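/- Let (φ₁,ψ₁), (φ₂,ψ₂), (φ₃,ψ₃) belong to H²(ℝ₊×ℝ₊)×H¹(ℝ₊×ℝ₊) and satisfy the compatibility conditions: φ₁(0,x₃) = φ₂(0,x₃) and ψ₁(0,x₃) = (∂φ₂/∂x₁)(0,x₃) and ψ₂(0,x₃) = (∂φ₁/∂x₂)(0,x₃) for all x₃ > 0; φ₂(x₁,0) = φ₃(x₁,0) and ψ₂(x₁,0) = (∂φ₃/∂x₂)(x₁,0) and ψ₃(x₁,0) = (∂φ₂/∂x₃)(x₁,0) for all x₁ > 0; φ₃(0,x₂) = φ₁(x₂,0) and ψ₁(x₂,0) = (∂φ₃/∂x₁)(0,x₂) and ψ₃(0,x₂) = (∂φ₁/∂x₃)(x₂,0) for all x₂ > 0. Then there exists ζ ∈ H^{5/2}(ℝ₊×ℝ₊×ℝ₊) such that (ζ, ∂ζ/∂x_i) = (φ_i, ψ_i) on the boundary face where x_i = 0, for i = 1, 2, 3. -/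

import Mathlib

open MeasureTheory Real Set
open scoped RealInnerProductSpace
noncomputable section

abbrev E2 := EuclideanSpace ℝ (Fin 2)
def stdb2 (i : Fin 2) : E2 := EuclideanSpace.single i 1
def L2on {n : ℕ} (Ω : Set (EuclideanSpace ℝ (Fin n))) (u : EuclideanSpace ℝ (Fin n) → ℝ) : Prop :=
  MemLp u 2 (volume.restrict Ω)
def IsWeakD {n : ℕ} (Ω : Set (EuclideanSpace ℝ (Fin n)))
    (u v : EuclideanSpace ℝ (Fin n) → ℝ) (d : EuclideanSpace ℝ (Fin n)) : Prop :=
  ∀ φ : EuclideanSpace ℝ (Fin n) → ℝ, ContDiff ℝ (⊤ : ℕ∞) φ → HasCompactSupport φ → tsupport φ ⊆ Ω →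
    ∫ x in Ω, u x * fderiv ℝ φ x d = - ∫ x in Ω, v x * φ x
def tri (p : Fin 3 → E2) : Set E2 := interior (convexHull ℝ (range p))
def evec (p : Fin 3 → E2) (i : Fin 3) : E2 := p (i + 2) - p (i + 1)
def elen (p : Fin 3 → E2) (i : Fin 3) : ℝ := ‖evec p i‖
def tangv (p : Fin 3 → E2) (i : Fin 3) : E2 := (elen p i)⁻¹ • evec p i
def norv (p : Fin 3 → E2) (i : Fin 3) : E2 :=
  EuclideanSpace.single 0 (tangv p i 1) + EuclideanSpace.single 1 (-(tangv p i 0))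
def epar (p : Fin 3 → E2) (i : Fin 3) (t : ℝ) : E2 := p (i + 1) + t • evec p i
def ccw (p : Fin 3 → E2) : Prop :=
  0 < (p 1 - p 0) 0 * (p 2 - p 0) 1 - (p 1 - p 0) 1 * (p 2 - p 0) 0
def tau (i j : Fin 3) : ℝ := if i = j + 1 then 0 else 1

/-- weak derivative on an open interval of `ℝ` -/
def IsWeakD1 (S : Set ℝ) (u v : ℝ → ℝ) : Prop :=
  ∀ φ : ℝ → ℝ, ContDiff ℝ (⊤ : ℕ∞) φ → HasCompactSupport φ → tsupport φ ⊆ S →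
    ∫ t in S, u t * deriv φ t = - ∫ t in S, v t * φ t

def MemHedge : ℕ → (ℝ → ℝ) → Prop
  | 0, u => MemLp u 2 (volume.restrict (Ioo (0:ℝ) 1))
  | (k+1), u => MemLp u 2 (volume.restrict (Ioo (0:ℝ) 1)) ∧
      ∃ v, IsWeakD1 (Ioo (0:ℝ) 1) u v ∧ MemHedge k v

/-- membership of edgewise data in `H²(∂T) × H¹(∂T)` (with pointwise C¹/C⁰ representatives) -/
def MemBdryH2H1 (f g : Fin 3 → ℝ → ℝ) : Prop :=
  ∀ i, MemHedge 2 (f i) ∧ ContDiffOn ℝ 1 (f i) (Icc 0 1) ∧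
    MemHedge 1 (g i) ∧ ContinuousOn (g i) (Icc 0 1)

/-- compatibility conditions (2.2)-(2.4) -/
def Compat (p : Fin 3 → E2) (f g : Fin 3 → ℝ → ℝ) : Prop :=
  (∀ i j k : Fin 3, j ≠ i → k ≠ i → f j (tau i j) = f k (tau i k)) ∧
  ∃ w : Fin 3 → E2, ∀ i j : Fin 3, j ≠ i →
    derivWithin (f j) (Icc 0 1) (tau i j) = elen p j * ⟪w i, tangv p j⟫ ∧
    g j (tau i j) = ⟪w i, norv p j⟫

/-- `H²` membership with explicit weak gradient and Hessian data -/
def MemH2W {n : ℕ} (Ω : Set (EuclideanSpace ℝ (Fin n))) (ξ : EuclideanSpace ℝ (Fin n) → ℝ)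
    (G : Fin n → EuclideanSpace ℝ (Fin n) → ℝ)
    (Hs : Fin n → Fin n → EuclideanSpace ℝ (Fin n) → ℝ) : Prop :=
  L2on Ω ξ ∧ (∀ d, L2on Ω (G d) ∧ IsWeakD Ω ξ (G d) (EuclideanSpace.single d 1)) ∧
  ∀ d d', L2on Ω (Hs d d') ∧ IsWeakD Ω (G d) (Hs d d') (EuclideanSpace.single d' 1)

/-- Gagliardo-type `H^{1/2}` seminorm finiteness for functions on a domain in `ℝⁿ` -/
def GagH12 {n : ℕ} (Ω : Set (EuclideanSpace ℝ (Fin n))) (u : EuclideanSpace ℝ (Fin n) → ℝ) : Prop :=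
  Integrable (fun q : EuclideanSpace ℝ (Fin n) × EuclideanSpace ℝ (Fin n) =>
    (u q.1 - u q.2) ^ 2 / ‖q.1 - q.2‖ ^ (n + 1)) ((volume.restrict Ω).prod (volume.restrict Ω))

/-- membership in `H^{5/2}` of a domain: weak `H²` data whose second derivatives have finite
`H^{1/2}` Gagliardo seminorm. -/
def MemH52 {n : ℕ} (Ω : Set (EuclideanSpace ℝ (Fin n))) (ζ : EuclideanSpace ℝ (Fin n) → ℝ) : Prop :=
  ∃ G Hs, MemH2W Ω ζ G Hs ∧ ∀ d d', GagH12 Ω (Hs d d')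

/-- pointwise trace relation `Tr ζ = (f,g)` on `∂T` for a `C¹` function -/
def TraceEq (p : Fin 3 → E2) (ζ : E2 → ℝ) (f g : Fin 3 → ℝ → ℝ) : Prop :=
  ∀ i : Fin 3, ∀ t ∈ Icc (0:ℝ) 1,
    ζ (epar p i t) = f i t ∧ fderiv ℝ ζ (epar p i t) (norv p i) = g i t

abbrev E3 := EuclideanSpace ℝ (Fin 3)
def stdb3 (i : Fin 3) : E3 := EuclideanSpace.single i 1

/-- the open quadrant `ℝ₊ × ℝ₊` -/
def quadrant : Set E2 := {x : E2 | 0 < x 0 ∧ 0 < x 1}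
/-- the open octant `ℝ₊ × ℝ₊ × ℝ₊` -/
def octant : Set E3 := {x : E3 | 0 < x 0 ∧ 0 < x 1 ∧ 0 < x 2}

/-- `H¹(ℝ₊×ℝ₊)` membership with explicit weak gradient -/
def MemH1Q (ψ : E2 → ℝ) (Gψ : Fin 2 → E2 → ℝ) : Prop :=
  L2on quadrant ψ ∧ ∀ d, L2on quadrant (Gψ d) ∧ IsWeakD quadrant ψ (Gψ d) (stdb2 d)

/-- `b₀, b₁` are the traces of `u` on the two boundary half-lines
`{y₀ = 0}` (parametrized by `y₁`) and `{y₁ = 0}` (parametrized by `y₀`) of the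
quadrant, in the sense of the divergence theorem; `Du` is the weak gradient of `u`. -/
def QuadTrace (u : E2 → ℝ) (Du : Fin 2 → E2 → ℝ) (b₀ b₁ : ℝ → ℝ) : Prop :=
  ∀ φ : E2 → ℝ, ContDiff ℝ (⊤ : ℕ∞) φ → HasCompactSupport φ → ∀ d : Fin 2,
    ∫ x in quadrant, (u x * fderiv ℝ φ x (stdb2 d) + Du d x * φ x)
      = -(if d = 0 then ∫ t in Ioi (0:ℝ), b₀ t * φ (EuclideanSpace.single 1 t)
          else ∫ t in Ioi (0:ℝ), b₁ t * φ (EuclideanSpace.single 0 t))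

/-- the embedding of the quadrant onto the face `{x_i = 0}` of the octant, the two
coordinates being the remaining ones in increasing order -/
def embFace (i : Fin 3) (y : E2) : E3 :=
  (y 0) • stdb3 (i.succAbove 0) + (y 1) • stdb3 (i.succAbove 1)

/-- `b i` is the trace of `u` on the face `{x_i = 0}` of the octant, in the sense of the
divergence theorem; `Du` is the weak gradient of `u`. -/
def OctTrace (u : E3 → ℝ) (Du : Fin 3 → E3 → ℝ) (b : Fin 3 → E2 → ℝ) : Prop :=
  ∀ φ : E3 → ℝ, ContDiff ℝ (⊤ : ℕ∞) φ → HasCompactSupport φ → ∀ d : Fin 3,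
    ∫ x in octant, (u x * fderiv ℝ φ x (stdb3 d) + Du d x * φ x)
      = -∫ y in quadrant, b d y * φ (embFace d y)

abbrev En (n : ℕ) := EuclideanSpace ℝ (Fin n)

/-- drop coordinate `e` -/
def pr {n : ℕ} (e : Fin (n+1)) : En (n+1) →L[ℝ] En n :=
  LinearMap.toContinuousLinearMap
    { toFun := fun x => WithLp.toLp 2 (fun m => x (e.succAbove m))
      map_add' := fun x y => by ext m; simp
      map_smul' := fun c x => by ext m; simp }

@[simp] lemma pr_apply {n : ℕ} (e : Fin (n+1)) (x : En (n+1)) (m : Fin n) :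
    pr e x m = x (e.succAbove m) := rfl

/-- insert coordinate `e` -/
def ins {n : ℕ} (e : Fin (n+1)) (t : ℝ) (y : En n) : En (n+1) :=
  WithLp.toLp 2 (Fin.insertNth (α := fun _ => ℝ) e t (fun m => y m))

@[simp] lemma ins_same {n : ℕ} (e : Fin (n+1)) (t : ℝ) (y : En n) : ins e t y e = t := by
  simp [ins]
@[simp] lemma ins_succAbove {n : ℕ} (e : Fin (n+1)) (t : ℝ) (y : En n) (m : Fin n) :
    ins e t y (e.succAbove m) = y m := by
  simp [ins]

lemma ext_succAbove {n : ℕ} (e : Fin (n+1)) {x x' : En (n+1)} (h : x e = x' e)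
    (h' : ∀ m, x (e.succAbove m) = x' (e.succAbove m)) : x = x' := by
  ext k
  rcases Fin.eq_self_or_eq_succAbove e k with rfl | ⟨m, rfl⟩
  · exact h
  · exact h' m

@[simp] lemma pr_ins {n : ℕ} (e : Fin (n+1)) (t : ℝ) (y : En n) : pr e (ins e t y) = y := by
  ext m; simp

@[simp] lemma ins_pr {n : ℕ} (e : Fin (n+1)) (x : En (n+1)) : ins e (x e) (pr e x) = x := by
  apply ext_succAbove e <;> simp

lemma ins_add {n : ℕ} (e : Fin (n+1)) (t t' : ℝ) (y y' : En n) :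
    ins e (t + t') (y + y') = ins e t y + ins e t' y' := by
  apply ext_succAbove e <;> simp

lemma ins_smul {n : ℕ} (e : Fin (n+1)) (c t : ℝ) (y : En n) :
    ins e (c * t) (c • y) = c • ins e t y := by
  apply ext_succAbove e <;> simp

/-- insertion as a continuous linear map -/
def insL {n : ℕ} (e : Fin (n+1)) : (ℝ × En n) →L[ℝ] En (n+1) :=
  LinearMap.toContinuousLinearMap
    { toFun := fun p => ins e p.1 p.2
      map_add' := fun p q => by simp [ins_add]
      map_smul' := fun c p => by simpa using ins_smul e c p.1 p.2 }

@[simp] lemma insL_apply {n : ℕ} (e : Fin (n+1)) (p : ℝ × En n) : insL e p = ins e p.1 p.2 := rfl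

@[fun_prop] lemma continuous_ins {n : ℕ} (e : Fin (n+1)) :
    Continuous (fun p : ℝ × En n => ins e p.1 p.2) := (insL e).continuous

lemma ins_sub {n : ℕ} (e : Fin (n+1)) (t t' : ℝ) (y y' : En n) :
    ins e (t - t') (y - y') = ins e t y - ins e t' y' := by
  apply ext_succAbove e <;> simp

lemma norm_sq_ins {n : ℕ} (e : Fin (n+1)) (t : ℝ) (y : En n) :
    ‖ins e t y‖ ^ 2 = t ^ 2 + ‖y‖ ^ 2 := by
  simp [EuclideanSpace.norm_sq_eq, Fin.sum_univ_succAbove _ e]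

lemma mp_ins {n : ℕ} (e : Fin (n+1)) :
    MeasurePreserving (fun p : ℝ × En n => ins e p.1 p.2) := by
  have h1 := (volume_preserving_piFinSuccAbove (fun _ : Fin (n+1) => ℝ) e).symm
  have h2 := (EuclideanSpace.volume_preserving_symm_measurableEquiv_toLp (Fin (n+1))).symm
  have h3 : MeasurePreserving (Prod.map id (MeasurableEquiv.toLp 2 (Fin n → ℝ)).symm :
      ℝ × En n → ℝ × (Fin n → ℝ)) :=
    (MeasurePreserving.id volume).prod
      (EuclideanSpace.volume_preserving_symm_measurableEquiv_toLp (Fin n))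
  exact (h2.comp h1).comp h3

/-- homeomorphism -/
def insH {n : ℕ} (e : Fin (n+1)) : (ℝ × En n) ≃ₜ En (n+1) where
  toFun p := ins e p.1 p.2
  invFun x := (x e, pr e x)
  left_inv p := by simp
  right_inv x := by simp
  continuous_toFun := continuous_ins e
  continuous_invFun := by fun_prop

lemma me_ins {n : ℕ} (e : Fin (n+1)) :
    MeasurableEmbedding (fun p : ℝ × En n => ins e p.1 p.2) :=
  (insH e).measurableEmbedding

/-- open positive cone -/
def pos (n : ℕ) : Set (En n) := {x | ∀ j, 0 < x j}

lemma quadrant_eq : quadrant = pos 2 := by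
  ext x; simp [quadrant, pos, Fin.forall_fin_two]
lemma octant_eq : octant = pos 3 := by
  ext x; simp [octant, pos, Fin.forall_fin_succ]

lemma isOpen_pos (n : ℕ) : IsOpen (pos n) := by
  have : pos n = ⋂ j, {x : En n | 0 < x j} := by ext; simp [pos]
  rw [this]
  exact isOpen_iInter_of_finite fun j => isOpen_lt continuous_const (by fun_prop)

lemma measurableSet_pos (n : ℕ) : MeasurableSet (pos n) := (isOpen_pos n).measurableSet

lemma embFace_eq (i : Fin 3) (y : E2) : embFace i y = ins i 0 y := by
  apply ext_succAbove i
  · simp [embFace, stdb3]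
  · intro m
    rw [ins_succAbove]
    fin_cases m <;> simp [embFace, stdb3, Pi.single_apply]

lemma ins_mem_pos {n : ℕ} (e : Fin (n+1)) (t : ℝ) (y : En n) :
    ins e t y ∈ pos (n+1) ↔ 0 < t ∧ y ∈ pos n := by
  simp only [pos, mem_ofPred_eq]
  rw [Fin.forall_iff_succAbove e]; simp

lemma integral_split {n : ℕ} (e : Fin (n+1)) (f : En (n+1) → ℝ) :
    ∫ x, f x = ∫ p : ℝ × En n, f (ins e p.1 p.2) :=
  ((mp_ins e).integral_comp (me_ins e) f).symm

lemma setIntegral_pos_split {n : ℕ} (e : Fin (n+1)) (f : En (n+1) → ℝ) :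
    ∫ x in pos (n+1), f x = ∫ p in (Ioi (0:ℝ)) ×ˢ pos n, f (ins e p.1 p.2) := by
  rw [← (mp_ins e).setIntegral_preimage_emb (me_ins e)]
  congr 2; ext p; simp [ins_mem_pos]

lemma lintegral_split {n : ℕ} (e : Fin (n+1)) (f : En (n+1) → ENNReal) :
    ∫⁻ x, f x = ∫⁻ p : ℝ × En n, f (ins e p.1 p.2) :=
  ((mp_ins e).lintegral_comp_emb (me_ins e) f).symm

/-- test functions -/
def IsTest {n : ℕ} (φ : En n → ℝ) : Prop := ContDiff ℝ (⊤ : ℕ∞) φ ∧ HasCompactSupport φ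

/-- partial derivative -/
def pd {n : ℕ} (j : Fin n) (φ : En n → ℝ) (x : En n) : ℝ :=
  fderiv ℝ φ x (EuclideanSpace.single j 1)

lemma IsTest.continuous {n : ℕ} {φ : En n → ℝ} (h : IsTest φ) : Continuous φ := h.1.continuous
lemma IsTest.differentiable {n : ℕ} {φ : En n → ℝ} (h : IsTest φ) : Differentiable ℝ φ :=
  h.1.differentiable (by simp)

lemma IsTest.pd {n : ℕ} {φ : En n → ℝ} (h : IsTest φ) (j : Fin n) : IsTest (pd j φ) := by
  refine ⟨?_, h.2.fderiv_apply ℝ _⟩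
  exact ContDiff.clm_apply (h.1.fderiv_right (by simp)) contDiff_const

lemma tsupport_pd {n : ℕ} (φ : En n → ℝ) (j : Fin n) : tsupport (pd j φ) ⊆ tsupport φ :=
  tsupport_fderiv_apply_subset ℝ _

lemma IsTest.mul_left {n : ℕ} {φ g : En n → ℝ} (h : IsTest φ) (hg : ContDiff ℝ (⊤ : ℕ∞) g) :
    IsTest (fun x => g x * φ x) := ⟨hg.mul h.1, h.2.mul_left⟩

lemma IsTest.memLp {n : ℕ} {φ : En n → ℝ} (h : IsTest φ) (p : ENNReal) (μ : Measure (En n))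
    [IsFiniteMeasureOnCompacts μ] : MemLp φ p μ :=
  h.continuous.memLp_of_hasCompactSupport h.2

lemma pd_mul {n : ℕ} {f g : En n → ℝ} (hf : Differentiable ℝ f) (hg : Differentiable ℝ g)
    (j : Fin n) (x : En n) : pd j (fun x => f x * g x) x = f x * pd j g x + pd j f x * g x := by
  unfold pd
  rw [fderiv_fun_mul (hf x) (hg x)]
  simp; ring

lemma pd_comp_clm {n k : ℕ} (A : En n →L[ℝ] En k) (φ : En k → ℝ) (hφ : Differentiable ℝ φ)
    (j : Fin n) (x : En n) :
    pd j (fun x => φ (A x)) x = fderiv ℝ φ (A x) (A (EuclideanSpace.single j 1)) := by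
  unfold pd
  have : HasFDerivAt (fun x => φ (A x)) ((fderiv ℝ φ (A x)).comp A) x :=
    (hφ (A x)).hasFDerivAt.comp x A.hasFDerivAt
  rw [this.fderiv]; rfl

lemma fderiv_eq_sum_pd {n : ℕ} (φ : En n → ℝ) (x v : En n) :
    fderiv ℝ φ x v = ∑ j, v j * pd j φ x := by
  have hv : v = ∑ j, v j • (EuclideanSpace.single j (1:ℝ)) := by
    ext k
    rw [WithLp.ofLp_sum, Finset.sum_apply]; simp [Finset.sum_ite_eq]
  conv_lhs => rw [hv]
  simp [pd]

lemma pd_comm {n : ℕ} {φ : En n → ℝ} (h : ContDiff ℝ (⊤ : ℕ∞) φ) (i j : Fin n) (x : En n) :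
    pd i (pd j φ) x = pd j (pd i φ) x := by
  have hs : IsSymmSndFDerivAt ℝ φ x := by
    apply (h.contDiffAt).isSymmSndFDerivAt
    rw [minSmoothness_of_isRCLikeNormedField]
    exact WithTop.coe_le_coe.2 le_top
  have hd : DifferentiableAt ℝ (fderiv ℝ φ) x :=
    ((h.fderiv_right (m := (⊤ : ℕ∞)) (by simp)).differentiable (by simp)) x
  have key : ∀ a b : Fin n, pd a (pd b φ) x
      = fderiv ℝ (fderiv ℝ φ) x (EuclideanSpace.single a 1) (EuclideanSpace.single b 1) := by
    intro a b
    unfold pd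
    have := (hd.hasFDerivAt).clm_apply (hasFDerivAt_const (EuclideanSpace.single b (1:ℝ)) x)
    rw [this.fderiv]; simp
  rw [key, key]; exact hs _ _

open Filter Topology in
lemma enorm_sq_real (a : ℝ) : ‖a‖ₑ ^ 2 = ENNReal.ofReal (a ^ 2) := by
  rw [Real.enorm_eq_ofReal_abs, ← ENNReal.ofReal_pow (abs_nonneg _), sq_abs]

/-- squared `L²` norm -/
def N2 {X : Type*} [MeasurableSpace X] (μ : Measure X) (f : X → ℝ) : ENNReal :=
  ∫⁻ x, ‖f x‖ₑ ^ 2 ∂μ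

lemma N2_eq {X : Type*} [MeasurableSpace X] (μ : Measure X) (f : X → ℝ) :
    N2 μ f = (eLpNorm f 2 μ) ^ 2 := by
  have := eLpNorm_nnreal_pow_eq_lintegral (f := f) (μ := μ) (p := 2) (by norm_num)
  unfold N2
  simpa using this.symm

lemma memLp_of_N2 {X : Type*} [MeasurableSpace X] {μ : Measure X} {f : X → ℝ}
    (hf : AEStronglyMeasurable f μ) (h : N2 μ f < ⊤) : MemLp f 2 μ := by
  refine ⟨hf, ?_⟩
  rw [N2_eq] at h
  by_contra hc
  simp only [not_lt, top_le_iff] at hc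
  simp [hc] at h

lemma _root_.MeasureTheory.MemLp.N2_lt {X : Type*} [MeasurableSpace X] {μ : Measure X} {f : X → ℝ}
    (hf : MemLp f 2 μ) : N2 μ f < ⊤ := by
  rw [N2_eq]; exact ENNReal.pow_lt_top hf.2

/-- weighted Cauchy–Schwarz -/
lemma lintegral_cs {X : Type*} [MeasurableSpace X] (μ : Measure X) {f g : X → ENNReal}
    (hf : AEMeasurable f μ) (hg : AEMeasurable g μ) :
    (∫⁻ x, f x * g x ∂μ) ^ 2 ≤ (∫⁻ x, f x ^ 2 ∂μ) * ∫⁻ x, g x ^ 2 ∂μ := by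
  have h := ENNReal.lintegral_mul_le_Lp_mul_Lq μ (p := 2) (q := 2)
    ⟨by norm_num, by norm_num, by norm_num⟩ hf hg
  have h2 := pow_le_pow_left' h 2
  refine (le_of_eq ?_).trans (h2.trans (le_of_eq ?_))
  · rfl
  · rw [mul_pow]
    have key : ∀ a : ENNReal, (a ^ (1 / (2:ℝ))) ^ 2 = a := by
      intro a
      rw [← ENNReal.rpow_natCast, ← ENNReal.rpow_mul]; norm_num
    rw [key, key]; simp

lemma lintegral_cs_w {X : Type*} [MeasurableSpace X] (μ : Measure X) {w g : X → ENNReal}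
    (hw : AEMeasurable w μ) (hg : AEMeasurable g μ) :
    (∫⁻ x, w x * g x ∂μ) ^ 2 ≤ (∫⁻ x, w x ∂μ) * ∫⁻ x, w x * g x ^ 2 ∂μ := by
  have key : ∀ a : ENNReal, (a ^ (1 / (2:ℝ))) ^ 2 = a := by
    intro a
    rw [← ENNReal.rpow_natCast, ← ENNReal.rpow_mul]; norm_num
  have h := lintegral_cs μ (f := fun x => (w x) ^ (1/(2:ℝ))) (g := fun x => (w x) ^ (1/(2:ℝ)) * g x)
    (hw.pow_const _) ((hw.pow_const _).mul hg)
  simp only [mul_pow, key] at h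
  refine (le_of_eq ?_).trans h
  congr 1
  refine lintegral_congr fun x => ?_
  rw [← mul_assoc, ← sq, key]

lemma N2_integral_mul {X : Type*} [MeasurableSpace X] {μ : Measure X} {f g : X → ℝ}
    (hf : AEStronglyMeasurable f μ) (hg : AEStronglyMeasurable g μ) :
    ‖∫ x, f x * g x ∂μ‖ₑ ^ 2 ≤ N2 μ f * N2 μ g := by
  calc ‖∫ x, f x * g x ∂μ‖ₑ ^ 2 ≤ (∫⁻ x, ‖f x * g x‖ₑ ∂μ) ^ 2 := by
        gcongr; exact enorm_integral_le_lintegral_enorm _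
    _ = (∫⁻ x, ‖f x‖ₑ * ‖g x‖ₑ ∂μ) ^ 2 := by simp only [enorm_mul]
    _ ≤ _ := lintegral_cs μ hf.enorm hg.enorm

lemma int_mul {X : Type*} [MeasurableSpace X] {μ : Measure X} {f g : X → ℝ}
    (hf : MemLp f 2 μ) (hg : MemLp g 2 μ) : Integrable (fun x => f x * g x) μ :=
  hf.integrable_mul hg

/-- `L²` convergence -/
def Conv {X : Type*} [MeasurableSpace X] (μ : Measure X) (f : ℕ → X → ℝ) (g : X → ℝ) : Prop :=
  (∀ n, MemLp (f n) 2 μ) ∧ MemLp g 2 μ ∧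
    Filter.Tendsto (fun n => N2 μ (fun x => f n x - g x)) Filter.atTop (nhds 0)

lemma Conv.tendsto {X : Type*} [MeasurableSpace X] {μ : Measure X} {f : ℕ → X → ℝ} {g : X → ℝ}
    (h : Conv μ f g) {θ : X → ℝ} (hθ : MemLp θ 2 μ) :
    Filter.Tendsto (fun n => ∫ x, f n x * θ x ∂μ) Filter.atTop (nhds (∫ x, g x * θ x ∂μ)) := by
  obtain ⟨h1, h2, h3⟩ := h
  rw [tendsto_iff_edist_tendsto_0]
  have hb : ∀ n, edist (∫ x, f n x * θ x ∂μ) (∫ x, g x * θ x ∂μ) ^ 2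
      ≤ N2 μ (fun x => f n x - g x) * N2 μ θ := by
    intro n
    rw [edist_eq_enorm_sub, ← integral_sub (int_mul (h1 n) hθ) (int_mul h2 hθ)]
    have := N2_integral_mul (μ := μ) ((h1 n).1.sub h2.1) hθ.1
    refine le_trans (le_of_eq ?_) this
    congr 2; refine integral_congr_ae (Filter.Eventually.of_forall fun x => ?_)
    simp [sub_mul]
  have h4 : Filter.Tendsto (fun n => N2 μ (fun x => f n x - g x) * N2 μ θ) Filter.atTop (nhds 0) := by
    have := ENNReal.Tendsto.mul_const (b := N2 μ θ) h3 (Or.inr hθ.N2_lt.ne)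
    simpa using this
  have h5 : Filter.Tendsto (fun n => edist (∫ x, f n x * θ x ∂μ) (∫ x, g x * θ x ∂μ) ^ 2)
      Filter.atTop (nhds 0) := tendsto_of_tendsto_of_tendsto_of_le_of_le tendsto_const_nhds h4
        (fun n => bot_le) hb
  have h6 := ((ENNReal.continuous_rpow_const (y := 1/2)).tendsto 0).comp h5
  have h7 : ((0:ENNReal)) ^ (1/2 : ℝ) = 0 := by simp
  rw [h7] at h6
  refine h6.congr fun n => ?_
  simp only [Function.comp]
  rw [← ENNReal.rpow_natCast, ← ENNReal.rpow_mul]; norm_num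

lemma N2_add_le {X : Type*} [MeasurableSpace X] {μ : Measure X} {f g : X → ℝ}
    (hf : AEStronglyMeasurable f μ) :
    N2 μ (fun x => f x + g x) ≤ 2 * N2 μ f + 2 * N2 μ g := by
  unfold N2
  rw [← lintegral_const_mul'' _ (hf.enorm.pow_const _),
    ← lintegral_const_mul' _ _ (by simp), ← lintegral_add_left' ((hf.enorm.pow_const _).const_mul _)]
  refine lintegral_mono fun x => ?_
  simp only [enorm_sq_real]
  rw [show (2:ENNReal) = ENNReal.ofReal 2 by simp, ← ENNReal.ofReal_mul (by norm_num),
    ← ENNReal.ofReal_mul (by norm_num), ← ENNReal.ofReal_add (by positivity) (by positivity)]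
  apply ENNReal.ofReal_le_ofReal
  nlinarith [sq_nonneg (f x - g x)]

lemma N2_const_mul {X : Type*} [MeasurableSpace X] {μ : Measure X} (c : ℝ) (f : X → ℝ) :
    N2 μ (fun x => c * f x) = ENNReal.ofReal (c^2) * N2 μ f := by
  unfold N2
  simp only [enorm_mul, mul_pow, enorm_sq_real c]
  rw [lintegral_const_mul' _ _ (by simp)]

lemma Conv.add {X : Type*} [MeasurableSpace X] {μ : Measure X} {f f' : ℕ → X → ℝ} {g g' : X → ℝ}
    (h : Conv μ f g) (h' : Conv μ f' g') :
    Conv μ (fun n x => f n x + f' n x) (fun x => g x + g' x) := by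
  refine ⟨fun n => (h.1 n).add (h'.1 n), h.2.1.add h'.2.1, ?_⟩
  have h4 : Filter.Tendsto (fun n => 2 * N2 μ (fun x => f n x - g x) + 2 * N2 μ (fun x => f' n x - g' x))
      Filter.atTop (nhds 0) := by
    have a := ENNReal.Tendsto.const_mul (a := 2) h.2.2 (Or.inr (by simp))
    have b := ENNReal.Tendsto.const_mul (a := 2) h'.2.2 (Or.inr (by simp))
    simpa using a.add b
  refine tendsto_of_tendsto_of_tendsto_of_le_of_le tendsto_const_nhds h4 (fun n => bot_le) fun n => ?_
  refine le_trans (le_of_eq ?_) (N2_add_le ((h.1 n).1.sub h.2.1.1))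
  congr 1; ext x; simp; ring

lemma Conv.const_zero {X : Type*} [MeasurableSpace X] {μ : Measure X} :
    Conv μ (fun _ _ => 0) (fun _ => (0:ℝ)) := by
  refine ⟨fun n => MemLp.zero', MemLp.zero', ?_⟩
  simp [N2]

lemma Conv.sum {X ι : Type*} [MeasurableSpace X] {μ : Measure X} (S : Finset ι)
    {f : ι → ℕ → X → ℝ} {g : ι → X → ℝ} (h : ∀ j, Conv μ (f j) (g j)) :
    Conv μ (fun n x => ∑ j ∈ S, f j n x) (fun x => ∑ j ∈ S, g j x) := by
  classical
  induction S using Finset.induction_on with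
  | empty => simpa using Conv.const_zero
  | insert a S ha ih => simp only [Finset.sum_insert ha]; exact (h a).add ih

/-- measurable `L²` functions on the plane -/
def L2M (h : En 2 → ℝ) : Prop := Measurable h ∧ MemLp h 2 volume

def T0 (L h : En 2 → ℝ) (z : ℝ) (y : En 2) : ℝ := ∫ s, L s * h (y + z • s)

def term (i : Fin 3) (c : ℝ → ℝ) (L h : En 2 → ℝ) (x : En 3) : ℝ :=
  c (x i) * T0 L h (x i) (pr i x)

lemma lintegral_affine {n : ℕ} (f : En n → ENNReal) (hf : Measurable f) (y : En n) {z : ℝ} (hz : z ≠ 0) :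
    ∫⁻ s, f (y + z • s) = ENNReal.ofReal (|z|⁻¹ ^ n) * ∫⁻ s, f s := by
  have h1 : ∫⁻ s, f (y + z • s) = ∫⁻ s, f (y + s) ∂(Measure.map (fun s : En n => z • s) volume) := by
    rw [lintegral_map (by fun_prop) (by fun_prop)]
  rw [h1, Measure.map_addHaar_smul _ hz, lintegral_smul_measure, lintegral_add_left_eq_self]
  simp [abs_inv, abs_pow]

lemma L2M.affine {h : En 2 → ℝ} (hh : L2M h) (y : En 2) {z : ℝ} (hz : z ≠ 0) :
    MemLp (fun s => h (y + z • s)) 2 volume := by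
  have hm := hh.1
  refine memLp_of_N2 (Measurable.aestronglyMeasurable (by fun_prop)) ?_
  unfold N2
  rw [lintegral_affine (fun s => ‖h s‖ₑ ^ 2) (by fun_prop) y hz]
  exact ENNReal.mul_lt_top (by simp) hh.2.N2_lt

lemma T0_int {L h : En 2 → ℝ} (hL : IsTest L) (hh : L2M h) (z : ℝ) (y : En 2) :
    Integrable (fun s => L s * h (y + z • s)) := by
  by_cases hz : z = 0
  · subst hz
    simp only [zero_smul, add_zero]
    exact (memLp_one_iff_integrable.1 (hL.memLp 1 _)).mul_const _
  · exact int_mul (hL.memLp 2 _) (hh.affine y hz)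

lemma T0_zero (L h : En 2 → ℝ) (y : En 2) : T0 L h 0 y = (∫ s, L s) * h y := by
  simp [T0, integral_mul_const]

lemma T0_sub {L h h' : En 2 → ℝ} (hL : IsTest L) (hh : L2M h) (hh' : L2M h') (z : ℝ) (y : En 2) :
    T0 L (fun s => h s - h' s) z y = T0 L h z y - T0 L h' z y := by
  unfold T0
  rw [← integral_sub (T0_int hL hh z y) (T0_int hL hh' z y)]
  simp only [mul_sub]

/-- uniform bound -/
lemma T0_sup {L h : En 2 → ℝ} (hL : IsTest L) (hh : L2M h) {z : ℝ} (hz : z ≠ 0) (y : En 2) :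
    ‖T0 L h z y‖ₑ ^ 2 ≤ N2 volume L * (ENNReal.ofReal (|z|⁻¹ ^ 2) * N2 volume h) := by
  have hm := hh.1
  refine (N2_integral_mul (hL.memLp 2 _).1 (hh.affine y hz).1).trans (le_of_eq ?_)
  congr 1
  unfold N2
  exact lintegral_affine (fun s => ‖h s‖ₑ ^ 2) (by fun_prop) y hz

lemma avg_meas {X : Type*} [MeasurableSpace X] {L h : En 2 → ℝ} (hL : IsTest L) (hh : Measurable h)
    {Ψ : X × En 2 → En 2} (hΨ : Measurable Ψ) :
    Measurable (fun x => ∫ s, L s * h (Ψ (x, s))) := by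
  have hLm := hL.continuous.measurable
  have : StronglyMeasurable (Function.uncurry fun x s => L s * h (Ψ (x, s))) := by
    apply Measurable.stronglyMeasurable
    simp only [Function.uncurry_def]
    fun_prop
  exact this.integral_prod_right.measurable

lemma T0_meas {L h : En 2 → ℝ} (hL : IsTest L) (hh : Measurable h) :
    Measurable (fun p : ℝ × En 2 => T0 L h p.1 p.2) := by
  refine avg_meas hL hh (Ψ := fun q : (ℝ × En 2) × En 2 => q.1.2 + q.1.1 • q.2) ?_
  fun_prop

lemma term_meas {L h : En 2 → ℝ} (hL : IsTest L) (hh : Measurable h) {c : ℝ → ℝ} (hc : Measurable c)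
    (i : Fin 3) : Measurable (term i c L h) := by
  unfold term
  refine Measurable.mul (by fun_prop) ?_
  exact (T0_meas hL hh).comp (g := fun p : ℝ × En 2 => T0 L h p.1 p.2)
    (f := fun x : En 3 => (x i, pr i x)) (by fun_prop)

lemma avg_bound {X : Type*} [MeasurableSpace X] {μ : Measure X} [SFinite μ] {L h : En 2 → ℝ}
    (hL : IsTest L) (hh : Measurable h) {Ψ : X × En 2 → En 2} (hΨ : Measurable Ψ) (C : ENNReal)
    (hC : ∀ s, L s ≠ 0 → ∀ f : En 2 → ENNReal, Measurable f → ∫⁻ x, f (Ψ (x, s)) ∂μ ≤ C * ∫⁻ y, f y) :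
    N2 μ (fun x => ∫ s, L s * h (Ψ (x, s))) ≤ C * (∫⁻ s, ‖L s‖ₑ) ^ 2 * N2 volume h := by
  have hLm := hL.continuous.measurable
  calc N2 μ (fun x => ∫ s, L s * h (Ψ (x, s)))
      ≤ ∫⁻ x, ((∫⁻ s, ‖L s‖ₑ) * ∫⁻ s, ‖L s‖ₑ * ‖h (Ψ (x, s))‖ₑ ^ 2) ∂μ := by
        unfold N2
        refine lintegral_mono fun x => ?_
        refine le_trans ?_ (lintegral_cs_w volume (w := fun s => ‖L s‖ₑ)
          (g := fun s => ‖h (Ψ (x, s))‖ₑ) (by fun_prop) (by fun_prop))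
        gcongr
        refine (enorm_integral_le_lintegral_enorm _).trans (le_of_eq ?_)
        simp only [enorm_mul]
    _ = (∫⁻ s, ‖L s‖ₑ) * ∫⁻ x, (∫⁻ s, ‖L s‖ₑ * ‖h (Ψ (x, s))‖ₑ ^ 2) ∂μ := by
        rw [lintegral_const_mul]
        exact Measurable.lintegral_prod_right' (f := fun q : X × En 2 => ‖L q.2‖ₑ * ‖h (Ψ q)‖ₑ ^ 2)
          (by fun_prop)
    _ = (∫⁻ s, ‖L s‖ₑ) * ∫⁻ s, ∫⁻ x, ‖L s‖ₑ * ‖h (Ψ (x, s))‖ₑ ^ 2 ∂μ := by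
        rw [lintegral_lintegral_swap]; fun_prop
    _ ≤ (∫⁻ s, ‖L s‖ₑ) * ∫⁻ s, ‖L s‖ₑ * (C * N2 volume h) := by
        gcongr with s
        by_cases hs : L s = 0
        · simp [hs]
        · rw [lintegral_const_mul _ (by fun_prop)]
          gcongr
          exact hC s hs (fun y => ‖h y‖ₑ ^ 2) (by fun_prop)
    _ = _ := by
        rw [lintegral_mul_const _ (by fun_prop)]; ring

lemma test_lint_lt {L : En 2 → ℝ} (hL : IsTest L) : (∫⁻ s, ‖L s‖ₑ) < ⊤ :=
  (memLp_one_iff_integrable.1 (hL.memLp 1 volume)).2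

/-- geometric bound in space: slab -/
lemma geo3 (i : Fin 3) (R : ℝ) (s : En 2) (f : En 2 → ENNReal) (hf : Measurable f) :
    ∫⁻ x in {x : En 3 | |x i| ≤ R}, f (pr i x + x i • s) ≤ ENNReal.ofReal (2 * R) * ∫⁻ y, f y := by
  have hS : MeasurableSet {x : En 3 | |x i| ≤ R} := measurableSet_le (by fun_prop) (by fun_prop)
  rw [← lintegral_indicator hS, lintegral_split i, Measure.volume_eq_prod]
  rw [lintegral_prod _ (by
    apply Measurable.aemeasurable
    have : Measurable ({x : En 3 | |x i| ≤ R}.indicator fun x => f (pr i x + x i • s)) :=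
      Measurable.indicator (by fun_prop) hS
    exact this.comp (continuous_ins i).measurable)]
  have h1 : ∀ z : ℝ, ∫⁻ y : En 2, {x : En 3 | |x i| ≤ R}.indicator
      (fun x => f (pr i x + x i • s)) (ins i z y)
      = (Icc (-R) R).indicator (fun _ => ∫⁻ y, f y) z := by
    intro z
    by_cases hz : |z| ≤ R
    · have : z ∈ Icc (-R) R := abs_le.1 hz
      simp only [indicator, mem_ofPred_eq, ins_same, hz, this, if_true, pr_ins]
      rw [lintegral_add_right_eq_self]
    · have : z ∉ Icc (-R) R := fun h => hz (abs_le.2 h)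
      simp [indicator, hz, this]
  simp only [h1]
  rw [lintegral_indicator measurableSet_Icc, lintegral_const]
  rw [mul_comm]; simp [two_mul]

lemma ins_lat {n : ℕ} (i : Fin (n+2)) (m : Fin (n+1)) (t : ℝ) (y : En (n+1)) :
    ins (i.succAbove m) t y i = y (m.predAbove i) := by
  have := ins_succAbove (i.succAbove m) t y (m.predAbove i)
  rwa [Fin.succAbove_succAbove_predAbove] at this

/-- geometric bound on lateral faces -/
lemma geo2 (i : Fin 3) (m : Fin 2) (s : En 2) (hs : s m ≠ 0) (f : En 2 → ENNReal) (hf : Measurable f) :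
    ∫⁻ y : En 2, f (pr i (ins (i.succAbove m) 0 y) + (ins (i.succAbove m) 0 y i) • s)
      = ENNReal.ofReal (|s m|⁻¹) * ∫⁻ y, f y := by
  rw [lintegral_split (m.predAbove i), lintegral_split m]
  have e1 : ∀ p : ℝ × En 1, pr i (ins (i.succAbove m) 0 (ins (m.predAbove i) p.1 p.2))
        + (ins (i.succAbove m) 0 (ins (m.predAbove i) p.1 p.2) i) • s
      = ins m (p.1 * s m) (p.2 + p.1 • pr m s) := by
    intro p
    have e2 : ins (i.succAbove m) 0 (ins (m.predAbove i) p.1 p.2) i = p.1 := by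
      rw [ins_lat, ins_same]
    rw [e2]
    apply ext_succAbove m
    · simp
    · intro k
      have : ins (i.succAbove m) 0 (ins (m.predAbove i) p.1 p.2) (i.succAbove (m.succAbove k)) = p.2 k := by
        rw [← Fin.succAbove_succAbove_succAbove_predAbove i m k]; simp
      simp [this]
  simp only [e1]
  have hm1 : Measurable fun p : ℝ × En 1 => f (ins m p.1 p.2) :=
    hf.comp (continuous_ins m).measurable
  rw [Measure.volume_eq_prod, lintegral_prod _ (by
    apply Measurable.aemeasurable
    exact hm1.comp (f := fun p : ℝ × En 1 => (p.1 * s m, p.2 + p.1 • pr m s)) (by fun_prop)),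
    lintegral_prod _ hm1.aemeasurable]
  have e3 : ∀ z : ℝ, ∫⁻ y : En 1, f (ins m (z * s m) (y + z • pr m s))
      = ∫⁻ y : En 1, f (ins m (z * s m) y) := fun z =>
    lintegral_add_right_eq_self (fun y : En 1 => f (ins m (z * s m) y)) _
  simp only [e3]
  have hm2 : Measurable fun z : ℝ => ∫⁻ y : En 1, f (ins m z y) := hm1.lintegral_prod_right'
  have h1 : ∫⁻ z : ℝ, ∫⁻ y : En 1, f (ins m (z * s m) y)
      = ∫⁻ z : ℝ, (∫⁻ y : En 1, f (ins m z y)) ∂(Measure.map (fun z : ℝ => z * s m) volume) := by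
    rw [lintegral_map hm2 (by fun_prop)]
  rw [h1, Real.map_volume_mul_right hs, lintegral_smul_measure]
  simp [abs_inv]

/-- kernels supported in a signed cone -/
def Ker (neg : Fin 2 → Prop) (L : En 2 → ℝ) : Prop :=
  IsTest L ∧ ∃ c > 0, ∀ s ∈ tsupport L, ∀ m, (neg m → s m ≤ -c) ∧ (¬ neg m → c ≤ s m)

/-- cutoff functions of the normal variable -/
def Cut (c : ℝ → ℝ) : Prop := ContDiff ℝ (⊤ : ℕ∞) c ∧ HasCompactSupport c

lemma Cut.bound {c : ℝ → ℝ} (h : Cut c) : ∃ M R : ℝ, 0 ≤ M ∧ 0 ≤ R ∧ ∀ z, |c z| ≤ M ∧ (R < |z| → c z = 0) := by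
  obtain ⟨M, hM⟩ := h.2.exists_bound_of_continuous h.1.continuous
  obtain ⟨R, hR⟩ := h.2.isCompact.isBounded.subset_closedBall 0
  refine ⟨|M|, |R|, abs_nonneg _, abs_nonneg _, fun z => ⟨(hM z).trans (le_abs_self _), fun hz => ?_⟩⟩
  by_contra hc
  have := hR (subset_tsupport _ hc)
  simp only [Metric.mem_closedBall, dist_zero_right, norm_eq_abs] at this
  linarith [le_abs_self R]

lemma Cut.deriv {c : ℝ → ℝ} (h : Cut c) : Cut (deriv c) :=
  ⟨((contDiff_infty_iff_deriv (𝕜 := ℝ) (f := c)).1 h.1).2, h.2.deriv⟩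

lemma Ker.pd {neg : Fin 2 → Prop} {L : En 2 → ℝ} (h : Ker neg L) (m : Fin 2) : Ker neg (pd m L) :=
  ⟨h.1.pd m, h.2.imp fun _ hc => ⟨hc.1, fun s hs => hc.2 s (tsupport_pd L m hs)⟩⟩

lemma Ker.mul {neg : Fin 2 → Prop} {L : En 2 → ℝ} (h : Ker neg L) (m : Fin 2) :
    Ker neg (fun s => s m * L s) :=
  ⟨h.1.mul_left (by fun_prop), h.2.imp fun _ hc => ⟨hc.1, fun s hs => hc.2 s
    (closure_mono (Function.support_mul_subset_right _ _) hs)⟩⟩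

lemma Ker.coord {neg : Fin 2 → Prop} {L : En 2 → ℝ} (h : Ker neg L) :
    ∃ c > 0, ∀ s, L s ≠ 0 → ∀ m, c ≤ |s m| := by
  obtain ⟨c, hc, h⟩ := h.2
  refine ⟨c, hc, fun s hs m => ?_⟩
  have := h s (subset_tsupport _ hs) m
  by_cases hn : neg m
  · rw [le_abs]; right; linarith [this.1 hn]
  · rw [le_abs]; left; exact this.2 hn

lemma N2_mul_le {X : Type*} [MeasurableSpace X] {μ : Measure X} (M : ℝ) {f g : X → ℝ}
    (h : ∀ x, |f x| ≤ M * |g x|) : N2 μ f ≤ ENNReal.ofReal (M ^ 2) * N2 μ g := by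
  rw [← N2_const_mul]
  unfold N2
  refine lintegral_mono fun x => ?_
  simp only [enorm_sq_real]
  apply ENNReal.ofReal_le_ofReal
  rw [sq_le_sq, abs_mul]
  exact (h x).trans (by gcongr; exact le_abs_self M)

lemma term_bound {neg : Fin 2 → Prop} {L : En 2 → ℝ} (hL : Ker neg L) {c : ℝ → ℝ} (hc : Cut c) (i : Fin 3) :
    ∃ C : ENNReal, C < ⊤ ∧ ∀ h : En 2 → ℝ, Measurable h →
      N2 (volume.restrict (pos 3)) (term i c L h) ≤ C * N2 volume h ∧
      ∀ e, N2 (volume.restrict (pos 2)) (fun y => term i c L h (ins e 0 y)) ≤ C * N2 volume h := by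
  obtain ⟨M, R, hM0, hR0, hMR⟩ := hc.bound
  obtain ⟨k, hk, hks⟩ := hL.coord
  have hLl := test_lint_lt hL.1
  set A := (∫⁻ s, ‖L s‖ₑ) ^ 2 with hA
  have hAt : A < ⊤ := ENNReal.pow_lt_top hLl
  set C1 := ENNReal.ofReal (M^2) * (ENNReal.ofReal (2*R) * A)
  set C2 := ENNReal.ofReal (M^2) * (ENNReal.ofReal (k⁻¹) * A)
  set C3 := ENNReal.ofReal ((M * |∫ s, L s|)^2)
  refine ⟨C1 + C2 + C3, ?_, fun h hh => ⟨?_, fun e => ?_⟩⟩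
  · have h1 : C1 < ⊤ := ENNReal.mul_lt_top ENNReal.ofReal_lt_top (ENNReal.mul_lt_top ENNReal.ofReal_lt_top hAt)
    have h2 : C2 < ⊤ := ENNReal.mul_lt_top (by simp) (ENNReal.mul_lt_top (by simp) hAt)
    exact ENNReal.add_lt_top.2 ⟨ENNReal.add_lt_top.2 ⟨h1, h2⟩, by simp [C3]⟩
  · have hS : MeasurableSet {x : En 3 | |x i| ≤ R} := measurableSet_le (by fun_prop) (by fun_prop)
    have h1 : N2 (volume.restrict (pos 3)) (term i c L h)
        ≤ N2 (volume.restrict {x : En 3 | |x i| ≤ R}) (term i c L h) := by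
      unfold N2
      calc _ ≤ ∫⁻ x, ‖term i c L h x‖ₑ ^ 2 := setLIntegral_le_lintegral _ _
        _ = ∫⁻ x, {x : En 3 | |x i| ≤ R}.indicator (fun x => ‖term i c L h x‖ₑ ^ 2) x := by
          refine lintegral_congr fun x => ?_
          by_cases hx : |x i| ≤ R
          · simp [indicator, hx]
          · simp [indicator, hx, term, (hMR (x i)).2 (not_le.1 hx)]
        _ = _ := lintegral_indicator hS _
    have h2 : N2 (volume.restrict {x : En 3 | |x i| ≤ R}) (term i c L h)
        ≤ ENNReal.ofReal (M^2) * N2 (volume.restrict {x : En 3 | |x i| ≤ R})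
          (fun x => ∫ s, L s * h (pr i x + x i • s)) := by
      refine N2_mul_le M fun x => ?_
      rw [term, abs_mul]
      exact mul_le_mul_of_nonneg_right (hMR _).1 (abs_nonneg _)
    have h3 := avg_bound (μ := volume.restrict {x : En 3 | |x i| ≤ R}) hL.1 hh
      (Ψ := fun q : En 3 × En 2 => pr i q.1 + q.1 i • q.2) (by fun_prop) (ENNReal.ofReal (2*R))
      (fun s _ f hf => geo3 i R s f hf)
    refine h1.trans (h2.trans ?_)
    calc _ ≤ ENNReal.ofReal (M^2) * (ENNReal.ofReal (2*R) * A * N2 volume h) := by gcongr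
      _ = C1 * N2 volume h := by simp only [C1]; ring
      _ ≤ _ := by gcongr; rw [add_assoc]; exact le_self_add
  · refine (lintegral_mono' Measure.restrict_le_self le_rfl).trans ?_
    change N2 volume (fun y => term i c L h (ins e 0 y)) ≤ _
    rcases Fin.eq_self_or_eq_succAbove i e with rfl | ⟨m, rfl⟩
    · have h1 : N2 volume (fun y => term e c L h (ins e 0 y)) ≤ C3 * N2 volume h := by
        refine N2_mul_le _ fun y => ?_
        simp only [term, ins_same, pr_ins, T0_zero, abs_mul]
        rw [← mul_assoc]
        gcongr
        exact (hMR 0).1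
      refine h1.trans ?_
      gcongr
      exact le_add_self
    · have h2 : N2 volume (fun y => term i c L h (ins (i.succAbove m) 0 y))
          ≤ ENNReal.ofReal (M^2) * N2 volume (fun y => ∫ s, L s *
            h (pr i (ins (i.succAbove m) 0 y) + (ins (i.succAbove m) 0 y i) • s)) := by
        refine N2_mul_le M fun x => ?_
        rw [term, abs_mul]
        exact mul_le_mul_of_nonneg_right (hMR _).1 (abs_nonneg _)
      have hcont : Continuous (fun y : En 2 => ins (i.succAbove m) 0 y) :=
        (continuous_ins (i.succAbove m)).comp (f := fun y : En 2 => ((0:ℝ), y)) (by fun_prop)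
      have h3 := avg_bound (μ := volume) hL.1 hh
        (Ψ := fun q : En 2 × En 2 => pr i (ins (i.succAbove m) 0 q.1) +
          (ins (i.succAbove m) 0 q.1 i) • q.2) (by
            apply Continuous.measurable
            fun_prop) (ENNReal.ofReal (k⁻¹))
        (fun s hs f hf => by
          have := hks s hs m
          have h0 : s m ≠ 0 := by intro h0; rw [h0] at this; simp at this; linarith
          refine (geo2 i m s h0 f hf).le.trans ?_
          gcongr)
      refine h2.trans ?_
      calc _ ≤ ENNReal.ofReal (M^2) * (ENNReal.ofReal (k⁻¹) * A * N2 volume h) := by gcongr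
        _ = C2 * N2 volume h := by simp only [C2]; ring
        _ ≤ _ := by gcongr; rw [add_comm C1, add_assoc]; exact le_self_add

/-- convergence on the octant and all faces -/
def JConv (f : ℕ → En 3 → ℝ) (g : En 3 → ℝ) : Prop :=
  Conv (volume.restrict (pos 3)) f g ∧
    ∀ e, Conv (volume.restrict (pos 2)) (fun n y => f n (ins e 0 y)) (fun y => g (ins e 0 y))

/-- `L²` on the octant and all faces -/
def JL2 (g : En 3 → ℝ) : Prop := Measurable g ∧
  MemLp g 2 (volume.restrict (pos 3)) ∧ ∀ e, MemLp (fun y => g (ins e 0 y)) 2 (volume.restrict (pos 2))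

lemma measurable_ins0 {n : ℕ} (e : Fin (n+1)) : Measurable (fun y : En n => ins e 0 y) :=
  ((continuous_ins e).comp (f := fun y : En n => ((0:ℝ), y)) (by fun_prop)).measurable

lemma term_JL2 {neg : Fin 2 → Prop} {L : En 2 → ℝ} (hL : Ker neg L) {c : ℝ → ℝ} (hc : Cut c) (i : Fin 3)
    {h : En 2 → ℝ} (hh : L2M h) : JL2 (term i c L h) := by
  obtain ⟨C, hC, hb⟩ := term_bound hL hc i
  have hm : Measurable (term i c L h) := term_meas hL.1 hh.1 hc.1.continuous.measurable i
  have hlt : C * N2 volume h < ⊤ := ENNReal.mul_lt_top hC hh.2.N2_lt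
  refine ⟨hm, memLp_of_N2 hm.aestronglyMeasurable ((hb h hh.1).1.trans_lt hlt), fun e =>
    memLp_of_N2 (hm.comp (measurable_ins0 e)).aestronglyMeasurable (((hb h hh.1).2 e).trans_lt hlt)⟩

lemma term_sub {L h h' : En 2 → ℝ} (hL : IsTest L) (hh : L2M h) (hh' : L2M h') (c : ℝ → ℝ) (i : Fin 3)
    (x : En 3) : term i c L (fun s => h s - h' s) x = term i c L h x - term i c L h' x := by
  simp only [term, T0_sub hL hh hh']; ring

lemma term_JConv {neg : Fin 2 → Prop} {L : En 2 → ℝ} (hL : Ker neg L) {c : ℝ → ℝ} (hc : Cut c) (i : Fin 3)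
    {f : ℕ → En 2 → ℝ} {h : En 2 → ℝ} (hf : ∀ n, Measurable (f n)) (hh : Measurable h)
    (hfh : Conv volume f h) : JConv (fun n => term i c L (f n)) (term i c L h) := by
  obtain ⟨C, hC, hb⟩ := term_bound hL hc i
  have h1 := fun n => term_JL2 hL hc i ⟨hf n, hfh.1 n⟩
  have h2 := term_JL2 hL hc i ⟨hh, hfh.2.1⟩
  have h3 : Filter.Tendsto (fun n => C * N2 volume (fun x => f n x - h x)) Filter.atTop (nhds 0) := by
    simpa using ENNReal.Tendsto.const_mul (a := C) hfh.2.2 (Or.inr hC.ne)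
  refine ⟨⟨fun n => (h1 n).2.1, h2.2.1, ?_⟩, fun e => ⟨fun n => (h1 n).2.2 e, h2.2.2 e, ?_⟩⟩
  · refine tendsto_of_tendsto_of_tendsto_of_le_of_le tendsto_const_nhds h3 (fun n => bot_le) fun n => ?_
    have := (hb (fun x => f n x - h x) ((hf n).sub hh)).1
    refine le_trans (le_of_eq ?_) this
    congr 1; ext x; exact (term_sub hL.1 ⟨hf n, hfh.1 n⟩ ⟨hh, hfh.2.1⟩ c i x).symm
  · refine tendsto_of_tendsto_of_tendsto_of_le_of_le tendsto_const_nhds h3 (fun n => bot_le) fun n => ?_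
    have := (hb (fun x => f n x - h x) ((hf n).sub hh)).2 e
    refine le_trans (le_of_eq ?_) this
    congr 1; ext x; exact (term_sub hL.1 ⟨hf n, hfh.1 n⟩ ⟨hh, hfh.2.1⟩ c i _).symm

lemma JConv.add {f f' : ℕ → En 3 → ℝ} {g g' : En 3 → ℝ} (h : JConv f g) (h' : JConv f' g') :
    JConv (fun n x => f n x + f' n x) (fun x => g x + g' x) :=
  ⟨h.1.add h'.1, fun e => (h.2 e).add (h'.2 e)⟩

lemma JConv.sum {ι : Type*} (S : Finset ι) {f : ι → ℕ → En 3 → ℝ} {g : ι → En 3 → ℝ}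
    (h : ∀ j, JConv (f j) (g j)) :
    JConv (fun n x => ∑ j ∈ S, f j n x) (fun x => ∑ j ∈ S, g j x) :=
  ⟨Conv.sum S fun j => (h j).1, fun e => Conv.sum S fun j => (h j).2 e⟩

/-- gradient of `term` -/
def dterm (i : Fin 3) (c : ℝ → ℝ) (L h : En 2 → ℝ) (Dh : Fin 2 → En 2 → ℝ) (d : Fin 3) (x : En 3) : ℝ :=
  Fin.insertNth (α := fun _ => ℝ) i
    (term i (deriv c) L h x + ∑ m, term i c (fun s => s m * L s) (Dh m) x)
    (fun m => term i c L (Dh m) x) d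

lemma dterm_same (i : Fin 3) (c : ℝ → ℝ) (L h : En 2 → ℝ) (Dh : Fin 2 → En 2 → ℝ) (x : En 3) :
    dterm i c L h Dh i x
      = term i (deriv c) L h x + ∑ m, term i c (fun s => s m * L s) (Dh m) x := by
  simp [dterm]
lemma dterm_succ (i : Fin 3) (c : ℝ → ℝ) (L h : En 2 → ℝ) (Dh : Fin 2 → En 2 → ℝ) (m : Fin 2) (x : En 3) :
    dterm i c L h Dh (i.succAbove m) x = term i c L (Dh m) x := by
  simp [dterm]

lemma dterm_JConv {neg : Fin 2 → Prop} {L : En 2 → ℝ} (hL : Ker neg L) {c : ℝ → ℝ} (hc : Cut c) (i : Fin 3)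
    {f : ℕ → En 2 → ℝ} {h : En 2 → ℝ} (hf : ∀ n, Measurable (f n)) (hh : Measurable h)
    (hfh : Conv volume f h) {Df : ℕ → Fin 2 → En 2 → ℝ} {Dh : Fin 2 → En 2 → ℝ}
    (hDf : ∀ n m, Measurable (Df n m)) (hDh : ∀ m, Measurable (Dh m))
    (hDfh : ∀ m, Conv volume (fun n => Df n m) (Dh m)) (d : Fin 3) :
    JConv (fun n => dterm i c L (f n) (Df n) d) (dterm i c L h Dh d) := by
  rcases Fin.eq_self_or_eq_succAbove i d with rfl | ⟨m, rfl⟩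
  · simp only [funext (dterm_same d c L h Dh), funext (dterm_same d c L (f _) (Df _))]
    exact (term_JConv hL hc.deriv d hf hh hfh).add
      (JConv.sum _ fun m => term_JConv (hL.mul m) hc d (fun n => hDf n m) (hDh m) (hDfh m))
  · simp only [funext (dterm_succ i c L h Dh m), funext (dterm_succ i c L (f _) (Df _) m)]
    exact term_JConv hL hc i (fun n => hDf n m) (hDh m) (hDfh m)

lemma JL2.add {f g : En 3 → ℝ} (hf : JL2 f) (hg : JL2 g) : JL2 (fun x => f x + g x) :=
  ⟨hf.1.add hg.1, hf.2.1.add hg.2.1, fun e => (hf.2.2 e).add (hg.2.2 e)⟩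

lemma JL2.sum {ι : Type*} (S : Finset ι) {f : ι → En 3 → ℝ} (h : ∀ j, JL2 (f j)) :
    JL2 (fun x => ∑ j ∈ S, f j x) :=
  ⟨Finset.measurable_fun_sum _ fun j _ => (h j).1, memLp_finsetSum _ fun j _ => (h j).2.1,
    fun e => memLp_finsetSum _ fun j _ => (h j).2.2 e⟩

lemma dterm_JL2 {neg : Fin 2 → Prop} {L : En 2 → ℝ} (hL : Ker neg L) {c : ℝ → ℝ} (hc : Cut c) (i : Fin 3)
    {h : En 2 → ℝ} (hh : L2M h) {Dh : Fin 2 → En 2 → ℝ} (hDh : ∀ m, L2M (Dh m)) (d : Fin 3) :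
    JL2 (dterm i c L h Dh d) := by
  rcases Fin.eq_self_or_eq_succAbove i d with rfl | ⟨m, rfl⟩
  · simp only [funext (dterm_same d c L h Dh)]
    exact (term_JL2 hL hc.deriv d hh).add (JL2.sum _ fun m => term_JL2 (hL.mul m) hc d (hDh m))
  · simp only [funext (dterm_succ i c L h Dh m)]
    exact term_JL2 hL hc i (hDh m)

/-- `v` is the derivative of `u` in direction `e` -/
def HasPd {n : ℕ} (e : Fin n) (u v : En n → ℝ) : Prop :=
  ∀ x, HasDerivAt (fun t : ℝ => u (x + t • EuclideanSpace.single e (1:ℝ))) (v x) 0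

lemma hasPd_of_diff {n : ℕ} (e : Fin n) {u : En n → ℝ} (hu : Differentiable ℝ u) : HasPd e u (pd e u) := by
  intro x
  have h1 : HasFDerivAt u (fderiv ℝ u x) (x + (0:ℝ) • EuclideanSpace.single e (1:ℝ)) := by
    simpa using (hu x).hasFDerivAt
  have h2 : HasDerivAt (fun t : ℝ => x + t • EuclideanSpace.single e (1:ℝ))
      (EuclideanSpace.single e (1:ℝ)) 0 := by
    simpa using ((hasDerivAt_id (0:ℝ)).smul_const (EuclideanSpace.single e (1:ℝ))).const_add x
  exact h1.comp_hasDerivAt 0 h2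

lemma HasPd.mul {n : ℕ} {e : Fin n} {u v u' v' : En n → ℝ} (h : HasPd e u v) (h' : HasPd e u' v') :
    HasPd e (fun x => u x * u' x) (fun x => u x * v' x + v x * u' x) := by
  intro x
  have := (h x).mul (h' x)
  simp only [zero_smul, add_zero] at this
  convert! this using 1; ring

lemma ins_add_single {n : ℕ} (e : Fin (n+1)) (t r : ℝ) (y : En n) :
    ins e t y + r • EuclideanSpace.single e (1:ℝ) = ins e (t + r) y := by
  apply ext_succAbove e <;> simp

lemma HasPd.ins {n : ℕ} {e : Fin (n+1)} {u v : En (n+1) → ℝ} (h : HasPd e u v) (y : En n) (t : ℝ) :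
    HasDerivAt (fun t => u (ins e t y)) (v (ins e t y)) t := by
  have := h (_root_.ins e t y)
  simp only [ins_add_single] at this
  have h2 : HasDerivAt (fun r => u (_root_.ins e r y)) (v (_root_.ins e t y)) (t + 0) := by
    have h3 := (hasDerivAt_id (t + 0)).sub_const t
    have h4 : HasDerivAt (fun r => u (_root_.ins e (t + r) y)) (v (_root_.ins e t y)) (id (t+0) - t) := by
      simpa using this
    have := h4.comp (t+0) h3
    simpa [Function.comp_def] using this
  simpa using h2

lemma HasPd.restrict {n : ℕ} {e : Fin (n+1)} {m : Fin n} {u v : En (n+1) → ℝ}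
    (h : HasPd (e.succAbove m) u v) (t : ℝ) :
    HasPd m (fun y => u (_root_.ins e t y)) (fun y => v (_root_.ins e t y)) := by
  intro y
  refine (h (_root_.ins e t y)).congr_of_eventuallyEq (Filter.Eventually.of_forall fun r => ?_)
  simp only
  congr 1
  apply ext_succAbove e
  · simp
  · intro k; simp

/-- divergence theorem on the positive cone -/
lemma div_thm {n : ℕ} (e : Fin (n+1)) {u v Θ : En (n+1) → ℝ} (hu : Continuous u) (hv : Continuous v)
    (huv : HasPd e u v) (hΘ : IsTest Θ) :
    ∫ x in pos (n+1), (u x * pd e Θ x + v x * Θ x) = - ∫ y in pos n, u (ins e 0 y) * Θ (ins e 0 y) := by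
  set w : En (n+1) → ℝ := fun x => u x * Θ x with hw
  set W : En (n+1) → ℝ := fun x => u x * pd e Θ x + v x * Θ x with hW
  have hwW : HasPd e w W := huv.mul (hasPd_of_diff e hΘ.differentiable)
  have hwc : Continuous w := hu.mul hΘ.continuous
  have hWc : Continuous W := (hu.mul (hΘ.pd e).continuous).add (hv.mul hΘ.continuous)
  have hws : HasCompactSupport w := hΘ.2.mul_left
  have hWs : HasCompactSupport W := ((hΘ.pd e).2.mul_left).add (hΘ.2.mul_left)
  have hemb : ∀ y : En n, Topology.IsClosedEmbedding (fun t : ℝ => ins e t y) := by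
    intro y
    refine Function.LeftInverse.isClosedEmbedding (f := fun x : En (n+1) => x e)
      (fun t => by simp) (by fun_prop) ?_
    exact (continuous_ins e).comp (f := fun t : ℝ => (t, y)) (by fun_prop)
  rw [setIntegral_pos_split e]
  have hWi : Integrable (fun p : ℝ × En n => W (ins e p.1 p.2)) := by
    apply Continuous.integrable_of_hasCompactSupport
    · exact hWc.comp (continuous_ins e)
    · exact hWs.comp_isClosedEmbedding (insH e).isClosedEmbedding
  rw [Measure.volume_eq_prod] at hWi ⊢
  rw [← Measure.prod_restrict, integral_prod_symm _ (by rw [Measure.prod_restrict]; exact hWi.integrableOn), ← integral_neg]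
  congr 1
  ext y
  have hi : Integrable (fun t : ℝ => W (ins e t y)) :=
    (hWc.comp (hemb y).continuous).integrable_of_hasCompactSupport (hWs.comp_isClosedEmbedding (hemb y))
  have ht : Filter.Tendsto (fun t : ℝ => w (ins e t y)) Filter.atTop (nhds 0) := by
    have h1 : HasCompactSupport (fun t : ℝ => w (ins e t y)) := hws.comp_isClosedEmbedding (hemb y)
    have := h1.is_zero_at_infty
    exact this.mono_left atTop_le_cocompact
  have := integral_Ioi_of_hasDerivAt_of_tendsto' (a := 0) (fun t _ => hwW.ins y t) hi.integrableOn ht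
  simp only [zero_sub] at this
  exact this

/-- closed positive cone -/
def cpos (n : ℕ) : Set (En n) := {x | ∀ j, 0 ≤ x j}

lemma pos_subset_cpos (n : ℕ) : pos n ⊆ cpos n := fun _ hx j => (hx j).le

lemma ins_mem_cpos {n : ℕ} (e : Fin (n+1)) (t : ℝ) (y : En n) :
    ins e t y ∈ cpos (n+1) ↔ 0 ≤ t ∧ y ∈ cpos n := by
  simp only [cpos, mem_ofPred_eq]
  rw [Fin.forall_iff_succAbove e]; simp

/-- edge functional of a pair on the face `e`, edge towards `e.succAbove m` -/
def edgeF (e : Fin 3) (m : Fin 2) (U V : En 2 → ℝ) (Θ : En 3 → ℝ) : ℝ :=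
  ∫ y in pos 2, (U y * pd (e.succAbove m) Θ (ins e 0 y) + V y * Θ (ins e 0 y))

structure Ids (u : En 3 → ℝ) (Du : Fin 3 → En 3 → ℝ) : Prop where
  T3 : ∀ Θ, IsTest Θ → ∀ d, ∫ x in pos 3, (u x * pd d Θ x + Du d x * Θ x)
    = - ∫ y in pos 2, u (ins d 0 y) * Θ (ins d 0 y)
  E : ∀ Θ, IsTest Θ → ∀ e m,
    edgeF e m (fun y => u (ins e 0 y)) (fun y => Du (e.succAbove m) (ins e 0 y)) Θ
    = edgeF (e.succAbove m) (m.predAbove e) (fun y => u (ins (e.succAbove m) 0 y))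
        (fun y => Du e (ins (e.succAbove m) 0 y)) Θ
  W : ∀ θ : En 2 → ℝ, IsTest θ → tsupport θ ⊆ pos 2 → ∀ (e : Fin 3) m,
    ∫ y in pos 2, (u (ins e 0 y) * pd m θ y + Du (e.succAbove m) (ins e 0 y) * θ y) = 0

lemma isClosedEmbedding_ins0 {n : ℕ} (e : Fin (n+1)) : Topology.IsClosedEmbedding (fun y : En n => ins e 0 y) :=
  Function.LeftInverse.isClosedEmbedding (f := fun x : En (n+1) => pr e x)
      (fun t => by simp) (by fun_prop)
      ((continuous_ins e).comp (f := fun y : En n => ((0:ℝ), y)) (by fun_prop))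

def ins0L {n : ℕ} (e : Fin (n+1)) : En n →L[ℝ] En (n+1) :=
  (insL e).comp (ContinuousLinearMap.inr ℝ ℝ (En n))

@[simp] lemma ins0L_apply {n : ℕ} (e : Fin (n+1)) (y : En n) : ins0L e y = ins e 0 y := rfl

lemma ins0_single {n : ℕ} (e : Fin (n+1)) (m : Fin n) :
    ins e 0 (EuclideanSpace.single m (1:ℝ)) = EuclideanSpace.single (e.succAbove m) (1:ℝ) := by
  apply ext_succAbove e <;> simp [Pi.single_apply]

lemma IsTest.ins0 {n : ℕ} (e : Fin (n+1)) {Θ : En (n+1) → ℝ} (h : IsTest Θ) :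
    IsTest (fun y => Θ (ins e 0 y)) :=
  ⟨h.1.comp (ins0L e).contDiff, h.2.comp_isClosedEmbedding (isClosedEmbedding_ins0 e)⟩

lemma pd_ins0 {n : ℕ} (e : Fin (n+1)) {Θ : En (n+1) → ℝ} (h : IsTest Θ) (m : Fin n) (y : En n) :
    pd m (fun y => Θ (ins e 0 y)) y = pd (e.succAbove m) Θ (ins e 0 y) := by
  have := pd_comp_clm (ins0L e) Θ h.differentiable m y
  simp only [ins0L_apply, ins0_single] at this
  exact this

lemma ins_ins_comm {n : ℕ} (e : Fin (n+2)) (m : Fin (n+1)) (y : En n) :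
    ins (e.succAbove m) 0 (ins (m.predAbove e) 0 y) = ins e 0 (ins m 0 y) := by
  apply ext_succAbove e
  · rw [ins_lat]; simp
  · intro k
    rcases Fin.eq_self_or_eq_succAbove m k with rfl | ⟨j, rfl⟩
    · simp
    · rw [← Fin.succAbove_succAbove_succAbove_predAbove e m j]; simp [Fin.succAbove_succAbove_succAbove_predAbove e m j]

lemma ids_classical {u : En 3 → ℝ} {Du : Fin 3 → En 3 → ℝ} (hu : Continuous u)
    (hDu : ∀ d, Continuous (Du d)) (h : ∀ d, HasPd d u (Du d)) : Ids u Du := by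
  have hc : ∀ e : Fin 3, Continuous (fun y : En 2 => ins e 0 y) := fun e => (ins0L e).continuous
  have key : ∀ (e : Fin 3) (m : Fin 2) (θ : En 2 → ℝ), IsTest θ →
      ∫ y in pos 2, (u (ins e 0 y) * pd m θ y + Du (e.succAbove m) (ins e 0 y) * θ y)
        = - ∫ t in pos 1, u (ins e 0 (ins m 0 t)) * θ (ins m 0 t) := fun e m θ hθ =>
    div_thm m (hu.comp (hc e)) ((hDu _).comp (hc e)) ((h (e.succAbove m)).restrict 0) hθ
  have key2 : ∀ (e : Fin 3) (m : Fin 2) (Θ : En 3 → ℝ), IsTest Θ →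
      edgeF e m (fun y => u (ins e 0 y)) (fun y => Du (e.succAbove m) (ins e 0 y)) Θ
        = - ∫ t in pos 1, u (ins e 0 (ins m 0 t)) * Θ (ins e 0 (ins m 0 t)) := by
    intro e m Θ hΘ
    rw [← key e m _ (hΘ.ins0 e)]
    simp only [pd_ins0 e hΘ, edgeF]
  refine ⟨fun Θ hΘ d => div_thm d hu (hDu d) (h d) hΘ, fun Θ hΘ e m => ?_, fun θ hθ hs e m => ?_⟩
  · rw [key2 e m Θ hΘ]
    have := key2 (e.succAbove m) (m.predAbove e) Θ hΘ
    rw [Fin.succAbove_succAbove_predAbove] at this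
    rw [this]
    simp only [ins_ins_comm]
  · rw [key e m θ hθ]
    have : ∀ t : En 1, θ (ins m 0 t) = 0 := by
      intro t
      by_contra hne
      have := hs (subset_tsupport _ hne) m
      simp at this
    simp [this]

lemma ids_congr {u u' : En 3 → ℝ} {Du Du' : Fin 3 → En 3 → ℝ} (hu : ∀ x ∈ cpos 3, u x = u' x)
    (hDu : ∀ d, ∀ x ∈ cpos 3, Du d x = Du' d x) (h : Ids u Du) : Ids u' Du' := by
  have h3 := measurableSet_pos 3
  have h2 := measurableSet_pos 2
  have hi : ∀ (e : Fin 3) (y : En 2), y ∈ pos 2 → ins e 0 y ∈ cpos 3 := fun e y hy =>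
    (ins_mem_cpos e 0 y).2 ⟨le_rfl, pos_subset_cpos 2 hy⟩
  refine ⟨fun Θ hΘ d => ?_, fun Θ hΘ e m => ?_, fun θ hθ hs e m => ?_⟩
  · convert! h.T3 Θ hΘ d using 1
    · exact setIntegral_congr_fun h3 fun x hx => by
        simp only [hu x (pos_subset_cpos 3 hx), hDu d x (pos_subset_cpos 3 hx)]
    · congr 1
      exact setIntegral_congr_fun h2 fun y hy => by simp only [hu _ (hi d y hy)]
  · have := h.E Θ hΘ e m
    unfold edgeF at this ⊢
    convert! this using 1
    · exact setIntegral_congr_fun h2 fun y hy => by simp only [hu _ (hi _ y hy), hDu _ _ (hi _ y hy)]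
    · exact setIntegral_congr_fun h2 fun y hy => by simp only [hu _ (hi _ y hy), hDu _ _ (hi _ y hy)]
  · refine Eq.trans ?_ (h.W θ hθ hs e m)
    refine setIntegral_congr_fun h2 fun y hy => ?_
    simp only [hu _ (hi _ y hy), hDu _ _ (hi _ y hy)]

lemma conv_pair {n : ℕ} {μ : Measure (En n)} {f f' : ℕ → En n → ℝ} {g g' : En n → ℝ}
    (h : Conv μ f g) (h' : Conv μ f' g') {θ θ' : En n → ℝ} (hθ : MemLp θ 2 μ) (hθ' : MemLp θ' 2 μ) :
    Filter.Tendsto (fun k => ∫ x, (f k x * θ x + f' k x * θ' x) ∂μ) Filter.atTop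
      (nhds (∫ x, (g x * θ x + g' x * θ' x) ∂μ)) := by
  rw [integral_add (int_mul h.2.1 hθ) (int_mul h'.2.1 hθ')]
  have : ∀ k, ∫ x, (f k x * θ x + f' k x * θ' x) ∂μ
      = ∫ x, f k x * θ x ∂μ + ∫ x, f' k x * θ' x ∂μ := fun k =>
    integral_add (int_mul (h.1 k) hθ) (int_mul (h'.1 k) hθ')
  simp only [this]
  exact (h.tendsto hθ).add (h'.tendsto hθ')

lemma ids_lim {u : En 3 → ℝ} {Du : Fin 3 → En 3 → ℝ} {f : ℕ → En 3 → ℝ} {Df : ℕ → Fin 3 → En 3 → ℝ}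
    (hu : JConv f u) (hDu : ∀ d, JConv (fun n => Df n d) (Du d)) (h : ∀ n, Ids (f n) (Df n)) :
    Ids u Du := by
  have edge : ∀ e m (Θ : En 3 → ℝ), IsTest Θ → ∀ d, Filter.Tendsto (fun n =>
      edgeF e m (fun y => f n (ins e 0 y)) (fun y => Df n d (ins e 0 y)) Θ) Filter.atTop
      (nhds (edgeF e m (fun y => u (ins e 0 y)) (fun y => Du d (ins e 0 y)) Θ)) := by
    intro e m Θ hΘ d
    exact conv_pair (hu.2 e) ((hDu d).2 e) (((hΘ.pd _).ins0 e).memLp 2 _) ((hΘ.ins0 e).memLp 2 _)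
  refine ⟨fun Θ hΘ d => ?_, fun Θ hΘ e m => ?_, fun θ hθ hs e m => ?_⟩
  · refine tendsto_nhds_unique (conv_pair hu.1 (hDu d).1 ((hΘ.pd d).memLp 2 _) (hΘ.memLp 2 _)) ?_
    simp only [(h _).T3 Θ hΘ d]
    exact ((hu.2 d).tendsto ((hΘ.ins0 d).memLp 2 _)).neg
  · refine tendsto_nhds_unique (edge e m Θ hΘ (e.succAbove m)) ?_
    simp only [(h _).E Θ hΘ e m]
    exact edge _ _ Θ hΘ e
  · refine tendsto_nhds_unique (conv_pair (hu.2 e) ((hDu _).2 e) ((hθ.pd m).memLp 2 _) (hθ.memLp 2 _)) ?_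
    simp only [(h _).W θ hθ hs e m]
    exact tendsto_const_nhds

/-- full package -/
def IdsJ (u : En 3 → ℝ) (Du : Fin 3 → En 3 → ℝ) : Prop := JL2 u ∧ (∀ d, JL2 (Du d)) ∧ Ids u Du

lemma pair_add {n : ℕ} {μ : Measure (En n)} {f f' g g' : En n → ℝ}
    (h : MemLp f 2 μ) (h' : MemLp f' 2 μ) (hg : MemLp g 2 μ) (hg' : MemLp g' 2 μ)
    {θ θ' : En n → ℝ} (hθ : MemLp θ 2 μ) (hθ' : MemLp θ' 2 μ) :
    ∫ x, ((f x + f' x) * θ x + (g x + g' x) * θ' x) ∂μ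
      = ∫ x, (f x * θ x + g x * θ' x) ∂μ + ∫ x, (f' x * θ x + g' x * θ' x) ∂μ := by
  have i1 : Integrable (fun x => f x * θ x + g x * θ' x) μ := (int_mul h hθ).add (int_mul hg hθ')
  have i2 : Integrable (fun x => f' x * θ x + g' x * θ' x) μ := (int_mul h' hθ).add (int_mul hg' hθ')
  rw [← integral_add i1 i2]
  congr 1; ext x; ring

lemma IdsJ.add {u u' : En 3 → ℝ} {Du Du' : Fin 3 → En 3 → ℝ} (h : IdsJ u Du) (h' : IdsJ u' Du') :
    IdsJ (fun x => u x + u' x) (fun d x => Du d x + Du' d x) := by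
  refine ⟨h.1.add h'.1, fun d => (h.2.1 d).add (h'.2.1 d), fun Θ hΘ d => ?_, fun Θ hΘ e m => ?_,
    fun θ hθ hs e m => ?_⟩
  · rw [pair_add h.1.2.1 h'.1.2.1 (h.2.1 d).2.1 (h'.2.1 d).2.1 ((hΘ.pd d).memLp 2 _) (hΘ.memLp 2 _),
      h.2.2.T3 Θ hΘ d, h'.2.2.T3 Θ hΘ d, ← neg_add,
      ← integral_add (int_mul (h.1.2.2 d) ((hΘ.ins0 d).memLp 2 _)) (int_mul (h'.1.2.2 d) ((hΘ.ins0 d).memLp 2 _))]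
    simp only [add_mul]
  · have k := h.2.2.E Θ hΘ e m
    have k' := h'.2.2.E Θ hΘ e m
    unfold edgeF at *
    rw [pair_add (h.1.2.2 _) (h'.1.2.2 _) ((h.2.1 _).2.2 _) ((h'.2.1 _).2.2 _)
      (((hΘ.pd _).ins0 e).memLp 2 _) ((hΘ.ins0 e).memLp 2 _),
      pair_add (h.1.2.2 _) (h'.1.2.2 _) ((h.2.1 _).2.2 _) ((h'.2.1 _).2.2 _)
      (((hΘ.pd _).ins0 _).memLp 2 _) ((hΘ.ins0 _).memLp 2 _), k, k']
  · rw [pair_add (h.1.2.2 _) (h'.1.2.2 _) ((h.2.1 _).2.2 _) ((h'.2.1 _).2.2 _)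
      ((hθ.pd m).memLp 2 _) (hθ.memLp 2 _), h.2.2.W θ hθ hs e m, h'.2.2.W θ hθ hs e m, add_zero]

lemma IdsJ.zero : IdsJ (fun _ => 0) (fun _ _ => 0) := by
  refine ⟨⟨measurable_const, MemLp.zero', fun e => MemLp.zero'⟩,
    fun d => ⟨measurable_const, MemLp.zero', fun e => MemLp.zero'⟩, ?_, ?_, ?_⟩ <;> simp [edgeF]

lemma IdsJ.sum {ι : Type*} (S : Finset ι) {u : ι → En 3 → ℝ} {Du : ι → Fin 3 → En 3 → ℝ}
    (h : ∀ j, IdsJ (u j) (Du j)) :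
    IdsJ (fun x => ∑ j ∈ S, u j x) (fun d x => ∑ j ∈ S, Du j d x) := by
  classical
  induction S using Finset.induction_on with
  | empty => simpa using IdsJ.zero
  | insert a S ha ih => simp only [Finset.sum_insert ha]; exact (h a).add ih

lemma jensen {X : Type*} [MeasurableSpace X] {μ : Measure X} [SFinite μ] {L : En 2 → ℝ}
    (hL : IsTest L) {G : X × En 2 → ℝ} (hG : Measurable G) (D : ENNReal)
    (hD : ∀ s, L s ≠ 0 → N2 μ (fun x => G (x, s)) ≤ D) :
    N2 μ (fun x => ∫ s, L s * G (x, s)) ≤ (∫⁻ s, ‖L s‖ₑ) ^ 2 * D := by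
  have hLm := hL.continuous.measurable
  calc N2 μ (fun x => ∫ s, L s * G (x, s))
      ≤ ∫⁻ x, ((∫⁻ s, ‖L s‖ₑ) * ∫⁻ s, ‖L s‖ₑ * ‖G (x, s)‖ₑ ^ 2) ∂μ := by
        unfold N2
        refine lintegral_mono fun x => ?_
        refine le_trans ?_ (lintegral_cs_w volume (w := fun s => ‖L s‖ₑ)
          (g := fun s => ‖G (x, s)‖ₑ) (by fun_prop) (by fun_prop))
        gcongr
        refine (enorm_integral_le_lintegral_enorm _).trans (le_of_eq ?_)
        simp only [enorm_mul]
    _ = (∫⁻ s, ‖L s‖ₑ) * ∫⁻ x, (∫⁻ s, ‖L s‖ₑ * ‖G (x, s)‖ₑ ^ 2) ∂μ := by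
        rw [lintegral_const_mul]
        exact Measurable.lintegral_prod_right' (f := fun q : X × En 2 => ‖L q.2‖ₑ * ‖G q‖ₑ ^ 2)
          (by fun_prop)
    _ = (∫⁻ s, ‖L s‖ₑ) * ∫⁻ s, ∫⁻ x, ‖L s‖ₑ * ‖G (x, s)‖ₑ ^ 2 ∂μ := by
        rw [lintegral_lintegral_swap]; fun_prop
    _ ≤ (∫⁻ s, ‖L s‖ₑ) * ∫⁻ s, ‖L s‖ₑ * D := by
        gcongr with s
        by_cases hs : L s = 0
        · simp [hs]
        · rw [lintegral_const_mul _ (by fun_prop)]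
          gcongr
          exact hD s hs
    _ = _ := by
        rw [lintegral_mul_const _ (by fun_prop)]; ring

lemma trans_cont {h : En 2 → ℝ} (hh : L2M h) :
    Filter.Tendsto (fun v : En 2 => N2 volume (fun y => h (y + v) - h y)) (nhds 0) (nhds 0) := by
  have : Fact (1 ≤ (2:ENNReal)) := ⟨by norm_num⟩
  have : Fact ((2:ENNReal) ≠ ⊤) := ⟨by norm_num⟩
  set f : Lp ℝ 2 (volume : Measure (En 2)) := hh.2.toLp h
  have hc : Continuous (fun v : En 2 => (DomAddAct.mk v) +ᵥ f) := by
    have := DomAddAct.continuous_mk (M := En 2)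
    fun_prop
  have key : ∀ v : En 2, N2 volume (fun y => h (y + v) - h y) = ‖(DomAddAct.mk v +ᵥ f) - f‖ₑ ^ 2 := by
    intro v
    rw [DomAddAct.mk_vadd_toLp, ← MemLp.toLp_sub, Lp.enorm_toLp, N2_eq]
    congr 2
    ext y; simp [add_comm]
  simp only [key]
  have h1 : Filter.Tendsto (fun v : En 2 => ‖(DomAddAct.mk v +ᵥ f) - f‖ₑ ^ 2) (nhds 0)
      (nhds (‖(DomAddAct.mk (0 : En 2) +ᵥ f) - f‖ₑ ^ 2)) := by
    have : Continuous (fun v : En 2 => ‖(DomAddAct.mk v +ᵥ f) - f‖ₑ ^ 2) := by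
      have hp : Continuous (fun x : ENNReal => x ^ 2) := ENNReal.continuous_pow 2
      exact hp.comp (hc.sub continuous_const).enorm
    exact this.tendsto 0
  simpa using h1

lemma T0_L2M {L h : En 2 → ℝ} (hL : IsTest L) (hh : L2M h) (z : ℝ) : L2M (T0 L h z) := by
  have hm : Measurable (T0 L h z) := (T0_meas hL hh.1).comp (f := fun y => (z, y)) (by fun_prop)
  have := hh.1
  refine ⟨hm, memLp_of_N2 hm.aestronglyMeasurable ?_⟩
  refine (jensen (μ := volume) hL (G := fun q => h (q.1 + z • q.2)) (by fun_prop) (N2 volume h) ?_).trans_lt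
    (ENNReal.mul_lt_top (ENNReal.pow_lt_top (test_lint_lt hL)) hh.2.N2_lt)
  intro s _
  exact (lintegral_add_right_eq_self (fun y => ‖h y‖ₑ ^ 2) (z • s)).le

lemma T0_conv {L h : En 2 → ℝ} (hL : IsTest L) (hL1 : ∫ s, L s = 1) (hh : L2M h) :
    Conv volume (fun n : ℕ => T0 L h (1 / ((n:ℝ) + 1))) h := by
  refine ⟨fun n => (T0_L2M hL hh _).2, hh.2, ?_⟩
  obtain ⟨R, hR⟩ := hL.2.isCompact.isBounded.exists_norm_le
  have hm := hh.1
  rw [ENNReal.tendsto_nhds_zero]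
  intro ε hε
  obtain ⟨A, hA⟩ : ∃ A, A = (∫⁻ s, ‖L s‖ₑ) ^ 2 := ⟨_, rfl⟩
  have hAt : A < ⊤ := hA ▸ ENNReal.pow_lt_top (test_lint_lt hL)
  have hδ : 0 < ε / (A + 1) := ENNReal.div_pos hε.ne' (ENNReal.add_lt_top.2 ⟨hAt, ENNReal.one_lt_top⟩).ne
  have h1 := (ENNReal.tendsto_nhds_zero.1 (trans_cont hh)) _ hδ
  obtain ⟨η, hη, hb⟩ := Metric.eventually_nhds_iff.1 h1
  have h2 : Filter.Tendsto (fun n : ℕ => 1 / ((n:ℝ) + 1) * R) Filter.atTop (nhds (0 * R)) :=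
    tendsto_one_div_add_atTop_nhds_zero_nat.mul_const R
  rw [zero_mul] at h2
  filter_upwards [h2.eventually (gt_mem_nhds hη)] with n hn
  have e1 : (fun x => T0 L h (1 / ((n:ℝ) + 1)) x - h x)
      = fun x => ∫ s, L s * (h (x + (1 / ((n:ℝ) + 1)) • s) - h x) := by
    ext x
    simp only [mul_sub]
    rw [integral_sub (T0_int hL hh _ _), integral_mul_const, hL1, one_mul]; rfl
    exact (hL.continuous.integrable_of_hasCompactSupport hL.2).mul_const _
  rw [e1]
  refine (jensen (μ := volume) hL (G := fun q => h (q.1 + (1 / ((n:ℝ) + 1)) • q.2) - h q.1) (by fun_prop)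
    (ε / (A + 1)) ?_).trans ?_
  · intro s hs
    refine hb (y := (1 / ((n:ℝ) + 1)) • s) ?_
    rw [dist_zero_right, norm_smul, Real.norm_of_nonneg (by positivity)]
    refine lt_of_le_of_lt ?_ hn
    gcongr
    exact hR s (subset_tsupport _ hs)
  · rw [← hA]
    calc A * (ε / (A + 1)) ≤ (A + 1) * (ε / (A + 1)) := by gcongr; exact le_self_add
      _ ≤ ε := ENNReal.mul_div_le

/-- kernels supported in the positive half spaces of the non-`neg` directions -/
def PosK (neg : Fin 2 → Prop) (L : En 2 → ℝ) : Prop :=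
  IsTest L ∧ ∃ c > 0, ∀ s ∈ tsupport L, ∀ m, ¬ neg m → c ≤ s m

lemma Ker.posK {neg : Fin 2 → Prop} {L : En 2 → ℝ} (h : Ker neg L) : PosK neg L := by
  obtain ⟨h1, c, hc, h2⟩ := h
  exact ⟨h1, c, hc, fun s hs m hm => (h2 s hs m).2 hm⟩

def Dom (neg : Fin 2 → Prop) : Set (En 2) := {y | ∀ m, neg m ∨ 0 < y m}
def CDom (neg : Fin 2 → Prop) : Set (En 2) := {y | ∀ m, neg m ∨ 0 ≤ y m}

structure Admis (neg : Fin 2 → Prop) (h : En 2 → ℝ) (Dh : Fin 2 → En 2 → ℝ) : Prop where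
  h2 : L2M h
  d2 : ∀ m, L2M (Dh m)
  wd : ∀ θ, IsTest θ → tsupport θ ⊆ Dom neg → ∀ m, ∫ y, h y * pd m θ y = - ∫ y, Dh m y * θ y

lemma integral_affine (f : En 2 → ℝ) (y : En 2) {z : ℝ} (hz : 0 < z) :
    ∫ s, f (y + z • s) = (z ^ 2)⁻¹ * ∫ s, f s := by
  have h1 := Measure.integral_comp_smul (volume : Measure (En 2)) (fun s => f (y + s)) z
  rw [h1, integral_add_left_eq_self]
  simp [abs_of_pos hz]

lemma IsTest.affine {L : En 2 → ℝ} (hL : IsTest L) (x : En 2) {z : ℝ} (hz : z ≠ 0) :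
    IsTest (fun y => L (z • (y - x))) := by
  refine ⟨hL.1.comp (by fun_prop), ?_⟩
  exact hL.2.comp_homeomorph ((Homeomorph.subRight x).trans (Homeomorph.smulOfNeZero z hz))

lemma pd_affine {L : En 2 → ℝ} (hL : Differentiable ℝ L) (x y : En 2) (z : ℝ) (m : Fin 2) :
    pd m (fun y => L (z • (y - x))) y = z * pd m L (z • (y - x)) := by
  unfold pd
  have h1 : HasFDerivAt (fun y : En 2 => z • (y - x)) (z • ContinuousLinearMap.id ℝ (En 2)) y :=
    ((hasFDerivAt_id y).sub_const x).const_smul z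
  have := (hL (z • (y - x))).hasFDerivAt.comp y h1
  have e : fderiv ℝ (fun y => L (z • (y - x))) y = _ := this.fderiv
  rw [e]; simp

lemma T0_ibp {neg : Fin 2 → Prop} {h : En 2 → ℝ} {Dh : Fin 2 → En 2 → ℝ} (H : Admis neg h Dh)
    {L : En 2 → ℝ} (hL : PosK neg L) {z : ℝ} (hz : 0 < z) {x : En 2} (hx : x ∈ CDom neg) (m : Fin 2) :
    z * T0 L (Dh m) z x = - T0 (pd m L) h z x := by
  have hz' : z⁻¹ ≠ 0 := inv_ne_zero hz.ne'
  obtain ⟨hLt, c, hc, hcs⟩ := hL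
  have key : ∀ (M f : En 2 → ℝ), T0 M f z x = (z ^ 2)⁻¹ * ∫ y, M (z⁻¹ • (y - x)) * f y := by
    intro M f
    rw [← integral_affine _ x hz]
    unfold T0
    congr 1; ext s
    rw [add_sub_cancel_left, smul_smul, inv_mul_cancel₀ hz.ne', one_smul]
  have ht := hLt.affine x hz'
  have hsup : tsupport (fun y => L (z⁻¹ • (y - x))) ⊆ Dom neg := by
    have : tsupport (fun y => L (z⁻¹ • (y - x))) ⊆ (fun y => z⁻¹ • (y - x)) ⁻¹' tsupport L :=
      closure_minimal (fun y hy => subset_tsupport _ hy)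
        ((isClosed_tsupport L).preimage (by fun_prop))
    intro y hy k
    by_cases hk : neg k
    · exact Or.inl hk
    · right
      have h1 := hcs _ (this hy) k hk
      have h2 := (hx k).resolve_left hk
      simp at h1
      have : 0 < z⁻¹ * (y k - x k) := hc.trans_le h1
      have := (mul_pos_iff_of_pos_left (inv_pos.2 hz)).1 this
      linarith
  have hw := H.wd _ ht hsup m
  simp only [pd_affine hLt.differentiable] at hw
  rw [key, key]
  have e1 : ∫ y, L (z⁻¹ • (y - x)) * Dh m y = ∫ y, Dh m y * L (z⁻¹ • (y - x)) := by simp only [mul_comm]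
  have e2 : ∫ y, h y * (z⁻¹ * pd m L (z⁻¹ • (y - x))) = z⁻¹ * ∫ y, pd m L (z⁻¹ • (y - x)) * h y := by
    rw [← integral_const_mul]; congr 1; ext y; ring
  rw [e1, ← neg_eq_iff_eq_neg.2 hw, e2]
  field_simp

lemma T0_eq_set (L h : En 2 → ℝ) (z : ℝ) (y : En 2) :
    T0 L h z y = ∫ s in tsupport L, L s * h (y + z • s) := by
  refine (setIntegral_eq_integral_of_forall_compl_eq_zero fun s hs => ?_).symm
  rw [image_eq_zero_of_notMem_tsupport hs, zero_mul]

lemma T0_continuous {L h : En 2 → ℝ} (hL : IsTest L) (hh : Continuous h) :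
    Continuous (fun p : ℝ × En 2 => T0 L h p.1 p.2) := by
  simp only [T0_eq_set]
  have := hL.continuous
  exact continuous_parametric_integral_of_continuous
    (f := fun (p : ℝ × En 2) s => L s * h (p.2 + p.1 • s))
    (by simp only [Function.uncurry_def]; fun_prop) hL.2.isCompact

lemma term_continuous {L h : En 2 → ℝ} (hL : IsTest L) (hh : Continuous h) {c : ℝ → ℝ} (hc : Continuous c)
    (i : Fin 3) : Continuous (term i c L h) := by
  unfold term
  refine Continuous.mul (by fun_prop) ?_
  exact (T0_continuous hL hh).comp (f := fun x : En 3 => (x i, pr i x)) (by fun_prop)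

lemma param_deriv {L h : En 2 → ℝ} (hL : IsTest L) (hh : ContDiff ℝ 1 h) {p w : En 2 → En 2}
    (hp : Continuous p) (hw : Continuous w) :
    HasDerivAt (fun t : ℝ => ∫ s, L s * h (p s + t • w s)) (∫ s, L s * fderiv ℝ h (p s) (w s)) 0 := by
  have hLc := hL.continuous
  have hhc := hh.continuous
  have hdc : Continuous (fderiv ℝ h) := hh.continuous_fderiv (by simp)
  have hF : Continuous (fun q : ℝ × En 2 => fderiv ℝ h (p q.2 + q.1 • w q.2) (w q.2)) := by fun_prop
  obtain ⟨C, hC⟩ := ((isCompact_Icc (a := (-1:ℝ)) (b := 1)).prod hL.2.isCompact).exists_bound_of_continuousOn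
    hF.continuousOn
  have key := hasDerivAt_integral_of_dominated_loc_of_deriv_le (μ := (volume : Measure (En 2)))
    (F := fun (t : ℝ) s => L s * h (p s + t • w s)) (x₀ := (0:ℝ)) (s := Icc (-1) 1)
    (F' := fun t s => L s * fderiv ℝ h (p s + t • w s) (w s)) (bound := fun s => |L s| * C)
    (Icc_mem_nhds (by norm_num) (by norm_num))
    (Filter.Eventually.of_forall fun t => (by fun_prop : Continuous _).aestronglyMeasurable) ?_
    ((by fun_prop : Continuous _).aestronglyMeasurable) ?_ ?_ ?_
  · simpa using key.2
  · exact Continuous.integrable_of_hasCompactSupport (by fun_prop) (hL.2.mul_right)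
  · refine Filter.Eventually.of_forall fun s t ht => ?_
    rw [norm_mul, Real.norm_eq_abs]
    by_cases hs : s ∈ tsupport L
    · gcongr
      exact hC (t, s) ⟨ht, hs⟩
    · rw [image_eq_zero_of_notMem_tsupport hs]; simp
  · exact ((hL.continuous.abs).integrable_of_hasCompactSupport hL.2.abs).mul_const _
  · refine Filter.Eventually.of_forall fun s t _ => ?_
    refine HasDerivAt.const_mul _ ?_
    have h1 : HasDerivAt (fun t : ℝ => p s + t • w s) (w s) t := by
      simpa using ((hasDerivAt_id t).smul_const (w s)).const_add (p s)
    exact ((hh.differentiable (by simp)) _).hasFDerivAt.comp_hasDerivAt t h1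

lemma pr_single_same {n : ℕ} (i : Fin (n+1)) : pr i (EuclideanSpace.single i (1:ℝ)) = 0 := by
  ext m; simp
lemma pr_single_succ {n : ℕ} (i : Fin (n+1)) (m : Fin n) :
    pr i (EuclideanSpace.single (i.succAbove m) (1:ℝ)) = EuclideanSpace.single m 1 := by
  ext k; simp

lemma T0_hasPd_succ {L h : En 2 → ℝ} (hL : IsTest L) (hh : ContDiff ℝ 1 h) (i : Fin 3) (m : Fin 2) :
    HasPd (i.succAbove m) (fun x => T0 L h (x i) (pr i x)) (fun x => T0 L (pd m h) (x i) (pr i x)) := by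
  intro x
  have := param_deriv hL hh (p := fun s => pr i x + x i • s) (w := fun _ => EuclideanSpace.single m 1)
    (by fun_prop) (by fun_prop)
  convert! this using 1
  funext t
  unfold T0
  refine integral_congr_ae (Filter.Eventually.of_forall fun s => ?_)
  dsimp only
  congr 2
  rw [map_add, map_smul, pr_single_succ]
  simp
  abel

lemma T0_hasPd_same {L h : En 2 → ℝ} (hL : IsTest L) (hh : ContDiff ℝ 1 h) (i : Fin 3) :
    HasPd i (fun x => T0 L h (x i) (pr i x))
      (fun x => ∑ m, T0 (fun s => s m * L s) (pd m h) (x i) (pr i x)) := by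
  intro x
  have := param_deriv hL hh (p := fun s => pr i x + x i • s) (w := fun s => s)
    (by fun_prop) (by fun_prop)
  have hLc := hL.continuous
  have hdc : Continuous (fderiv ℝ h) := hh.continuous_fderiv (by simp)
  convert! this using 1
  · funext t
    unfold T0
    refine integral_congr_ae (Filter.Eventually.of_forall fun s => ?_)
    dsimp only
    congr 2
    rw [map_add, map_smul, pr_single_same]
    simp [add_smul]
    abel
  · unfold T0
    dsimp only
    rw [← integral_finsetSum]
    · congr 1; ext s
      rw [fderiv_eq_sum_pd, Finset.mul_sum]
      exact Finset.sum_congr rfl fun m _ => by ring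
    · intro m _
      refine Continuous.integrable_of_hasCompactSupport ?_ ?_
      · unfold pd; fun_prop
      · exact (hL.2.mul_left).mul_right

lemma hasPd_cut {c : ℝ → ℝ} (hc : Differentiable ℝ c) (i : Fin 3) :
    HasPd i (fun x : En 3 => c (x i)) (fun x => deriv c (x i)) := by
  intro x
  have h1 : HasDerivAt (fun t : ℝ => x i + t) 1 0 := (hasDerivAt_id (0:ℝ)).const_add _
  have h2 : HasDerivAt c (deriv c (x i)) (x i + 0) := by simpa using (hc (x i)).hasDerivAt
  have h3 := h2.comp (0:ℝ) h1
  rw [mul_one] at h3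
  convert! h3 using 1
  funext t; simp

lemma hasPd_cut_succ (c : ℝ → ℝ) (i : Fin 3) (m : Fin 2) :
    HasPd (i.succAbove m) (fun x : En 3 => c (x i)) (fun _ => 0) := by
  intro x
  simpa using hasDerivAt_const (0:ℝ) (c (x i))

lemma term_hasPd {L h : En 2 → ℝ} (hL : IsTest L) (hh : ContDiff ℝ 1 h) {c : ℝ → ℝ} (hc : Cut c)
    (i d : Fin 3) : HasPd d (term i c L h) (dterm i c L h (fun m => pd m h) d) := by
  rcases Fin.eq_self_or_eq_succAbove i d with rfl | ⟨m, rfl⟩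
  · have := (hasPd_cut (hc.1.differentiable (by simp)) d).mul (T0_hasPd_same hL hh d)
    convert! this using 1
    ext x
    rw [dterm_same, Finset.mul_sum, add_comm]; rfl
  · have := (hasPd_cut_succ c i m).mul (T0_hasPd_succ hL hh i m)
    convert! this using 1
    ext x
    rw [dterm_succ]; simp [term]

lemma IsTest.mulc {L : En 2 → ℝ} (hL : IsTest L) (m : Fin 2) : IsTest (fun s => s m * L s) :=
  hL.mul_left (by fun_prop)

lemma dterm_continuous {L h : En 2 → ℝ} (hL : IsTest L) (hh : ContDiff ℝ 1 h) {c : ℝ → ℝ} (hc : Cut c)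
    (i d : Fin 3) : Continuous (dterm i c L h (fun m => pd m h) d) := by
  have hdc : ∀ m, Continuous (pd m h) := fun m => by
    have : Continuous (fderiv ℝ h) := hh.continuous_fderiv (by simp)
    unfold pd; fun_prop
  rcases Fin.eq_self_or_eq_succAbove i d with rfl | ⟨m, rfl⟩
  · have : dterm d c L h (fun m => pd m h) d = fun x =>
      term d (deriv c) L h x + ∑ m, term d c (fun s => s m * L s) (pd m h) x := by
      ext x; rw [dterm_same]
    rw [this]
    exact (term_continuous hL hh.continuous hc.deriv.1.continuous d).add
      (continuous_finsetSum _ fun m _ => term_continuous (hL.mulc m) (hdc m) hc.1.continuous d)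
  · have : dterm i c L h (fun m => pd m h) (i.succAbove m) = term i c L (pd m h) := by
      ext x; rw [dterm_succ]
    rw [this]
    exact term_continuous hL (hdc m) hc.1.continuous i

lemma term_ids_classical {L h : En 2 → ℝ} (hL : IsTest L) (hh : ContDiff ℝ 1 h) {c : ℝ → ℝ} (hc : Cut c)
    (i : Fin 3) : Ids (term i c L h) (dterm i c L h (fun m => pd m h)) :=
  ids_classical (term_continuous hL hh.continuous hc.1.continuous i)
    (fun d => dterm_continuous hL hh hc i d) (fun d => term_hasPd hL hh hc i d)

/-- convolution form -/
def kap (L : En 2 → ℝ) (z : ℝ) (v : En 2) : ℝ := (z ^ 2)⁻¹ * L ((-z⁻¹) • (v - 0))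

lemma kap_test {L : En 2 → ℝ} (hL : IsTest L) {z : ℝ} (hz : 0 < z) : IsTest (kap L z) :=
  (hL.affine 0 (z := -z⁻¹) (by simpa using hz.ne')).mul_left contDiff_const

lemma T0_eq_convolution (L f : En 2 → ℝ) {z : ℝ} (hz : 0 < z) :
    T0 L f z = MeasureTheory.convolution f (kap L z) (ContinuousLinearMap.mul ℝ ℝ) volume := by
  ext x
  have : T0 L f z x = (z ^ 2)⁻¹ * ∫ y, L (z⁻¹ • (y - x)) * f y := by
    rw [← integral_affine _ x hz]
    unfold T0
    congr 1; ext s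
    rw [add_sub_cancel_left, smul_smul, inv_mul_cancel₀ hz.ne', one_smul]
  rw [this, MeasureTheory.convolution, ← integral_const_mul]
  congr 1; ext t
  simp only [ContinuousLinearMap.mul_apply', kap]
  rw [show (-z⁻¹) • (x - t - 0) = z⁻¹ • (t - x) by simp [smul_sub]; abel]
  ring

lemma T0_contDiff {L f : En 2 → ℝ} (hL : IsTest L) (hf : L2M f) {z : ℝ} (hz : 0 < z) :
    ContDiff ℝ (⊤ : ℕ∞) (T0 L f z) := by
  rw [T0_eq_convolution L f hz]
  exact (kap_test hL hz).2.contDiff_convolution_right _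
    (hf.2.locallyIntegrable (by norm_num)) (kap_test hL hz).1

lemma pd_T0 {L f : En 2 → ℝ} (hL : IsTest L) (hf : L2M f) {z : ℝ} (hz : 0 < z) (m : Fin 2) (x : En 2) :
    z * pd m (T0 L f z) x = - T0 (pd m L) f z x := by
  have hk := kap_test hL hz
  have hfl := hf.2.locallyIntegrable (by norm_num)
  have h1 := hk.2.hasFDerivAt_convolution_right (ContinuousLinearMap.mul ℝ ℝ) (f := f) (μ := volume) hfl
    (hk.1.of_le (by simp)) x
  rw [T0_eq_convolution L f hz, T0_eq_convolution (pd m L) f hz]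
  rw [pd, h1.fderiv, convolution_precompR_apply _ hfl (hk.2.fderiv ℝ) (hk.1.continuous_fderiv (by simp))]
  unfold MeasureTheory.convolution
  rw [← integral_neg, ← integral_const_mul]
  congr 1; ext t
  simp only [ContinuousLinearMap.mul_apply']
  have h2 : fderiv ℝ (kap L z) (x - t) (EuclideanSpace.single m 1) = pd m (kap L z) (x - t) := rfl
  have h3 : pd m (kap L z) (x - t) = (z^2)⁻¹ * (-z⁻¹ * pd m L ((-z⁻¹) • ((x - t) - 0))) := by
    rw [← pd_affine hL.differentiable]
    unfold kap pd
    rw [fderiv_const_mul]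
    · simp
    · exact (hL.affine 0 (z := -z⁻¹) (by simpa using hz.ne')).differentiable _
  rw [h2, h3, kap]
  field_simp

lemma pd_T0_eq {neg : Fin 2 → Prop} {h : En 2 → ℝ} {Dh : Fin 2 → En 2 → ℝ} (H : Admis neg h Dh)
    {L : En 2 → ℝ} (hL : PosK neg L) {z : ℝ} (hz : 0 < z) {x : En 2} (hx : x ∈ CDom neg) (m : Fin 2) :
    pd m (T0 L h z) x = T0 L (Dh m) z x := by
  have h1 := T0_ibp H hL hz hx m
  have h2 := pd_T0 hL.1 H.h2 hz m x
  exact mul_left_cancel₀ hz.ne' (h2.trans h1.symm)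

lemma exists_ker (neg : Fin 2 → Prop) : ∃ L, Ker neg L ∧ ∫ s, L s = 1 := by
  classical
  let p : En 2 := WithLp.toLp 2 (fun m => if neg m then -1 else 1)
  let b : ContDiffBump p := ⟨1/4, 1/2, by norm_num, by norm_num⟩
  refine ⟨b.normed volume, ⟨⟨b.contDiff_normed, b.hasCompactSupport_normed⟩, 1/2, by norm_num, ?_⟩,
    b.integral_normed⟩
  intro s hs m
  rw [b.tsupport_normed_eq, Metric.mem_closedBall, dist_eq_norm] at hs
  have h1 : ‖(s - p) m‖ ≤ 1/2 := (PiLp.norm_apply_le (s - p) m).trans hs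
  rw [Real.norm_eq_abs, abs_le] at h1
  have h2 : (s - p) m = s m - p m := rfl
  rw [h2] at h1
  constructor
  · intro hm
    have : p m = -1 := by simp [p, hm]
    linarith [h1.2]
  · intro hm
    have : p m = 1 := by simp [p, hm]
    linarith [h1.1]

lemma exists_posK : ∃ L, (∀ neg, PosK neg L) ∧ ∫ s, L s = 1 := by
  obtain ⟨L, ⟨h1, c, hc, h2⟩, h3⟩ := exists_ker (fun _ => False)
  exact ⟨L, fun neg => ⟨h1, c, hc, fun s hs m _ => (h2 s hs m).2 id⟩, h3⟩

lemma cdom_shift {neg : Fin 2 → Prop} {L : En 2 → ℝ} (hL : PosK neg L) {z : ℝ} (hz : 0 ≤ z) {y : En 2}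
    (hy : y ∈ CDom neg) {s : En 2} (hs : s ∈ tsupport L) : y + z • s ∈ CDom neg := by
  obtain ⟨_, c, hc, h⟩ := hL
  intro m
  by_cases hm : neg m
  · exact Or.inl hm
  · right
    have h1 := h s hs m hm
    have h2 := (hy m).resolve_left hm
    simp
    have := mul_nonneg hz (hc.le.trans h1)
    linarith

lemma T0_congr {neg : Fin 2 → Prop} {L f g : En 2 → ℝ} (hL : PosK neg L) (hfg : ∀ y ∈ CDom neg, f y = g y)
    {z : ℝ} (hz : 0 ≤ z) {y : En 2} (hy : y ∈ CDom neg) : T0 L f z y = T0 L g z y := by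
  unfold T0
  congr 1; ext s
  by_cases hs : s ∈ tsupport L
  · rw [hfg _ (cdom_shift hL hz hy hs)]
  · simp [image_eq_zero_of_notMem_tsupport hs]

lemma pr_mem_cdom (neg : Fin 2 → Prop) (i : Fin 3) {x : En 3} (hx : x ∈ cpos 3) : pr i x ∈ CDom neg :=
  fun _ => Or.inr (hx _)

lemma term_congr {neg : Fin 2 → Prop} {L f g : En 2 → ℝ} (hL : PosK neg L) (hfg : ∀ y ∈ CDom neg, f y = g y)
    (c : ℝ → ℝ) (i : Fin 3) {x : En 3} (hx : x ∈ cpos 3) : term i c L f x = term i c L g x := by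
  unfold term
  rw [T0_congr hL hfg (hx i) (pr_mem_cdom neg i hx)]

lemma term_idsJ {neg : Fin 2 → Prop} {h : En 2 → ℝ} {Dh : Fin 2 → En 2 → ℝ} (H : Admis neg h Dh)
    {L : En 2 → ℝ} (hL : Ker neg L) {c : ℝ → ℝ} (hc : Cut c) (i : Fin 3) :
    IdsJ (term i c L h) (dterm i c L h Dh) := by
  refine ⟨term_JL2 hL hc i H.h2, fun d => dterm_JL2 hL hc i H.h2 H.d2 d, ?_⟩
  obtain ⟨ρ, hρ, hρ1⟩ := exists_posK
  have hε : ∀ n : ℕ, 0 < 1 / ((n:ℝ) + 1) := fun n => by positivity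
  have hρt := (hρ neg).1
  refine ids_lim (f := fun n => term i c L (T0 ρ h (1 / ((n:ℝ) + 1))))
    (Df := fun n => dterm i c L (T0 ρ h (1 / ((n:ℝ) + 1))) (fun m => T0 ρ (Dh m) (1 / ((n:ℝ) + 1))))
    (term_JConv hL hc i (fun n => (T0_L2M hρt H.h2 _).1) H.h2.1 (T0_conv hρt hρ1 H.h2))
    (fun d => dterm_JConv hL hc i (fun n => (T0_L2M hρt H.h2 _).1) H.h2.1 (T0_conv hρt hρ1 H.h2)
      (fun n m => (T0_L2M hρt (H.d2 m) _).1) (fun m => (H.d2 m).1)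
      (fun m => T0_conv hρt hρ1 (H.d2 m)) d) ?_
  intro n
  refine ids_congr (fun _ _ => rfl) ?_ (term_ids_classical hL.1
    ((T0_contDiff hρt H.h2 (hε n)).of_le (by simp)) hc i)
  intro d x hx
  have hpd : ∀ m, ∀ y ∈ CDom neg, pd m (T0 ρ h (1 / ((n:ℝ) + 1))) y = T0 ρ (Dh m) (1 / ((n:ℝ) + 1)) y :=
    fun m y hy => pd_T0_eq H (hρ neg) (hε n) hy m
  rcases Fin.eq_self_or_eq_succAbove i d with rfl | ⟨m, rfl⟩
  · rw [dterm_same, dterm_same]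
    congr 1
    exact Finset.sum_congr rfl fun m _ => term_congr (hL.mul m).posK (hpd m) c d hx
  · rw [dterm_succ, dterm_succ]
    exact term_congr hL.posK (hpd m) c i hx

lemma Conv.restrict {X : Type*} [MeasurableSpace X] {μ : Measure X} {f : ℕ → X → ℝ} {g : X → ℝ}
    (h : Conv μ f g) (s : Set X) : Conv (μ.restrict s) f g := by
  refine ⟨fun n => (h.1 n).mono_measure Measure.restrict_le_self, h.2.1.mono_measure Measure.restrict_le_self,
    tendsto_of_tendsto_of_tendsto_of_le_of_le tendsto_const_nhds h.2.2 (fun _ => bot_le) fun n => ?_⟩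
  exact lintegral_mono' Measure.restrict_le_self le_rfl

/-- no `neg` direction -/
def nn : Fin 2 → Prop := fun _ => False

lemma cdom_nn : CDom nn = cpos 2 := by ext; simp [CDom, nn, cpos]
lemma dom_nn : Dom nn = pos 2 := by ext; simp [Dom, nn, pos]

lemma ibp_lim {h : En 2 → ℝ} {Dh : Fin 2 → En 2 → ℝ} (H : Admis nn h Dh) {θ : En 2 → ℝ} (hθ : IsTest θ)
    (m : Fin 2) {ρ : En 2 → ℝ} (hρ : PosK nn ρ) (hρ1 : ∫ s, ρ s = 1) :
    Filter.Tendsto (fun n : ℕ => - ∫ t in pos 1, T0 ρ h (1 / ((n:ℝ) + 1)) (ins m 0 t) * θ (ins m 0 t))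
      Filter.atTop (nhds (∫ y in pos 2, (h y * pd m θ y + Dh m y * θ y))) := by
  have hε : ∀ n : ℕ, 0 < 1 / ((n:ℝ) + 1) := fun n => by positivity
  have h1 := conv_pair ((T0_conv hρ.1 hρ1 H.h2).restrict (pos 2)) ((T0_conv hρ.1 hρ1 (H.d2 m)).restrict (pos 2))
    ((hθ.pd m).memLp 2 _) (hθ.memLp 2 _)
  refine h1.congr fun n => ?_
  have hs := T0_contDiff hρ.1 H.h2 (hε n)
  have h2 := div_thm (n := 1) m hs.continuous
    (v := pd m (T0 ρ h (1 / ((n:ℝ) + 1)))) ?_ (hasPd_of_diff m (hs.differentiable (by simp))) hθ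
  · rw [← h2]
    refine setIntegral_congr_fun (measurableSet_pos 2) fun y hy => ?_
    rw [pd_T0_eq H hρ (hε n) (by rw [cdom_nn]; exact pos_subset_cpos 2 hy) m]
  · have : Continuous (fderiv ℝ (T0 ρ h (1 / ((n:ℝ) + 1)))) := hs.continuous_fderiv (by simp)
    unfold pd; fun_prop

lemma qid {h : En 2 → ℝ} {Dh : Fin 2 → En 2 → ℝ} (H : Admis nn h Dh) {θ : En 2 → ℝ} (hθ : IsTest θ)
    (m : Fin 2) (h0 : ∀ t : En 1, θ (ins m 0 t) = 0) :
    ∫ y in pos 2, (h y * pd m θ y + Dh m y * θ y) = 0 := by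
  obtain ⟨ρ, hρ, hρ1⟩ := exists_posK
  have := ibp_lim H hθ m (hρ nn) hρ1
  simp only [h0, mul_zero, integral_zero, neg_zero] at this
  exact tendsto_nhds_unique this tendsto_const_nhds

lemma isClosed_cdom (neg : Fin 2 → Prop) : IsClosed (CDom neg) := by
  have : CDom neg = ⋂ m, {y : En 2 | neg m ∨ 0 ≤ y m} := by ext; simp [CDom]
  rw [this]
  refine isClosed_iInter fun m => ?_
  by_cases hm : neg m
  · simp [hm]
  · simp only [hm, false_or]; exact isClosed_le continuous_const (by fun_prop)

lemma exists_ext {f : En 2 → ℝ} {s : Set (En 2)} (hs : IsClosed s) (hf : ContinuousOn f s) :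
    ∃ g : En 2 → ℝ, Continuous g ∧ ∀ y ∈ s, f y = g y := by
  obtain ⟨g, hg⟩ := ContinuousMap.exists_restrict_eq hs ⟨s.domRestrict f, hf.domRestrict⟩
  refine ⟨g, g.continuous, fun y hy => ?_⟩
  have := DFunLike.congr_fun hg ⟨y, hy⟩
  exact this.symm

lemma term_continuousOn {neg : Fin 2 → Prop} {L f : En 2 → ℝ} (hL : PosK neg L)
    (hf : ContinuousOn f (CDom neg)) {c : ℝ → ℝ} (hc : Continuous c) (i : Fin 3) :
    ContinuousOn (term i c L f) (cpos 3) := by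
  obtain ⟨g, hg, hfg⟩ := exists_ext (isClosed_cdom neg) hf
  exact (term_continuous hL.1 hg hc i).continuousOn.congr fun x hx => term_congr hL hfg c i hx

lemma edge_cont {h : En 2 → ℝ} {Dh : Fin 2 → En 2 → ℝ} (H : Admis nn h Dh) (hc : ContinuousOn h (cpos 2))
    {θ : En 2 → ℝ} (hθ : IsTest θ) (m : Fin 2) :
    ∫ y in pos 2, (h y * pd m θ y + Dh m y * θ y) = - ∫ t in pos 1, h (ins m 0 t) * θ (ins m 0 t) := by
  obtain ⟨ρ, hρ, hρ1⟩ := exists_posK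
  have hlim := ibp_lim H hθ m (hρ nn) hρ1
  obtain ⟨g, hg, hfg⟩ := exists_ext (isClosed_cdom nn) (by rwa [cdom_nn])
  have hmem : ∀ t ∈ pos 1, ins m 0 t ∈ CDom nn := fun t ht => by
    rw [cdom_nn]; exact (ins_mem_cpos m 0 t).2 ⟨le_rfl, pos_subset_cpos 1 ht⟩
  have hθ0 := hθ.ins0 (n := 1) m
  have hcont : Continuous (fun z : ℝ => ∫ t in tsupport (fun t : En 1 => θ (ins m 0 t)),
      (pos 1).indicator (fun _ => (1:ℝ)) t * (T0 ρ g z (ins m 0 t) * θ (ins m 0 t))) := by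
    have h1 : ∀ z, ∫ t in tsupport (fun t : En 1 => θ (ins m 0 t)),
      (pos 1).indicator (fun _ => (1:ℝ)) t * (T0 ρ g z (ins m 0 t) * θ (ins m 0 t))
      = ∫ t in tsupport (fun t : En 1 => θ (ins m 0 t)), (T0 ρ g z (ins m 0 t) * θ (ins m 0 t)) 
        ∂(volume.restrict (pos 1)) := by
      intro z
      rw [Measure.restrict_restrict (isClosed_tsupport _).measurableSet, inter_comm,
        ← Measure.restrict_restrict (measurableSet_pos 1), ← integral_indicator (measurableSet_pos 1)]
      congr 1; ext t
      by_cases ht : t ∈ pos 1 <;> simp [ht]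
    simp only [h1]
    refine continuous_parametric_integral_of_continuous
      (f := fun z t => T0 ρ g z (ins m 0 t) * θ (ins m 0 t)) ?_ hθ0.2.isCompact
    have h2 := (T0_continuous (hρ nn).1 hg).comp
      (f := fun p : ℝ × En 1 => (p.1, ins m 0 p.2)) (by
        have := (ins0L (n := 1) m).continuous
        simp only [← ins0L_apply]
        fun_prop)
    refine h2.mul ?_
    exact hθ0.continuous.comp continuous_snd
  have hval : ∀ z, 0 ≤ z → ∫ t in pos 1, T0 ρ h z (ins m 0 t) * θ (ins m 0 t)
      = ∫ t in tsupport (fun t : En 1 => θ (ins m 0 t)),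
      (pos 1).indicator (fun _ => (1:ℝ)) t * (T0 ρ g z (ins m 0 t) * θ (ins m 0 t)) := by
    intro z hz
    rw [← integral_indicator (measurableSet_pos 1)]
    refine Eq.trans ?_ (setIntegral_eq_integral_of_forall_compl_eq_zero ?_).symm
    · congr 1; ext t
      by_cases ht : t ∈ pos 1
      · simp [ht, T0_congr (hρ nn) hfg hz (hmem t ht)]
      · simp [ht]
    · intro t ht
      have := image_eq_zero_of_notMem_tsupport ht
      rw [this]; simp
  refine tendsto_nhds_unique hlim ?_
  have h3 := (hcont.tendsto 0).comp tendsto_one_div_add_atTop_nhds_zero_nat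
  rw [← hval 0 le_rfl] at h3
  simp only [T0_zero, hρ1, one_mul] at h3
  refine (h3.neg).congr fun n => ?_
  simp only [Function.comp]
  rw [hval _ (by positivity)]

/-! Gagliardo estimates -/
lemma lint_smul {E : Type*} [NormedAddCommGroup E] [NormedSpace ℝ E] [FiniteDimensional ℝ E]
    [MeasurableSpace E] [BorelSpace E] (μ : Measure E) [μ.IsAddHaarMeasure] (F : E → ENNReal)
    (hF : Measurable F) {r : ℝ} (hr : 0 < r) :
    (∫⁻ x, F (r • x) ∂μ) = ENNReal.ofReal ((r ^ Module.finrank ℝ E)⁻¹) * ∫⁻ x, F x ∂μ := by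
  rw [← lintegral_map hF (measurable_const_smul r), Measure.map_addHaar_smul μ hr.ne',
    lintegral_smul_measure, abs_of_pos (by positivity), smul_eq_mul]

def kk : ENNReal := ∫⁻ t : ℝ, ENNReal.ofReal (1 / (1 + t ^ 2))
def kc1 : ENNReal := ∫⁻ t : ℝ, ENNReal.ofReal (1 / (1 + t ^ 2) ^ 2)
def kc2 : ENNReal := ∫⁻ y : En 2, ENNReal.ofReal (1 / (‖y‖ ^ 2 + 1) ^ 2)
def kc3 : ENNReal := ∫⁻ y : En 2, ENNReal.ofReal (1 / (‖y‖ * (1 + ‖y‖ ^ 2)))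

lemma kk_lt : kk < ⊤ := by
  have := integrable_inv_one_add_sq.lintegral_lt_top
  simpa [kk] using this

lemma kc1_lt : kc1 < ⊤ := by
  refine lt_of_le_of_lt (lintegral_mono fun t => ENNReal.ofReal_le_ofReal ?_) kk_lt
  apply one_div_le_one_div_of_le (by positivity)
  nlinarith [sq_nonneg t, sq_nonneg (t^2)]

lemma kc3_lt : kc3 < ⊤ := by
  have h : Integrable (fun y : En 2 => (fun s : ℝ => 1 / (s * (1 + s ^ 2))) ‖y‖) := by
    refine (integrable_fun_norm_addHaar (E := En 2) volume (f := fun s : ℝ => 1 / (s * (1 + s ^ 2)))).2 ?_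
    refine (integrable_inv_one_add_sq.integrableOn (s := Ioi 0)).congr_fun (fun s hs => ?_) measurableSet_Ioi
    have hs : (0:ℝ) < s := hs
    simp
    field_simp
  exact h.lintegral_lt_top

lemma kc2_lt : kc2 < ⊤ := by
  refine lt_of_le_of_lt (lintegral_mono_ae ?_) kc3_lt
  have h0 : ∀ᵐ y : En 2, y ≠ 0 := by
    rw [ae_iff]; simp
  filter_upwards [h0] with y hy
  have : 0 < ‖y‖ := norm_pos_iff.2 hy
  apply ENNReal.ofReal_le_ofReal
  apply one_div_le_one_div_of_le (by positivity)
  nlinarith [sq_nonneg (‖y‖ - 1), sq_nonneg ‖y‖, sq_nonneg (‖y‖^2)]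

lemma kk_scale {r : ℝ} (hr : 0 < r) :
    (∫⁻ t : ℝ, ENNReal.ofReal (1 / (1 + (t * r) ^ 2))) = ENNReal.ofReal r⁻¹ * kk := by
  have := lint_smul (volume : Measure ℝ) (fun t => ENNReal.ofReal (1 / (1 + t ^ 2))) (by fun_prop) hr
  simp only [Module.finrank_self, pow_one, smul_eq_mul] at this
  rw [kk, ← this]
  congr 1; ext t; rw [mul_comm]

lemma kc1_scale {a : ℝ} (ha : 0 < a) (w : ℝ) :
    (∫⁻ z : ℝ, ENNReal.ofReal (1 / (a ^ 2 + (z - w) ^ 2) ^ 2)) = ENNReal.ofReal ((a ^ 3)⁻¹) * kc1 := by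
  rw [lintegral_sub_right_eq_self (fun z => ENNReal.ofReal (1 / (a ^ 2 + z ^ 2) ^ 2)) w]
  have := lint_smul (volume : Measure ℝ) (fun t => ENNReal.ofReal (1 / (1 + t ^ 2) ^ 2)) (by fun_prop)
    (inv_pos.2 ha)
  simp only [Module.finrank_self, pow_one, smul_eq_mul, inv_inv] at this
  have h2 : ∀ z : ℝ, ENNReal.ofReal (1 / (a ^ 2 + z ^ 2) ^ 2)
      = ENNReal.ofReal ((a ^ 4)⁻¹) * ENNReal.ofReal (1 / (1 + (a⁻¹ * z) ^ 2) ^ 2) := by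
    intro z
    rw [← ENNReal.ofReal_mul (by positivity)]
    congr 1
    field_simp
  simp_rw [h2]
  rw [lintegral_const_mul _ (by fun_prop), this, ← mul_assoc, ← ENNReal.ofReal_mul (by positivity), kc1]
  congr 2
  field_simp

lemma kc2_scale {a : ℝ} (ha : 0 < a) (x : En 2) :
    (∫⁻ y : En 2, ENNReal.ofReal (1 / (‖y - x‖ ^ 2 + a ^ 2) ^ 2)) = ENNReal.ofReal ((a ^ 2)⁻¹) * kc2 := by
  rw [lintegral_sub_right_eq_self (fun z : En 2 => ENNReal.ofReal (1 / (‖z‖ ^ 2 + a ^ 2) ^ 2)) x]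
  have := lint_smul (volume : Measure (En 2)) (fun t => ENNReal.ofReal (1 / (‖t‖ ^ 2 + 1) ^ 2)) (by fun_prop)
    (inv_pos.2 ha)
  have hd : Module.finrank ℝ (En 2) = 2 := by simp [En]
  rw [hd] at this
  have h2 : ∀ z : En 2, ENNReal.ofReal (1 / (‖z‖ ^ 2 + a ^ 2) ^ 2)
      = ENNReal.ofReal ((a ^ 4)⁻¹) * ENNReal.ofReal (1 / (‖a⁻¹ • z‖ ^ 2 + 1) ^ 2) := by
    intro z
    rw [← ENNReal.ofReal_mul (by positivity), norm_smul, Real.norm_of_nonneg (by positivity)]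
    congr 1
    field_simp
  simp_rw [h2]
  rw [lintegral_const_mul _ (by fun_prop), this, ← mul_assoc, ← ENNReal.ofReal_mul (by positivity), kc2]
  congr 2
  field_simp

lemma kc3_scale {r : ℝ} (hr : 0 < r) :
    (∫⁻ y : En 2, ENNReal.ofReal ((r * ‖y‖) ^ 2 / (1 + (r * ‖y‖) ^ 2) / ‖y‖ ^ 3)) ≤ ENNReal.ofReal r * kc3 := by
  have := lint_smul (volume : Measure (En 2)) (fun y => ENNReal.ofReal (1 / (‖y‖ * (1 + ‖y‖ ^ 2)))) (by fun_prop)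
    hr
  have hd : Module.finrank ℝ (En 2) = 2 := by simp [En]
  rw [hd] at this
  have h2 : ∀ z : En 2, ENNReal.ofReal ((r * ‖z‖) ^ 2 / (1 + (r * ‖z‖) ^ 2) / ‖z‖ ^ 3)
      = ENNReal.ofReal (r ^ 3) * ENNReal.ofReal (1 / (‖r • z‖ * (1 + ‖r • z‖ ^ 2))) := by
    intro z
    rw [← ENNReal.ofReal_mul (by positivity), norm_smul, Real.norm_of_nonneg hr.le]
    congr 1
    rcases eq_or_ne (‖z‖) 0 with h | h
    · simp [h]
    · field_simp
  simp_rw [h2]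
  rw [lintegral_const_mul _ (by fun_prop), this, ← mul_assoc, ← ENNReal.ofReal_mul (by positivity), kc3]
  apply le_of_eq
  congr 2
  field_simp

open scoped SchwartzMap FourierTransform in
def sch {f : En 2 → ℝ} (hf : IsTest f) : 𝓢(En 2, ℂ) :=
  HasCompactSupport.toSchwartzMap (f := fun x => (f x : ℂ)) (hf.2.comp_left (g := Complex.ofReal) rfl)
    (Complex.ofRealCLM.contDiff.comp hf.1)

lemma sch_apply {f : En 2 → ℝ} (hf : IsTest f) (x : En 2) : sch hf x = (f x : ℂ) := rfl

open scoped FourierTransform in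
def FT (f : En 2 → ℝ) (ξ : En 2) : ℂ := 𝓕 (fun x => (f x : ℂ)) ξ

open scoped FourierTransform in
lemma FT_sch {f : En 2 → ℝ} (hf : IsTest f) (ξ : En 2) : FT f ξ = 𝓕 (sch hf) ξ := rfl

lemma FT_cont {f : En 2 → ℝ} (hf : IsTest f) : Continuous (FT f) := by
  rw [show FT f = fun ξ => FT f ξ from rfl]
  simp_rw [FT_sch hf]
  exact SchwartzMap.continuous _

lemma lint_sq_eq (g : SchwartzMap (En 2) ℂ) : (∫⁻ x, ‖g x‖ₑ ^ 2) = ENNReal.ofReal (∫ x, ‖g x‖ ^ 2) := by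
  rw [ofReal_integral_eq_lintegral_ofReal]
  · congr 1; ext x
    rw [ENNReal.ofReal_pow (norm_nonneg _), ofReal_norm]
  · have := (g.memLp 2 volume).integrable_norm_pow (by norm_num)
    simpa using this
  · exact Filter.Eventually.of_forall fun x => by positivity

open scoped FourierTransform in
lemma planch_sch (g : SchwartzMap (En 2) ℂ) : (∫⁻ x, ‖g x‖ₑ ^ 2) = ∫⁻ ξ, ‖𝓕 g ξ‖ₑ ^ 2 := by
  rw [lint_sq_eq, lint_sq_eq, SchwartzMap.integral_norm_sq_fourier]

lemma enorm_cast (a : ℝ) : ‖(a : ℂ)‖ₑ = ‖a‖ₑ := by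
  rw [← ofReal_norm, ← ofReal_norm, Complex.norm_real]

lemma planch {f : En 2 → ℝ} (hf : IsTest f) : N2 volume f = ∫⁻ ξ, ‖FT f ξ‖ₑ ^ 2 := by
  have := planch_sch (sch hf)
  simp only [sch_apply, enorm_cast] at this
  exact this

lemma planch_conv {f k : En 2 → ℝ} (hf : IsTest f) (hk : IsTest k) :
    N2 volume (MeasureTheory.convolution f k (ContinuousLinearMap.mul ℝ ℝ) volume)
      = ∫⁻ ξ, ‖FT k ξ‖ₑ ^ 2 * ‖FT f ξ‖ₑ ^ 2 := by
  have h1 := planch_sch (SchwartzMap.convolution (ContinuousLinearMap.mul ℂ ℂ) (sch hf) (sch hk))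
  rw [SchwartzMap.fourier_convolution] at h1
  simp only [SchwartzMap.convolution_apply, SchwartzMap.pairing_apply_apply] at h1
  unfold N2
  convert! h1 using 3 with x ξ
  · rw [← enorm_cast]
    congr 2
    unfold MeasureTheory.convolution
    rw [← integral_complex_ofReal]
    congr 1; ext t
    simp [sch_apply]
  · rw [ContinuousLinearMap.mul_apply', enorm_mul, mul_pow, mul_comm]; rfl

lemma FT_kap {L : En 2 → ℝ} {z : ℝ} (hz : 0 < z) (ξ : En 2) : FT (kap L z) ξ = FT L (-(z • ξ)) := by
  unfold FT
  rw [Real.fourier_eq, Real.fourier_eq]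
  have h := Measure.integral_comp_smul (volume : Measure (En 2))
    (fun v => Real.fourierChar (-inner ℝ v ξ) • ((kap L z v : ℝ) : ℂ)) (-z)
  have hd : Module.finrank ℝ (En 2) = 2 := by simp [En]
  rw [hd] at h
  have hz2 : |((-z) ^ 2)⁻¹| = (z ^ 2)⁻¹ := by rw [abs_of_nonneg (by positivity)]; simp
  rw [hz2] at h
  have h3 : (∫ v : En 2, Real.fourierChar (-inner ℝ v ξ) • ((kap L z v : ℝ) : ℂ))
     = (z ^ 2) • ∫ x : En 2, Real.fourierChar (-inner ℝ (-z • x) ξ) • ((kap L z (-z • x) : ℝ) : ℂ) := by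
    rw [h, smul_smul, mul_inv_cancel₀ (by positivity), one_smul]
  rw [h3, ← integral_smul]
  congr 1; ext x
  have h4 : kap L z (-z • x) = (z ^ 2)⁻¹ * L x := by
    unfold kap
    rw [sub_zero, smul_smul]
    congr 2
    rw [show -z⁻¹ * -z = 1 by field_simp, one_smul]
  rw [h4, inner_smul_left, inner_neg_right, inner_smul_right]
  simp only [Circle.smul_def, smul_eq_mul, Complex.real_smul]
  have : (z : ℂ) ≠ 0 := by exact_mod_cast hz.ne'
  push_cast
  simp
  field_simp

lemma FT_lin {k l : En 2 → ℝ} (hk : IsTest k) (hl : IsTest l) (a b : ℝ) (ξ : En 2) :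
    FT (fun v => a * k v - b * l v) ξ = a * FT k ξ - b * FT l ξ := by
  unfold FT
  rw [Real.fourier_eq, Real.fourier_eq, Real.fourier_eq]
  have ik : Integrable (fun v => Real.fourierChar (-inner ℝ v ξ) • ((k v : ℝ) : ℂ)) :=
    (Real.fourierIntegral_convergent_iff ξ).2 (sch hk).integrable
  have il : Integrable (fun v => Real.fourierChar (-inner ℝ v ξ) • ((l v : ℝ) : ℂ)) :=
    (Real.fourierIntegral_convergent_iff ξ).2 (sch hl).integrable
  rw [← integral_const_mul, ← integral_const_mul, ← integral_sub (ik.const_mul _) (il.const_mul _)]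
  congr 1; ext x
  simp only [Circle.smul_def, smul_eq_mul]
  push_cast
  ring

lemma FT_shift {f : En 2 → ℝ} (hf : IsTest f) (y ξ : En 2) :
    FT (fun v => f (v + y) - f v) ξ = ((Real.fourierChar (inner ℝ y ξ) : ℂ) - 1) * FT f ξ := by
  unfold FT
  rw [Real.fourier_eq, Real.fourier_eq]
  set G : En 2 → ℂ := fun v => Real.fourierChar (-inner ℝ v ξ) • ((f v : ℝ) : ℂ) with hG
  have i1 : Integrable G := (Real.fourierIntegral_convergent_iff ξ).2 (sch hf).integrable
  have h2 : ∀ v, Real.fourierChar (-inner ℝ v ξ) • ((f (v + y) - f v : ℝ) : ℂ)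
      = (Real.fourierChar (inner ℝ y ξ) : ℂ) * G (v + y) - G v := by
    intro v
    simp only [hG, Circle.smul_def, smul_eq_mul]
    rw [← mul_assoc, ← Circle.coe_mul, ← AddChar.map_add_eq_mul, inner_add_left]
    rw [show inner ℝ y ξ + -(inner ℝ v ξ + inner ℝ y ξ) = -inner ℝ v ξ by ring]
    push_cast; ring
  have e1 : (∫ v, Real.fourierChar (-inner ℝ v ξ) • ((f (v + y) - f v : ℝ) : ℂ))
      = ∫ v, ((Real.fourierChar (inner ℝ y ξ) : ℂ) * G (v + y) - G v) :=
    integral_congr_ae (Filter.Eventually.of_forall h2)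
  rw [e1, integral_sub ((i1.comp_add_right y).const_mul _) i1, integral_const_mul,
    integral_add_right_eq_self G y]
  ring

lemma T0_diff_conv {L f : En 2 → ℝ} (hL : IsTest L) (hf : L2M f) {z w : ℝ} (hz : 0 < z) (hw : 0 < w) (a b : ℝ) :
    (fun x => a * T0 L f z x - b * T0 L f w x)
      = MeasureTheory.convolution f (fun v => a * kap L z v - b * kap L w v) (ContinuousLinearMap.mul ℝ ℝ) volume := by
  have hfl := hf.2.locallyIntegrable (by norm_num)
  have hcz : ConvolutionExists f (kap L z) (ContinuousLinearMap.mul ℝ ℝ) volume :=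
    (kap_test hL hz).2.convolutionExists_right _ hfl (kap_test hL hz).continuous
  have hcw : ConvolutionExists f (kap L w) (ContinuousLinearMap.mul ℝ ℝ) volume :=
    (kap_test hL hw).2.convolutionExists_right _ hfl (kap_test hL hw).continuous
  ext x
  rw [T0_eq_convolution L f hz, T0_eq_convolution L f hw]
  unfold MeasureTheory.convolution
  rw [← integral_const_mul, ← integral_const_mul,
    ← integral_sub ((hcz x).integrable.const_mul a) ((hcw x).integrable.const_mul b)]
  congr 1; ext t
  simp only [ContinuousLinearMap.mul_apply']
  ring

lemma planch_A {L f : En 2 → ℝ} (hL : IsTest L) (hf : IsTest f) {z w : ℝ} (hz : 0 < z) (hw : 0 < w) (a b : ℝ) :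
    (∫⁻ x, ‖a * T0 L f z x - b * T0 L f w x‖ₑ ^ 2)
      = ∫⁻ ξ, ‖a * FT L (-(z • ξ)) - b * FT L (-(w • ξ))‖ₑ ^ 2 * ‖FT f ξ‖ₑ ^ 2 := by
  have hf2 : L2M f := ⟨hf.continuous.measurable, hf.memLp _ _⟩
  have h := congrArg (N2 volume) (T0_diff_conv hL hf2 hz hw a b)
  have ht : IsTest (fun v => a * kap L z v - b * kap L w v) :=
    ⟨((kap_test hL hz).mul_left (contDiff_const (c := a))).1.sub ((kap_test hL hw).mul_left (contDiff_const (c := b))).1,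
      ((kap_test hL hz).mul_left (contDiff_const (c := a))).2.sub ((kap_test hL hw).mul_left (contDiff_const (c := b))).2⟩
  rw [planch_conv hf ht] at h
  unfold N2 at h
  rw [h]
  congr 1; ext ξ
  rw [FT_lin (kap_test hL hz) (kap_test hL hw), FT_kap hz, FT_kap hw]

lemma planch_B {L f : En 2 → ℝ} (hL : IsTest L) (hf : IsTest f) {z : ℝ} (hz : 0 < z) (y : En 2) :
    (∫⁻ x, ‖T0 L f z (x + y) - T0 L f z x‖ₑ ^ 2)
      = ∫⁻ ξ, ‖FT L (-(z • ξ))‖ₑ ^ 2 * (‖(Real.fourierChar (inner ℝ y ξ) : ℂ) - 1‖ₑ ^ 2 * ‖FT f ξ‖ₑ ^ 2) := by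
  have hft : IsTest (fun v => f (v + y)) := by
    have := hf.affine (-y) (z := 1) one_ne_zero
    simpa using this
  have hf' : IsTest (fun v => f (v + y) - f v) := ⟨hft.1.sub hf.1, hft.2.sub hf.2⟩
  have hL2 : ∀ {g : En 2 → ℝ}, IsTest g → L2M g := fun hg => ⟨hg.continuous.measurable, hg.memLp _ _⟩
  have h1 : ∀ x, T0 L f z (x + y) - T0 L f z x = T0 L (fun v => f (v + y) - f v) z x := by
    intro x
    have := T0_sub hL (hL2 hft) (hL2 hf) z x
    rw [this]
    congr 1
    unfold T0
    congr 1; ext s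
    rw [show x + y + z • s = x + z • s + y by abel]
  simp_rw [h1]
  have h := planch_conv hf' (kap_test hL hz)
  rw [← T0_eq_convolution L _ hz] at h
  unfold N2 at h
  rw [h]
  congr 1; ext ξ
  rw [FT_kap hz, FT_shift hf, enorm_mul, mul_pow]

lemma slope_est {E F : Type*} [NormedAddCommGroup E] [NormedSpace ℝ E] [NormedAddCommGroup F] [NormedSpace ℝ F]
    {P : E → F} (hP : Differentiable ℝ P) {C : ℝ} (h0 : ∀ x, (1 + ‖x‖) * ‖P x‖ ≤ C)
    (h1 : ∀ x, (1 + ‖x‖) * ‖fderiv ℝ P x‖ ≤ C) (η : E) {z w : ℝ} (hz : 0 ≤ z) (hzw : z ≤ w) :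
    ‖P (z • η) - P (w • η)‖ ^ 2 ≤ 8 * C ^ 2 *
      ((((w - z) * ‖η‖) ^ 2 / (1 + ((w - z) * ‖η‖) ^ 2)) * (1 / (1 + (z * ‖η‖) ^ 2))) := by
  set r := ‖η‖ with hr
  have hr0 : 0 ≤ r := norm_nonneg _
  have hw : 0 ≤ w := hz.trans hzw
  have hC : 0 ≤ C := le_trans (by positivity) (h0 0)
  have hzr : 0 ≤ z * r := by positivity
  have e0 : ∀ t, z ≤ t → ‖P (t • η)‖ ≤ C / (1 + z * r) := by
    intro t ht
    rw [le_div_iff₀ (by positivity)]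
    have := h0 (t • η)
    rw [norm_smul, Real.norm_of_nonneg (hz.trans ht)] at this
    have h3 : z * r ≤ t * r := by gcongr
    nlinarith [norm_nonneg (P (t • η))]
  have e1 : ‖P (z • η) - P (w • η)‖ ≤ C / (1 + z * r) * ((w - z) * r) := by
    have := (convex_segment (𝕜 := ℝ) (z • η) (w • η)).norm_image_sub_le_of_norm_fderiv_le (f := P)
      (C := C / (1 + z * r)) (fun x _ => hP x) (fun x hx => ?_) (right_mem_segment ℝ _ _) (left_mem_segment ℝ _ _)
    · refine this.trans (le_of_eq ?_)
      rw [← sub_smul, norm_smul, Real.norm_of_nonpos (by linarith)]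
      ring
    · obtain ⟨a, b, ha, hb, hab, rfl⟩ := hx
      have h3 := h1 (a • z • η + b • w • η)
      rw [smul_smul, smul_smul, ← add_smul] at h3 ⊢
      have h4 : z ≤ a * z + b * w := by
        have : a = 1 - b := by linarith
        subst this; nlinarith
      rw [norm_smul, Real.norm_of_nonneg (hz.trans h4)] at h3
      rw [le_div_iff₀ (by positivity)]
      have h5 : z * r ≤ (a * z + b * w) * r := by gcongr
      nlinarith [norm_nonneg (fderiv ℝ P ((a * z + b * w) • η))]
  set a := (w - z) * r with ha
  have ha0 : 0 ≤ a := mul_nonneg (by linarith) hr0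
  have e2 : ‖P (z • η) - P (w • η)‖ ≤ C / (1 + z * r) * 2 := by
    have := norm_sub_le (P (z • η)) (P (w • η))
    have h3 := e0 z le_rfl
    have h4 := e0 w hzw
    linarith
  have e3 : (C / (1 + z * r)) ^ 2 ≤ C ^ 2 * (1 / (1 + (z * r) ^ 2)) := by
    rw [div_pow, div_eq_mul_one_div]
    gcongr
    nlinarith
  have e4 : ‖P (z • η) - P (w • η)‖ ^ 2 ≤ (C / (1 + z * r)) ^ 2 * (8 * (a ^ 2 / (1 + a ^ 2))) := by
    rcases le_total a 1 with h | h
    · have : a ^ 2 ≤ 8 * (a ^ 2 / (1 + a ^ 2)) := by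
        rw [← mul_div_assoc, le_div_iff₀ (by positivity)]
        have : a ^ 2 ≤ 1 := by nlinarith
        nlinarith [sq_nonneg a]
      calc _ ≤ (C / (1 + z * r) * a) ^ 2 := by gcongr
        _ = (C / (1 + z * r)) ^ 2 * a ^ 2 := by ring
        _ ≤ _ := by gcongr
    · have : (2:ℝ) ^ 2 ≤ 8 * (a ^ 2 / (1 + a ^ 2)) := by
        rw [← mul_div_assoc, le_div_iff₀ (by positivity)]
        nlinarith
      calc _ ≤ (C / (1 + z * r) * 2) ^ 2 := by gcongr
        _ = (C / (1 + z * r)) ^ 2 * 2 ^ 2 := by ring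
        _ ≤ _ := by gcongr
  calc _ ≤ (C / (1 + z * r)) ^ 2 * (8 * (a ^ 2 / (1 + a ^ 2))) := e4
    _ ≤ (C ^ 2 * (1 / (1 + (z * r) ^ 2))) * (8 * (a ^ 2 / (1 + a ^ 2))) := by gcongr
    _ = _ := by ring

lemma S_lemma {F : Type*} [NormedAddCommGroup F] {g : ℝ → F} {r K : ℝ} (hr : 0 < r) (hK : 0 ≤ K)
    (h : ∀ z w, 0 < z → z ≤ w → ‖g z - g w‖ ^ 2 ≤ K *
      ((((w - z) * r) ^ 2 / (1 + ((w - z) * r) ^ 2)) * (1 / (1 + (z * r) ^ 2)))) :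
    (∫⁻ z in Ioi (0:ℝ), ∫⁻ w in Ioi (0:ℝ), ‖g z - g w‖ₑ ^ 2 * ENNReal.ofReal (1 / (z - w) ^ 2))
      ≤ ENNReal.ofReal K * (2 * kk ^ 2) := by
  set Q : ℝ → ℝ → ENNReal := fun z w =>
    ENNReal.ofReal (1 / (1 + (z * r) ^ 2)) * (ENNReal.ofReal (r ^ 2) * ENNReal.ofReal (1 / (1 + ((w - z) * r) ^ 2))) with hQ
  have hQ1 : ∀ z w, 0 < z → z ≤ w →
      ‖g z - g w‖ₑ ^ 2 * ENNReal.ofReal (1 / (z - w) ^ 2) ≤ ENNReal.ofReal K * Q z w := by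
    intro z w hz hzw
    rw [← ofReal_norm, ← ENNReal.ofReal_pow (norm_nonneg _), ← ENNReal.ofReal_mul (by positivity), hQ]
    dsimp only
    rw [← ENNReal.ofReal_mul (by positivity), ← ENNReal.ofReal_mul (by positivity), ← ENNReal.ofReal_mul hK]
    apply ENNReal.ofReal_le_ofReal
    rcases hzw.eq_or_lt with rfl | hlt
    · simp; positivity
    refine (mul_le_mul_of_nonneg_right (h z w hz hzw) (by positivity)).trans (le_of_eq ?_)
    have h1 : w - z ≠ 0 := by linarith
    rw [show (z - w) ^ 2 = (w - z) ^ 2 by ring]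
    field_simp
  have hQ2 : ∀ z w, 0 < z → 0 < w →
      ‖g z - g w‖ₑ ^ 2 * ENNReal.ofReal (1 / (z - w) ^ 2) ≤ ENNReal.ofReal K * (Q z w + Q w z) := by
    intro z w hz hw
    rcases le_total z w with h | h
    · exact (hQ1 z w hz h).trans (by gcongr; exact le_self_add)
    · have := hQ1 w z hw h
      rw [← enorm_neg, neg_sub, show (w - z) ^ 2 = (z - w) ^ 2 by ring] at this
      exact this.trans (by gcongr; exact le_add_self)
  have hQm : Measurable (fun p : ℝ × ℝ => Q p.1 p.2) := by rw [hQ]; fun_prop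
  have hQm1 : ∀ z, Measurable (fun w => Q z w) := by intro z; rw [hQ]; fun_prop
  have hQm2 : Measurable (fun p : ℝ × ℝ => Q p.2 p.1) := by rw [hQ]; fun_prop
  have hI : (∫⁻ z, ∫⁻ w, Q z w) = kk ^ 2 := by
    have : ∀ z, (∫⁻ w, Q z w) = ENNReal.ofReal (1 / (1 + (z * r) ^ 2)) * (ENNReal.ofReal (r ^ 2) * (ENNReal.ofReal r⁻¹ * kk)) := by
      intro z
      simp only [hQ]
      rw [lintegral_const_mul _ (by fun_prop), lintegral_const_mul _ (by fun_prop),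
        lintegral_sub_right_eq_self (fun w => ENNReal.ofReal (1 / (1 + (w * r) ^ 2))) z, kk_scale hr]
    simp_rw [this]
    rw [lintegral_mul_const _ (by fun_prop), kk_scale hr]
    have h2 : ENNReal.ofReal (r ^ 2) * ENNReal.ofReal r⁻¹ * ENNReal.ofReal r⁻¹ = 1 := by
      rw [← ENNReal.ofReal_mul (by positivity), ← ENNReal.ofReal_mul (by positivity)]
      rw [show r ^ 2 * r⁻¹ * r⁻¹ = 1 by field_simp]; simp
    calc _ = (ENNReal.ofReal (r ^ 2) * ENNReal.ofReal r⁻¹ * ENNReal.ofReal r⁻¹) * kk ^ 2 := by ring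
      _ = _ := by rw [h2, one_mul]
  have hI2 : (∫⁻ z, ∫⁻ w, Q w z) = kk ^ 2 := by
    rw [← hI, lintegral_lintegral_swap (hQm2.aemeasurable)]
  calc _ ≤ ∫⁻ z in Ioi (0:ℝ), ∫⁻ w in Ioi (0:ℝ), ENNReal.ofReal K * (Q z w + Q w z) := by
        refine setLIntegral_mono' measurableSet_Ioi fun z hz => ?_
        exact setLIntegral_mono' measurableSet_Ioi fun w hw => hQ2 z w hz hw
    _ ≤ ∫⁻ z, ∫⁻ w, ENNReal.ofReal K * (Q z w + Q w z) :=
        (setLIntegral_le_lintegral _ _).trans (lintegral_mono fun z => setLIntegral_le_lintegral _ _)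
    _ = ENNReal.ofReal K * ((∫⁻ z, ∫⁻ w, Q z w) + ∫⁻ z, ∫⁻ w, Q w z) := by
        rw [← lintegral_add_left hQm.lintegral_prod_right', ← lintegral_const_mul _ (by
          exact (hQm.lintegral_prod_right').add (hQm2.lintegral_prod_right'))]
        congr 1; ext z
        rw [lintegral_const_mul _ (by exact (hQm1 z).add (by rw [hQ]; fun_prop)), lintegral_add_left (hQm1 z)]
    _ = _ := by rw [hI, hI2]; ring

lemma FT_decay {L : En 2 → ℝ} (hL : IsTest L) : ∃ C : ℝ, 0 ≤ C ∧ Differentiable ℝ (FT L) ∧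
    (∀ x, (1 + ‖x‖) * ‖FT L x‖ ≤ C) ∧ ∀ x, (1 + ‖x‖) * ‖fderiv ℝ (FT L) x‖ ≤ C := by
  obtain ⟨C1, h1p, h1⟩ := (FourierTransform.fourier (sch hL)).decay 0 0
  obtain ⟨C2, h2p, h2⟩ := (FourierTransform.fourier (sch hL)).decay 1 0
  obtain ⟨C3, h3p, h3⟩ := (FourierTransform.fourier (sch hL)).decay 0 1
  obtain ⟨C4, h4p, h4⟩ := (FourierTransform.fourier (sch hL)).decay 1 1
  have e : FT L = ⇑(FourierTransform.fourier (sch hL) : SchwartzMap (En 2) ℂ) := by ext ξ; exact FT_sch hL ξ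
  rw [← e] at h1 h2 h3 h4
  simp only [norm_iteratedFDeriv_zero, norm_iteratedFDeriv_one, pow_zero, pow_one, one_mul] at h1 h2 h3 h4
  refine ⟨C1 + C2 + C3 + C4, by positivity, ?_, fun x => ?_, fun x => ?_⟩
  · rw [e]; exact SchwartzMap.differentiable _
  · have := h1 x; have := h2 x; rw [add_mul, one_mul]; linarith
  · have := h3 x; have := h4 x; rw [add_mul, one_mul]; linarith

lemma cut_decay {c : ℝ → ℝ} (hc : Cut c) : ∃ C : ℝ, 0 ≤ C ∧ Differentiable ℝ c ∧
    (∀ x, (1 + ‖x‖) * ‖c x‖ ≤ C) ∧ ∀ x, (1 + ‖x‖) * ‖fderiv ℝ c x‖ ≤ C := by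
  obtain ⟨M, R, hM, hR, h⟩ := hc.bound
  obtain ⟨M', R', hM', hR', h'⟩ := hc.deriv.bound
  have key : ∀ (N S : ℝ), 0 ≤ N → 0 ≤ S → ∀ f : ℝ → ℝ, (∀ z, |f z| ≤ N ∧ (S < |z| → f z = 0)) →
      ∀ x, (1 + ‖x‖) * |f x| ≤ (1 + S) * N := by
    intro N S hN hS f hf x
    by_cases hx : S < |x|
    · rw [(hf x).2 hx]; simp; positivity
    · push Not at hx
      rw [Real.norm_eq_abs]
      have := (hf x).1
      gcongr
  refine ⟨(1 + R) * M + (1 + R') * M', by positivity, hc.1.differentiable (by simp), fun x => ?_, fun x => ?_⟩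
  · have := key M R hM hR c h x
    rw [Real.norm_eq_abs (c x)]
    have : 0 ≤ (1 + R') * M' := by positivity
    linarith
  · have := key M' R' hM' hR' _ h' x
    rw [← norm_deriv_eq_norm_fderiv, Real.norm_eq_abs (deriv c x)]
    have : 0 ≤ (1 + R) * M := by positivity
    linarith

lemma lint2_le {μ ν : Measure ℝ} [SFinite μ] [SFinite ν] {f k1 k2 : ℝ → ℝ → ENNReal} {a b : ENNReal}
    (h1 : Measurable (fun q : ℝ × ℝ => k1 q.1 q.2)) (h2 : Measurable (fun q : ℝ × ℝ => k2 q.1 q.2))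
    (h : ∀ z w, f z w ≤ a * k1 z w + b * k2 z w) :
    (∫⁻ z, ∫⁻ w, f z w ∂ν ∂μ) ≤ a * (∫⁻ z, ∫⁻ w, k1 z w ∂ν ∂μ) + b * ∫⁻ z, ∫⁻ w, k2 z w ∂ν ∂μ := by
  have q1 : ∀ z, Measurable (fun w : ℝ => k1 z w) := fun z => h1.comp (measurable_prodMk_left)
  have q2 : ∀ z, Measurable (fun w : ℝ => k2 z w) := fun z => h2.comp (measurable_prodMk_left)
  refine (lintegral_mono fun z => lintegral_mono fun w => h z w).trans (le_of_eq ?_)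
  have e : ∀ z, (∫⁻ w, a * k1 z w + b * k2 z w ∂ν) = a * (∫⁻ w, k1 z w ∂ν) + b * ∫⁻ w, k2 z w ∂ν := by
    intro z
    rw [lintegral_add_left ((q1 z).const_mul _), lintegral_const_mul _ (q1 z), lintegral_const_mul _ (q2 z)]
  simp_rw [e]
  rw [lintegral_add_left (h1.lintegral_prod_right'.const_mul _), lintegral_const_mul _ h1.lintegral_prod_right',
    lintegral_const_mul _ h2.lintegral_prod_right']

lemma A_bound {L : En 2 → ℝ} (hL : IsTest L) {c : ℝ → ℝ} (hc : Cut c) : ∃ CA : ENNReal, CA < ⊤ ∧ ∀ ξ : En 2,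
    (∫⁻ z in Ioi (0:ℝ), ∫⁻ w in Ioi (0:ℝ), ‖(c z : ℂ) * FT L (-(z • ξ)) - c w * FT L (-(w • ξ))‖ₑ ^ 2
      * ENNReal.ofReal (1 / (z - w) ^ 2)) ≤ CA := by
  obtain ⟨C, hC, hd, h0, h1⟩ := FT_decay hL
  obtain ⟨C', hC', hd', h0', h1'⟩ := cut_decay hc
  have hb : ∀ x, ‖FT L x‖ ≤ C := fun x => by nlinarith [h0 x, norm_nonneg x, norm_nonneg (FT L x)]
  have hb' : ∀ x, ‖c x‖ ≤ C' := fun x => by nlinarith [h0' x, norm_nonneg x, norm_nonneg (c x)]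
  refine ⟨ENNReal.ofReal (2 * C' ^ 2) * (ENNReal.ofReal (8 * C ^ 2) * (2 * kk ^ 2))
    + ENNReal.ofReal (2 * C ^ 2) * (ENNReal.ofReal (8 * C' ^ 2) * (2 * kk ^ 2)), ?_, fun ξ => ?_⟩
  · have : kk ≠ ⊤ := kk_lt.ne
    finiteness
  have p : ∀ z w, ‖(c z : ℂ) * FT L (-(z • ξ)) - c w * FT L (-(w • ξ))‖ₑ ^ 2 * ENNReal.ofReal (1 / (z - w) ^ 2)
      ≤ ENNReal.ofReal (2 * C' ^ 2) * (‖FT L (-(z • ξ)) - FT L (-(w • ξ))‖ₑ ^ 2 * ENNReal.ofReal (1 / (z - w) ^ 2))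
      + ENNReal.ofReal (2 * C ^ 2) * (‖c z - c w‖ₑ ^ 2 * ENNReal.ofReal (1 / (z - w) ^ 2)) := by
    intro z w
    rw [← mul_assoc, ← mul_assoc, ← add_mul]
    gcongr
    simp only [← ofReal_norm]
    rw [← ENNReal.ofReal_pow (by positivity), ← ENNReal.ofReal_pow (by positivity), ← ENNReal.ofReal_pow (by positivity),
      ← ENNReal.ofReal_mul (by positivity), ← ENNReal.ofReal_mul (by positivity), ← ENNReal.ofReal_add (by positivity) (by positivity)]
    apply ENNReal.ofReal_le_ofReal
    set m := FT L (-(z • ξ))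
    set n := FT L (-(w • ξ))
    have e : (c z : ℂ) * m - c w * n = c z * (m - n) + ((c z - c w : ℝ) : ℂ) * n := by push_cast; ring
    have e2 : ‖(c z : ℂ) * m - c w * n‖ ≤ C' * ‖m - n‖ + C * ‖c z - c w‖ := by
      rw [e]
      refine (norm_add_le _ _).trans ?_
      rw [norm_mul, norm_mul, Complex.norm_real, Complex.norm_real, mul_comm C]
      have := hb' z; have := hb (-(w • ξ))
      gcongr
    calc _ ≤ (C' * ‖m - n‖ + C * ‖c z - c w‖) ^ 2 := by gcongr
      _ ≤ _ := by nlinarith [sq_nonneg (C' * ‖m - n‖ - C * ‖c z - c w‖)]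
  have mc : Measurable c := hc.1.continuous.measurable
  have mF : Measurable (FT L) := (FT_cont hL).measurable
  have mF2 : Measurable (fun z : ℝ => FT L (-(z • ξ))) := mF.comp (by fun_prop)
  have k1 : Measurable (fun q : ℝ × ℝ => ‖FT L (-(q.1 • ξ)) - FT L (-(q.2 • ξ))‖ₑ ^ 2 * ENNReal.ofReal (1 / (q.1 - q.2) ^ 2)) := by
    have := (mF2.comp measurable_fst (β := ℝ)).sub (mF2.comp measurable_snd (α := ℝ × ℝ))
    exact (this.enorm.pow_const 2).mul (by fun_prop)
  have k2 : Measurable (fun q : ℝ × ℝ => ‖c q.1 - c q.2‖ₑ ^ 2 * ENNReal.ofReal (1 / (q.1 - q.2) ^ 2)) := by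
    fun_prop
  have J1 : (∫⁻ z in Ioi (0:ℝ), ∫⁻ w in Ioi (0:ℝ), ‖FT L (-(z • ξ)) - FT L (-(w • ξ))‖ₑ ^ 2 * ENNReal.ofReal (1 / (z - w) ^ 2))
      ≤ ENNReal.ofReal (8 * C ^ 2) * (2 * kk ^ 2) := by
    rcases eq_or_ne ξ 0 with rfl | hξ
    · simp
    · refine S_lemma (norm_pos_iff.2 hξ) (by positivity) fun z w hz hzw => ?_
      have := slope_est hd h0 h1 (-ξ) hz.le hzw
      simpa only [smul_neg, norm_neg] using this
  have J2 : (∫⁻ z in Ioi (0:ℝ), ∫⁻ w in Ioi (0:ℝ), ‖c z - c w‖ₑ ^ 2 * ENNReal.ofReal (1 / (z - w) ^ 2))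
      ≤ ENNReal.ofReal (8 * C' ^ 2) * (2 * kk ^ 2) := by
    refine S_lemma (r := 1) one_pos (by positivity) fun z w hz hzw => ?_
    have := slope_est hd' h0' h1' (1:ℝ) hz.le hzw
    simpa using this
  refine (lint2_le k1 k2 p).trans ?_
  gcongr

lemma char_est (y ξ : En 2) : ‖(Real.fourierChar (inner ℝ y ξ) : ℂ) - 1‖ ^ 2
    ≤ 8 * π ^ 2 * ((‖ξ‖ * ‖y‖) ^ 2 / (1 + (‖ξ‖ * ‖y‖) ^ 2)) := by
  set a := ‖ξ‖ * ‖y‖ with ha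
  have ha0 : 0 ≤ a := by positivity
  have e1 : ‖(Real.fourierChar (inner ℝ y ξ) : ℂ) - 1‖ ≤ 2 * π * a := by
    rw [Real.fourierChar_apply]
    have := Real.norm_exp_I_mul_ofReal_sub_one_le (x := 2 * π * inner ℝ y ξ)
    rw [mul_comm] at this
    refine this.trans ?_
    rw [norm_mul, Real.norm_of_nonneg (by positivity)]
    have := norm_inner_le_norm (𝕜 := ℝ) y ξ
    gcongr
    rw [ha, mul_comm]; exact this
  have e2 : ‖(Real.fourierChar (inner ℝ y ξ) : ℂ) - 1‖ ≤ 2 := by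
    refine (norm_sub_le _ _).trans ?_
    rw [Circle.norm_coe]; norm_num
  have hpi : 1 ≤ π ^ 2 := by nlinarith [Real.pi_gt_three]
  rcases le_total a 1 with h | h
  · have : a ^ 2 ≤ 2 * (a ^ 2 / (1 + a ^ 2)) := by
      rw [← mul_div_assoc, le_div_iff₀ (by positivity)]
      have : a ^ 2 ≤ 1 := by nlinarith
      nlinarith [sq_nonneg a]
    calc _ ≤ (2 * π * a) ^ 2 := by gcongr
      _ = 4 * π ^ 2 * a ^ 2 := by ring
      _ ≤ 4 * π ^ 2 * (2 * (a ^ 2 / (1 + a ^ 2))) := by gcongr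
      _ = _ := by ring
  · have : 1 ≤ 2 * (a ^ 2 / (1 + a ^ 2)) := by
      rw [← mul_div_assoc, le_div_iff₀ (by positivity)]
      nlinarith
    calc _ ≤ (2:ℝ) ^ 2 := by gcongr
      _ ≤ _ := by nlinarith

lemma B_bound {L : En 2 → ℝ} (hL : IsTest L) {c : ℝ → ℝ} (hc : Cut c) : ∃ CB : ENNReal, CB < ⊤ ∧ ∀ ξ : En 2,
    (∫⁻ w in Ioi (0:ℝ), ‖c w‖ₑ ^ 2 * ‖FT L (-(w • ξ))‖ₑ ^ 2) *
      (∫⁻ y, ‖(Real.fourierChar (inner ℝ y ξ) : ℂ) - 1‖ₑ ^ 2 * ENNReal.ofReal (1 / ‖y‖ ^ 3)) ≤ CB := by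
  obtain ⟨C, hC, hd, h0, h1⟩ := FT_decay hL
  obtain ⟨C', hC', hd', h0', h1'⟩ := cut_decay hc
  have hb' : ∀ x, ‖c x‖ ≤ C' := fun x => by nlinarith [h0' x, norm_nonneg x, norm_nonneg (c x)]
  refine ⟨ENNReal.ofReal (C' ^ 2 * C ^ 2) * kk * (ENNReal.ofReal (8 * π ^ 2) * kc3), ?_, fun ξ => ?_⟩
  · have : kk ≠ ⊤ := kk_lt.ne
    have : kc3 ≠ ⊤ := kc3_lt.ne
    finiteness
  rcases eq_or_ne ξ 0 with rfl | hξ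
  · simp
  have hr : 0 < ‖ξ‖ := norm_pos_iff.2 hξ
  have J1 : (∫⁻ w in Ioi (0:ℝ), ‖c w‖ₑ ^ 2 * ‖FT L (-(w • ξ))‖ₑ ^ 2) ≤ ENNReal.ofReal (C' ^ 2 * C ^ 2) * (ENNReal.ofReal ‖ξ‖⁻¹ * kk) := by
    rw [← kk_scale hr, ← lintegral_const_mul _ (by fun_prop)]
    refine (setLIntegral_mono' measurableSet_Ioi fun w hw => ?_).trans (setLIntegral_le_lintegral _ _)
    have hw : 0 < w := hw
    simp only [← ofReal_norm]
    rw [← ENNReal.ofReal_pow (by positivity), ← ENNReal.ofReal_pow (by positivity), ← ENNReal.ofReal_mul (by positivity),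
      ← ENNReal.ofReal_mul (by positivity)]
    apply ENNReal.ofReal_le_ofReal
    have e1 : ‖FT L (-(w • ξ))‖ ^ 2 ≤ C ^ 2 * (1 / (1 + (w * ‖ξ‖) ^ 2)) := by
      have := h0 (-(w • ξ))
      rw [norm_neg, norm_smul, Real.norm_of_nonneg hw.le] at this
      rw [← mul_div_assoc, mul_one, le_div_iff₀ (by positivity)]
      have hw2 : 0 ≤ w * ‖ξ‖ := by positivity
      have hw3 : 1 + (w * ‖ξ‖) ^ 2 ≤ (1 + w * ‖ξ‖) ^ 2 := by nlinarith
      calc _ ≤ ‖FT L (-(w • ξ))‖ ^ 2 * (1 + w * ‖ξ‖) ^ 2 := by gcongr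
        _ = ((1 + w * ‖ξ‖) * ‖FT L (-(w • ξ))‖) ^ 2 := by ring
        _ ≤ _ := by gcongr
    have := hb' w
    calc _ ≤ C' ^ 2 * (C ^ 2 * (1 / (1 + (w * ‖ξ‖) ^ 2))) := by gcongr
      _ = _ := by ring
  have J2 : (∫⁻ y, ‖(Real.fourierChar (inner ℝ y ξ) : ℂ) - 1‖ₑ ^ 2 * ENNReal.ofReal (1 / ‖y‖ ^ 3))
      ≤ ENNReal.ofReal (8 * π ^ 2) * (ENNReal.ofReal ‖ξ‖ * kc3) := by
    refine le_trans ?_ (mul_le_mul_right (kc3_scale hr) _)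
    rw [← lintegral_const_mul _ (by fun_prop)]
    refine lintegral_mono fun y => ?_
    rw [← ofReal_norm, ← ENNReal.ofReal_pow (by positivity), ← ENNReal.ofReal_mul (by positivity),
      ← ENNReal.ofReal_mul (by positivity)]
    apply ENNReal.ofReal_le_ofReal
    have := char_est y ξ
    calc _ ≤ 8 * π ^ 2 * ((‖ξ‖ * ‖y‖) ^ 2 / (1 + (‖ξ‖ * ‖y‖) ^ 2)) * (1 / ‖y‖ ^ 3) := by gcongr
      _ = _ := by ring
  refine (mul_le_mul' J1 J2).trans (le_of_eq ?_)
  have h2 : ENNReal.ofReal ‖ξ‖⁻¹ * ENNReal.ofReal ‖ξ‖ = 1 := by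
    rw [← ENNReal.ofReal_mul (by positivity), inv_mul_cancel₀ hr.ne']; simp
  calc _ = ENNReal.ofReal (C' ^ 2 * C ^ 2) * kk * (ENNReal.ofReal (8 * π ^ 2) * kc3) * (ENNReal.ofReal ‖ξ‖⁻¹ * ENNReal.ofReal ‖ξ‖) := by ring
    _ = _ := by rw [h2, mul_one]

lemma swap3 {X Y Z : Type*} [MeasurableSpace X] [MeasurableSpace Y] [MeasurableSpace Z] {μ : Measure X}
    {ν : Measure Y} {ρ : Measure Z} [SFinite μ] [SFinite ν] [SFinite ρ] {F : X → Y → Z → ENNReal}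
    (hF : Measurable (fun q : (X × Y) × Z => F q.1.1 q.1.2 q.2)) :
    (∫⁻ x, ∫⁻ y, ∫⁻ z, F x y z ∂ρ ∂ν ∂μ) = ∫⁻ z, ∫⁻ x, ∫⁻ y, F x y z ∂ν ∂μ ∂ρ := by
  have h1 := lintegral_prod (μ := μ) (ν := ν) (fun p : X × Y => ∫⁻ z, F p.1 p.2 z ∂ρ)
    (hF.lintegral_prod_right').aemeasurable
  rw [← h1, lintegral_lintegral_swap (μ := μ.prod ν) (f := fun p z => F p.1 p.2 z) hF.aemeasurable]
  congr 1; ext z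
  exact lintegral_prod (μ := μ) (ν := ν) (fun p : X × Y => F p.1 p.2 z)
    (hF.comp measurable_prodMk_right).aemeasurable

lemma fub_bound {X Y Z : Type*} [MeasurableSpace X] [MeasurableSpace Y] [MeasurableSpace Z] {μ : Measure X}
    {ν : Measure Y} {ρ : Measure Z} [SFinite μ] [SFinite ν] [SFinite ρ] {K : X → Y → Z → ENNReal}
    (hK : Measurable (fun q : (X × Y) × Z => K q.1.1 q.1.2 q.2)) {F : Z → ENNReal} (hF : Measurable F) {C : ENNReal}
    (h : ∀ z, (∫⁻ x, ∫⁻ y, K x y z ∂ν ∂μ) ≤ C) :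
    (∫⁻ x, ∫⁻ y, ∫⁻ z, K x y z * F z ∂ρ ∂ν ∂μ) ≤ C * ∫⁻ z, F z ∂ρ := by
  rw [swap3 (F := fun x y z => K x y z * F z) (hK.mul (hF.comp measurable_snd)), ← lintegral_const_mul _ hF]
  refine lintegral_mono fun z => ?_
  have h2 : Measurable (fun q : X × Y => K q.1 q.2 z) := hK.comp (measurable_prodMk_right (y := z))
  have h3 : ∀ x, Measurable (fun y => K x y z) := fun x => h2.comp (measurable_prodMk_left (x := x))
  refine le_trans (le_of_eq ?_) (mul_le_mul_left (h z) _)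
  rw [← lintegral_mul_const _ h2.lintegral_prod_right']
  congr 1; ext x
  rw [lintegral_mul_const _ (h3 x)]

/-- half-line measure -/
def nu : Measure ℝ := volume.restrict (Ioi 0)
instance : SFinite nu := by unfold nu; infer_instance

def kg (p q : ℝ × En 2) : ENNReal := ENNReal.ofReal (1 / (‖p.2 - q.2‖ ^ 2 + (p.1 - q.1) ^ 2) ^ 2)

lemma kg_meas : Measurable (fun r : (ℝ × En 2) × (ℝ × En 2) => kg r.1 r.2) := by
  unfold kg; fun_prop

lemma enorm_sub_sq_le (a b d : ℝ) : ‖a - d‖ₑ ^ 2 ≤ 2 * ‖a - b‖ₑ ^ 2 + 2 * ‖b - d‖ₑ ^ 2 := by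
  simp only [enorm_sq_real]
  rw [show (2:ENNReal) = ENNReal.ofReal 2 by simp, ← ENNReal.ofReal_mul (by norm_num), ← ENNReal.ofReal_mul (by norm_num),
    ← ENNReal.ofReal_add (by positivity) (by positivity)]
  apply ENNReal.ofReal_le_ofReal
  nlinarith [sq_nonneg (a - b - (b - d))]

lemma gag_term1 {u : ℝ × En 2 → ℝ} (hu : Measurable u) :
    (∫⁻ p, ∫⁻ q, ‖u p - u (q.1, p.2)‖ₑ ^ 2 * kg p q ∂(nu.prod volume) ∂(nu.prod volume))
      ≤ kc2 * ∫⁻ z, ∫⁻ w, (∫⁻ x, ‖u (z, x) - u (w, x)‖ₑ ^ 2) * ENNReal.ofReal (1 / (z - w) ^ 2) ∂nu ∂nu := by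
  set H : ℝ → En 2 → ℝ → ENNReal := fun z x w => ‖u (z, x) - u (w, x)‖ₑ ^ 2 * ENNReal.ofReal (1 / (z - w) ^ 2) with hH
  have hHm : Measurable (fun q : (ℝ × En 2) × ℝ => H q.1.1 q.1.2 q.2) := by
    simp only [hH]; fun_prop
  have hHs : ∀ z x, Measurable (fun w => H z x w) := fun z x => by
    simp only [hH]; fun_prop
  have hi : ∀ p : ℝ × En 2, (∫⁻ q, ‖u p - u (q.1, p.2)‖ₑ ^ 2 * kg p q ∂(nu.prod volume)) ≤ kc2 * ∫⁻ w, H p.1 p.2 w ∂nu := by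
    rintro ⟨z, x⟩
    rw [lintegral_prod _ (by unfold kg; fun_prop), ← lintegral_const_mul _ (hHs z x)]
    refine lintegral_mono fun w => ?_
    dsimp only
    rw [lintegral_const_mul _ (by unfold kg; fun_prop)]
    rcases eq_or_ne z w with rfl | hzw
    · simp
    have ha : 0 < |z - w| := abs_pos.2 (sub_ne_zero.2 hzw)
    have := kc2_scale ha x
    rw [sq_abs] at this
    unfold kg
    simp only [norm_sub_rev x, this]
    rw [hH, inv_eq_one_div]
    apply le_of_eq; ring
  refine (lintegral_mono hi).trans ?_
  rw [lintegral_const_mul _ hHm.lintegral_prod_right']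
  gcongr
  rw [lintegral_prod _ hHm.lintegral_prod_right'.aemeasurable]
  refine lintegral_mono fun z => ?_
  rw [lintegral_lintegral_swap (by simp only [hH]; fun_prop)]
  refine lintegral_mono fun w => ?_
  simp only [hH]
  rw [lintegral_mul_const _ (by fun_prop)]

lemma gag_term2 {u : ℝ × En 2 → ℝ} (hu : Measurable u) :
    (∫⁻ p, ∫⁻ q, ‖u (q.1, p.2) - u q‖ₑ ^ 2 * kg p q ∂(nu.prod volume) ∂(nu.prod volume))
      ≤ kc1 * ∫⁻ w, (∫⁻ y : En 2, (∫⁻ x, ‖u (w, x + y) - u (w, x)‖ₑ ^ 2) * ENNReal.ofReal (1 / ‖y‖ ^ 3)) ∂nu := by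
  rw [lintegral_lintegral_swap (by unfold kg; fun_prop)]
  set H : ℝ → En 2 → En 2 → ENNReal := fun w x y => ‖u (w, x + y) - u (w, x)‖ₑ ^ 2 * ENNReal.ofReal (1 / ‖y‖ ^ 3) with hH
  have hHm : Measurable (fun q : (ℝ × En 2) × En 2 => H q.1.1 q.1.2 q.2) := by
    simp only [hH]; fun_prop
  have hHs : ∀ z x, Measurable (fun w => H z x w) := fun z x => by
    simp only [hH]; fun_prop
  have hi : ∀ q : ℝ × En 2, (∫⁻ p, ‖u (q.1, p.2) - u q‖ₑ ^ 2 * kg p q ∂(nu.prod volume)) ≤ kc1 * ∫⁻ y, H q.1 q.2 y := by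
    rintro ⟨w, x⟩
    rw [lintegral_prod_symm _ (by unfold kg; fun_prop), ← lintegral_const_mul _ (hHs w x),
      ← lintegral_sub_right_eq_self (fun y => kc1 * H w x y) x]
    refine lintegral_mono fun y => ?_
    dsimp only
    rw [lintegral_const_mul _ (by unfold kg; fun_prop)]
    rcases eq_or_ne y x with rfl | hyx
    · simp
    have ha : 0 < ‖y - x‖ := norm_pos_iff.2 (sub_ne_zero.2 hyx)
    have := kc1_scale ha w
    have h2 : (∫⁻ z, kg (z, y) (w, x) ∂nu) ≤ ENNReal.ofReal ((‖y - x‖ ^ 3)⁻¹) * kc1 := by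
      rw [← this]; unfold kg nu
      exact setLIntegral_le_lintegral _ _
    refine (mul_le_mul_right h2 _).trans (le_of_eq ?_)
    simp only [hH, inv_eq_one_div]
    rw [show x + (y - x) = y by abel]
    ring
  refine (lintegral_mono hi).trans ?_
  rw [lintegral_const_mul _ hHm.lintegral_prod_right']
  gcongr
  rw [lintegral_prod _ hHm.lintegral_prod_right'.aemeasurable]
  refine lintegral_mono fun z => ?_
  rw [lintegral_lintegral_swap (by simp only [hH]; fun_prop)]
  refine lintegral_mono fun w => ?_
  simp only [hH]
  rw [lintegral_mul_const _ (by fun_prop)]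

def GG (u : ℝ × En 2 → ℝ) : ENNReal :=
  ∫⁻ p, ∫⁻ q, ‖u p - u q‖ₑ ^ 2 * kg p q ∂(nu.prod volume) ∂(nu.prod volume)

lemma GG_le {u : ℝ × En 2 → ℝ} (hu : Measurable u) : GG u ≤
    2 * (kc2 * ∫⁻ z, ∫⁻ w, (∫⁻ x, ‖u (z, x) - u (w, x)‖ₑ ^ 2) * ENNReal.ofReal (1 / (z - w) ^ 2) ∂nu ∂nu)
    + 2 * (kc1 * ∫⁻ w, (∫⁻ y : En 2, (∫⁻ x, ‖u (w, x + y) - u (w, x)‖ₑ ^ 2) * ENNReal.ofReal (1 / ‖y‖ ^ 3)) ∂nu) := by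
  refine le_trans ?_ (add_le_add (mul_le_mul_right (gag_term1 hu) _) (mul_le_mul_right (gag_term2 hu) _))
  have m1 : Measurable (fun r : (ℝ × En 2) × (ℝ × En 2) => ‖u r.1 - u (r.2.1, r.1.2)‖ₑ ^ 2 * kg r.1 r.2) := by
    unfold kg; fun_prop
  have m2 : Measurable (fun r : (ℝ × En 2) × (ℝ × En 2) => ‖u (r.2.1, r.1.2) - u r.2‖ₑ ^ 2 * kg r.1 r.2) := by
    unfold kg; fun_prop
  rw [← lintegral_const_mul _ m1.lintegral_prod_right', ← lintegral_const_mul _ m2.lintegral_prod_right',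
    ← lintegral_add_left (m1.lintegral_prod_right'.const_mul _)]
  refine lintegral_mono fun p => ?_
  have n1 : Measurable (fun q : ℝ × En 2 => ‖u p - u (q.1, p.2)‖ₑ ^ 2 * kg p q) := by
    unfold kg; fun_prop
  have n2 : Measurable (fun q : ℝ × En 2 => ‖u (q.1, p.2) - u q‖ₑ ^ 2 * kg p q) := by
    unfold kg; fun_prop
  dsimp only
  rw [← lintegral_const_mul _ n1, ← lintegral_const_mul _ n2, ← lintegral_add_left (n1.const_mul _)]
  refine lintegral_mono fun q => ?_
  rw [← mul_assoc, ← mul_assoc, ← add_mul]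
  gcongr
  exact enorm_sub_sq_le _ _ _

lemma gag_A {L : En 2 → ℝ} (hL : IsTest L) {c : ℝ → ℝ} (mc : Measurable c) {CA : ENNReal}
    (hA : ∀ ξ : En 2, (∫⁻ z in Ioi (0:ℝ), ∫⁻ w in Ioi (0:ℝ), ‖(c z : ℂ) * FT L (-(z • ξ)) - c w * FT L (-(w • ξ))‖ₑ ^ 2
      * ENNReal.ofReal (1 / (z - w) ^ 2)) ≤ CA) {f : En 2 → ℝ} (hf : IsTest f) :
    (∫⁻ z, ∫⁻ w, (∫⁻ x, ‖c z * T0 L f z x - c w * T0 L f w x‖ₑ ^ 2) * ENNReal.ofReal (1 / (z - w) ^ 2) ∂nu ∂nu)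
      ≤ CA * N2 volume f := by
  have mF : Measurable (FT L) := (FT_cont hL).measurable
  have mf : Measurable (FT f) := (FT_cont hf).measurable
  have mF2 : Measurable (fun z : ℝ × En 2 => FT L (-(z.1 • z.2))) := mF.comp (by fun_prop)
  have a1 : Measurable (fun q : (ℝ × ℝ) × En 2 => FT L (-(q.1.1 • q.2))) :=
    mF2.comp (f := fun q : (ℝ × ℝ) × En 2 => (q.1.1, q.2)) (by fun_prop)
  have a2 : Measurable (fun q : (ℝ × ℝ) × En 2 => FT L (-(q.1.2 • q.2))) :=
    mF2.comp (f := fun q : (ℝ × ℝ) × En 2 => (q.1.2, q.2)) (by fun_prop)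
  have a3 : ∀ z w : ℝ, Measurable (fun ξ : En 2 => ‖(c z : ℂ) * FT L (-(z • ξ)) - c w * FT L (-(w • ξ))‖ₑ ^ 2) := by
    intro z w
    have b1 : ∀ z : ℝ, Measurable (fun ξ : En 2 => FT L (-(z • ξ))) := fun z => mF.comp (by fun_prop)
    have := b1 z; have := b1 w
    fun_prop
  have mk : Measurable (fun q : (ℝ × ℝ) × En 2 => ‖(c q.1.1 : ℂ) * FT L (-(q.1.1 • q.2)) - c q.1.2 * FT L (-(q.1.2 • q.2))‖ₑ ^ 2 * ENNReal.ofReal (1 / (q.1.1 - q.1.2) ^ 2)) := by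
    fun_prop
  rw [planch hf]
  refine le_trans (le_of_eq ?_) (fub_bound (μ := nu) (ν := nu) (ρ := volume) mk (F := fun ξ => ‖FT f ξ‖ₑ ^ 2) (by fun_prop) hA)
  refine setLIntegral_congr_fun measurableSet_Ioi fun z hz => setLIntegral_congr_fun measurableSet_Ioi fun w hw => ?_
  have a4 : Measurable (fun ξ : En 2 => ‖(c z : ℂ) * FT L (-(z • ξ)) - c w * FT L (-(w • ξ))‖ₑ ^ 2 * ‖FT f ξ‖ₑ ^ 2) :=
    (a3 z w).mul (mf.enorm.pow_const 2)
  rw [planch_A hL hf hz hw, ← lintegral_mul_const _ a4]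
  refine lintegral_congr fun ξ => ?_
  ring

@[irreducible] def chi (y ξ : En 2) : ENNReal := ‖(Real.fourierChar (inner ℝ y ξ) : ℂ) - 1‖ₑ ^ 2

lemma chi_meas : Measurable (fun q : En 2 × En 2 => chi q.1 q.2) := by
  have cE : Continuous (fun q : En 2 × En 2 => (Real.fourierChar (inner ℝ q.1 q.2) : ℂ)) :=
    continuous_subtype_val.comp (Real.continuous_fourierChar.comp (by fun_prop))
  unfold chi
  exact ((cE.measurable.sub_const 1).enorm).pow_const 2

lemma chi_meas1 (y : En 2) : Measurable (fun ξ : En 2 => chi y ξ) :=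
  chi_meas.comp (measurable_prodMk_left (x := y))
lemma chi_meas2 (ξ : En 2) : Measurable (fun y : En 2 => chi y ξ) :=
  chi_meas.comp (measurable_prodMk_right (y := ξ))

lemma planch_B1 {L f : En 2 → ℝ} (hL : IsTest L) (hf : IsTest f) {w : ℝ} (hw : 0 < w) (y : En 2) :
    ∫⁻ x, ‖T0 L f w (x + y) - T0 L f w x‖ₑ ^ 2 = ∫⁻ ξ, ‖FT L (-(w • ξ))‖ₑ ^ 2 * (chi y ξ * ‖FT f ξ‖ₑ ^ 2) := by
  unfold chi
  exact planch_B hL hf hw y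


lemma alg_B (a l x r g : ENNReal) : a * (l * (x * g) * r) = a * l * (x * r) * g := by ring

lemma gag_B0 {L : En 2 → ℝ} (hL : IsTest L) {c : ℝ → ℝ} {f : En 2 → ℝ} (hf : IsTest f) {w : ℝ} (hw : 0 < w) (y : En 2) :
    (∫⁻ x, ‖c w * T0 L f w (x + y) - c w * T0 L f w x‖ₑ ^ 2) * ENNReal.ofReal (1 / ‖y‖ ^ 3) =
    ∫⁻ ξ, (‖c w‖ₑ ^ 2 * ‖FT L (-(w • ξ))‖ₑ ^ 2) *
      (chi y ξ * ENNReal.ofReal (1 / ‖y‖ ^ 3)) * ‖FT f ξ‖ₑ ^ 2 := by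
  have hm : ∀ x, ‖c w * T0 L f w (x + y) - c w * T0 L f w x‖ₑ ^ 2 = ‖c w‖ₑ ^ 2 * ‖T0 L f w (x + y) - T0 L f w x‖ₑ ^ 2 := by
    intro x; rw [← mul_sub, enorm_mul, mul_pow]
  have mt : Measurable (fun x => T0 L f w x) :=
    (T0_meas hL hf.continuous.measurable).comp (measurable_prodMk_left (x := w))
  have mt2 : Measurable (fun x => ‖T0 L f w (x + y) - T0 L f w x‖ₑ ^ 2) :=
    (((mt.comp (measurable_add_const y)).sub mt).enorm).pow_const 2
  have b3 : Measurable (fun ξ : En 2 => FT L (-(w • ξ))) := (FT_cont hL).measurable.comp (by fun_prop)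
  have mf : Measurable (FT f) := (FT_cont hf).measurable
  have mE : Measurable (fun ξ : En 2 => chi y ξ) := chi_meas1 y
  have b4 : Measurable (fun ξ => ‖FT L (-(w • ξ))‖ₑ ^ 2 * (chi y ξ * ‖FT f ξ‖ₑ ^ 2)) :=
    (b3.enorm.pow_const 2).mul (mE.mul (mf.enorm.pow_const 2))
  generalize ENNReal.ofReal (1 / ‖y‖ ^ 3) = r
  rw [lintegral_congr hm, lintegral_const_mul _ mt2, planch_B1 hL hf hw y, mul_assoc,
      ← lintegral_mul_const _ b4, ← lintegral_const_mul _ (b4.mul_const _)]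
  exact lintegral_congr fun ξ => alg_B _ _ _ _ _

lemma gag_Bk {L : En 2 → ℝ} (hL : IsTest L) {c : ℝ → ℝ} (mc : Measurable c) :
    Measurable (fun q : (ℝ × En 2) × En 2 => (‖c q.1.1‖ₑ ^ 2 * ‖FT L (-(q.1.1 • q.2))‖ₑ ^ 2) *
      (chi q.1.2 q.2 * ENNReal.ofReal (1 / ‖q.1.2‖ ^ 3))) := by
  have mF2 : Measurable (fun z : ℝ × En 2 => FT L (-(z.1 • z.2))) := (FT_cont hL).measurable.comp (by fun_prop)
  have a1 : Measurable (fun q : (ℝ × En 2) × En 2 => FT L (-(q.1.1 • q.2))) :=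
    mF2.comp (f := fun q : (ℝ × En 2) × En 2 => (q.1.1, q.2)) (by fun_prop)
  have a2 : Measurable (fun q : (ℝ × En 2) × En 2 => chi q.1.2 q.2) :=
    chi_meas.comp (f := fun q : (ℝ × En 2) × En 2 => (q.1.2, q.2)) (by fun_prop)
  have a3 : Measurable (fun q : (ℝ × En 2) × En 2 => c q.1.1) := mc.comp (by fun_prop)
  have a4 : Measurable (fun q : (ℝ × En 2) × En 2 => ENNReal.ofReal (1 / ‖q.1.2‖ ^ 3)) := by fun_prop
  exact ((a3.enorm.pow_const 2).mul (a1.enorm.pow_const 2)).mul (a2.mul a4)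

lemma gag_B {L : En 2 → ℝ} (hL : IsTest L) {c : ℝ → ℝ} (mc : Measurable c) {CB : ENNReal}
    (hB : ∀ ξ : En 2, (∫⁻ w in Ioi (0:ℝ), ‖c w‖ₑ ^ 2 * ‖FT L (-(w • ξ))‖ₑ ^ 2) *
      (∫⁻ y, chi y ξ * ENNReal.ofReal (1 / ‖y‖ ^ 3)) ≤ CB)
    {f : En 2 → ℝ} (hf : IsTest f) :
    (∫⁻ w, (∫⁻ y : En 2, (∫⁻ x, ‖c w * T0 L f w (x + y) - c w * T0 L f w x‖ₑ ^ 2) * ENNReal.ofReal (1 / ‖y‖ ^ 3)) ∂nu)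
      ≤ CB * N2 volume f := by
  have mf : Measurable (FT f) := (FT_cont hf).measurable
  have hk : ∀ ξ : En 2, (∫⁻ w, (∫⁻ y : En 2, (‖c w‖ₑ ^ 2 * ‖FT L (-(w • ξ))‖ₑ ^ 2) *
      (chi y ξ * ENNReal.ofReal (1 / ‖y‖ ^ 3))) ∂nu) ≤ CB := by
    intro ξ
    refine le_trans (le_of_eq ?_) (hB ξ)
    have b3 : Measurable (fun z : ℝ => FT L (-(z • ξ))) := (FT_cont hL).measurable.comp (by fun_prop)
    have mE : Measurable (fun y : En 2 => chi y ξ) :=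
      chi_meas2 ξ
    have m2 : Measurable (fun y : En 2 => chi y ξ * ENNReal.ofReal (1 / ‖y‖ ^ 3)) :=
      mE.mul (by fun_prop)
    have m3 : Measurable (fun w => ‖c w‖ₑ ^ 2 * ‖FT L (-(w • ξ))‖ₑ ^ 2) := (mc.enorm.pow_const 2).mul (b3.enorm.pow_const 2)
    rw [← lintegral_mul_const _ m3]
    exact lintegral_congr fun w => lintegral_const_mul _ m2
  rw [planch hf]
  refine le_trans (le_of_eq ?_) (fub_bound (μ := nu) (ν := volume) (ρ := volume) (gag_Bk hL mc) (F := fun ξ => ‖FT f ξ‖ₑ ^ 2)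
    (mf.enorm.pow_const 2) (C := CB) hk)
  exact setLIntegral_congr_fun measurableSet_Ioi fun w hw => lintegral_congr fun y => gag_B0 hL hf hw y

lemma gag_test {L : En 2 → ℝ} (hL : IsTest L) {c : ℝ → ℝ} (hc : Cut c) : ∃ C : ENNReal, C < ⊤ ∧
    ∀ f, IsTest f → GG (fun p => c p.1 * T0 L f p.1 p.2) ≤ C * N2 volume f := by
  obtain ⟨CA, hCA, hA⟩ := A_bound hL hc
  obtain ⟨CB, hCB, hB⟩ := B_bound hL hc
  have mc : Measurable c := hc.1.continuous.measurable
  refine ⟨2 * (kc2 * CA) + 2 * (kc1 * CB), ?_, fun f hf => ?_⟩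
  · have : kc1 ≠ ⊤ := kc1_lt.ne
    have : kc2 ≠ ⊤ := kc2_lt.ne
    have := hCA.ne; have := hCB.ne
    finiteness
  have mu : Measurable (fun p : ℝ × En 2 => c p.1 * T0 L f p.1 p.2) :=
    (mc.comp measurable_fst).mul (T0_meas hL hf.continuous.measurable)
  refine (GG_le mu).trans ?_
  have j1 := gag_A hL mc hA hf
  have j2 := gag_B hL mc (CB := CB) (by unfold chi; exact hB) hf
  calc _ ≤ 2 * (kc2 * (CA * N2 volume f)) + 2 * (kc1 * (CB * N2 volume f)) := by gcongr
    _ = _ := by ring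

lemma exists_test_conv {h : En 2 → ℝ} (hh : MemLp h 2 volume) : ∃ f : ℕ → En 2 → ℝ, (∀ n, IsTest (f n)) ∧
    ∀ n : ℕ, N2 volume (fun x => f n x - h x) ≤ ENNReal.ofReal (1 / ((n:ℝ) + 1)) ^ 2 := by
  have key : ∀ n : ℕ, ∃ f : En 2 → ℝ, IsTest f ∧ N2 volume (fun x => f x - h x) ≤ ENNReal.ofReal (1 / ((n:ℝ) + 1)) ^ 2 := by
    intro n
    obtain ⟨g, g1, g2, g3⟩ := hh.exist_eLpNorm_sub_le (by simp) (by norm_num) (ε := 1 / ((n:ℝ) + 1)) (by positivity)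
    refine ⟨g, ⟨g2, g1⟩, ?_⟩
    rw [N2_eq]
    have : eLpNorm (fun x => g x - h x) 2 volume = eLpNorm (h - g) 2 volume := eLpNorm_sub_comm g h 2 volume
    rw [this]
    gcongr
  choose f hf using key
  exact ⟨f, fun n => (hf n).1, fun n => (hf n).2⟩

lemma T0_tendsto {L h : En 2 → ℝ} (hL : IsTest L) (hh : L2M h) {f : ℕ → En 2 → ℝ} (hf : ∀ n, L2M (f n))
    (hc : Filter.Tendsto (fun n => N2 volume (fun x => f n x - h x)) Filter.atTop (nhds 0)) {z : ℝ} (hz : z ≠ 0) (y : En 2) :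
    Filter.Tendsto (fun n => T0 L (f n) z y) Filter.atTop (nhds (T0 L h z y)) := by
  rw [tendsto_iff_edist_tendsto_0]
  have hb : ∀ n, edist (T0 L (f n) z y) (T0 L h z y) ^ 2 ≤ N2 volume L * (ENNReal.ofReal (|z|⁻¹ ^ 2) * N2 volume (fun x => f n x - h x)) := by
    intro n
    rw [edist_eq_enorm_sub, ← T0_sub hL (hf n) hh]
    exact T0_sup hL ⟨(hf n).1.sub hh.1, (hf n).2.sub hh.2⟩ hz y
  have h1 : Filter.Tendsto (fun n => N2 volume L * (ENNReal.ofReal (|z|⁻¹ ^ 2) * N2 volume (fun x => f n x - h x))) Filter.atTop (nhds 0) := by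
    have := ENNReal.Tendsto.const_mul (a := N2 volume L) (ENNReal.Tendsto.const_mul (a := ENNReal.ofReal (|z|⁻¹ ^ 2)) hc (by simp)) (Or.inr (hL.memLp 2 volume).N2_lt.ne)
    simpa using this
  have h2 := tendsto_of_tendsto_of_tendsto_of_le_of_le tendsto_const_nhds h1 (fun n => bot_le) hb
  have h3 := (ENNReal.continuous_rpow_const (y := 1/2)).tendsto 0 |>.comp h2
  simp only [Function.comp_def] at h3
  rw [show (0:ENNReal) ^ (1/2 : ℝ) = 0 by simp] at h3
  refine h3.congr fun n => ?_
  rw [← ENNReal.rpow_natCast, ← ENNReal.rpow_mul]; norm_num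

lemma test_L2M {f : En 2 → ℝ} (hf : IsTest f) : L2M f := ⟨hf.continuous.measurable, hf.memLp 2 _⟩

lemma nu_pos : ∀ᵐ p ∂(nu.prod (volume : Measure (En 2))), 0 < p.1 := by
  have : ∀ᵐ z ∂nu, 0 < z := ae_restrict_mem measurableSet_Ioi
  exact Measure.quasiMeasurePreserving_fst.ae this

lemma GG_fatou {u : ℕ → ℝ × En 2 → ℝ} (mu : ∀ n, Measurable (u n)) {v : ℝ × En 2 → ℝ}
    (hpt : ∀ p : ℝ × En 2, 0 < p.1 → Filter.Tendsto (fun n => u n p) Filter.atTop (nhds (v p))) :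
    GG v ≤ Filter.liminf (fun n => GG (u n)) Filter.atTop := by
  have mD : ∀ n, Measurable (fun r : (ℝ × En 2) × (ℝ × En 2) => ‖u n r.1 - u n r.2‖ₑ ^ 2 * kg r.1 r.2) := fun n =>
    (((((mu n).comp measurable_fst).sub ((mu n).comp measurable_snd)).enorm).pow_const 2).mul kg_meas
  have mE : ∀ n p, Measurable (fun q : ℝ × En 2 => ‖u n p - u n q‖ₑ ^ 2 * kg p q) := fun n p => by
    have := mu n
    unfold kg; fun_prop
  unfold GG
  refine le_trans ?_ (lintegral_liminf_le fun n => (mD n).lintegral_prod_right')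
  refine lintegral_mono_ae ?_
  filter_upwards [nu_pos] with p hp
  refine le_trans ?_ (lintegral_liminf_le fun n => mE n p)
  refine lintegral_mono_ae ?_
  filter_upwards [nu_pos] with q hq
  refine le_of_eq (Filter.Tendsto.liminf_eq ?_).symm
  have t1 := ((hpt p hp).sub (hpt q hq)).enorm
  exact ENNReal.Tendsto.mul_const (ENNReal.Tendsto.pow t1) (Or.inr (by simp [kg]))

lemma GG_term {L : En 2 → ℝ} (hL : IsTest L) {c : ℝ → ℝ} (hc : Cut c) {h : En 2 → ℝ} (hh : L2M h) :
    GG (fun p => c p.1 * T0 L h p.1 p.2) < ⊤ := by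
  obtain ⟨C, hC, hb⟩ := gag_test hL hc
  obtain ⟨f, hf, hfc⟩ := exists_test_conv hh.2
  have mc : Measurable c := hc.1.continuous.measurable
  have mu : ∀ n, Measurable (fun p : ℝ × En 2 => c p.1 * T0 L (f n) p.1 p.2) := fun n =>
    (mc.comp measurable_fst).mul (T0_meas hL (hf n).continuous.measurable)
  have h0 : Filter.Tendsto (fun n : ℕ => ENNReal.ofReal (1 / ((n:ℝ) + 1)) ^ 2) Filter.atTop (nhds 0) := by
    have := ENNReal.Tendsto.pow (n := 2) (ENNReal.tendsto_ofReal (tendsto_one_div_add_atTop_nhds_zero_nat (𝕜 := ℝ)))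
    simpa using this
  have hconv := tendsto_of_tendsto_of_tendsto_of_le_of_le tendsto_const_nhds h0 (fun n => bot_le) hfc
  have hpt : ∀ p : ℝ × En 2, 0 < p.1 → Filter.Tendsto (fun n => c p.1 * T0 L (f n) p.1 p.2) Filter.atTop (nhds (c p.1 * T0 L h p.1 p.2)) :=
    fun p hp => (T0_tendsto hL hh (fun n => test_L2M (hf n)) hconv hp.ne' p.2).const_mul _
  have hbd : ∀ n, GG (fun p => c p.1 * T0 L (f n) p.1 p.2) ≤ C * (2 * 1 + 2 * N2 volume h) := by
    intro n
    refine (hb _ (hf n)).trans ?_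
    gcongr
    have e : f n = fun x => (f n x - h x) + h x := by ext x; ring
    rw [e]
    refine (N2_add_le ((test_L2M (hf n)).2.sub hh.2).1).trans ?_
    gcongr
    refine (hfc n).trans ?_
    have : ENNReal.ofReal (1 / ((n:ℝ) + 1)) ≤ 1 := by
      rw [ENNReal.ofReal_le_one, div_le_one (by positivity)]; linarith [(Nat.cast_nonneg n : (0:ℝ) ≤ n)]
    calc _ ≤ (1:ENNReal) ^ 2 := by gcongr
      _ = 1 := by simp
  refine lt_of_le_of_lt ?_ (show C * (2 * 1 + 2 * N2 volume h) < ⊤ by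
    have := hh.2.N2_lt.ne; have := hC.ne; finiteness)
  have step := GG_fatou mu hpt
  refine step.trans (Filter.liminf_le_of_frequently_le' (Filter.Frequently.of_forall hbd))

/-- the Gagliardo double integral -/
def GI (u : En 3 → ℝ) : ENNReal := ∫⁻ x in pos 3, ∫⁻ y in pos 3, ‖(u x - u y) ^ 2 / ‖x - y‖ ^ 4‖ₑ

lemma gag_iff {u : En 3 → ℝ} (hu : Measurable u) : GagH12 octant u ↔ GI u < ⊤ := by
  have hm : Measurable (fun q : En 3 × En 3 => (u q.1 - u q.2) ^ 2 / ‖q.1 - q.2‖ ^ (3 + 1)) := by fun_prop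
  unfold GagH12 GI
  rw [octant_eq]
  constructor
  · intro h
    have := h.2
    rw [hasFiniteIntegral_iff_enorm, lintegral_prod _ hm.enorm.aemeasurable] at this
    exact this
  · intro h
    refine ⟨hm.aestronglyMeasurable, ?_⟩
    rw [hasFiniteIntegral_iff_enorm, lintegral_prod _ hm.enorm.aemeasurable]
    exact h

lemma oct_le (i : Fin 3) (F : En 3 → ENNReal) :
    ∫⁻ x in pos 3, F x ≤ ∫⁻ p, F (ins i p.1 p.2) ∂(nu.prod volume) := by
  have hS : MeasurableSet {x : En 3 | 0 < x i} := measurableSet_lt (by fun_prop) (by fun_prop)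
  have hs : nu.prod (volume : Measure (En 2)) = volume.restrict (Ioi 0 ×ˢ univ) := by
    rw [Measure.volume_eq_prod, ← Measure.prod_restrict, Measure.restrict_univ, nu]
  refine (lintegral_mono_set (t := {x : En 3 | 0 < x i}) (show pos 3 ⊆ _ from fun x hx => hx i)).trans (le_of_eq ?_)
  rw [← lintegral_indicator hS, lintegral_split i, hs, ← lintegral_indicator (measurableSet_Ioi.prod MeasurableSet.univ)]
  congr 1; ext p
  by_cases hp : 0 < p.1 <;> simp [indicator, hp]

lemma gag_kg (i : Fin 3) (u : En 3 → ℝ) (p q : ℝ × En 2) :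
    ‖(u (ins i p.1 p.2) - u (ins i q.1 q.2)) ^ 2 / ‖ins i p.1 p.2 - ins i q.1 q.2‖ ^ 4‖ₑ =
      ‖u (ins i p.1 p.2) - u (ins i q.1 q.2)‖ₑ ^ 2 * kg p q := by
  rw [← ins_sub, show (4:ℕ) = 2 * 2 by norm_num, pow_mul, norm_sq_ins, kg, div_eq_mul_inv, enorm_mul, enorm_pow, ← one_div,
    add_comm (‖p.2 - q.2‖ ^ 2)]
  congr 1
  exact Real.enorm_of_nonneg (by positivity)

lemma gag_term {L : En 2 → ℝ} (hL : IsTest L) {c : ℝ → ℝ} (hc : Cut c) {h : En 2 → ℝ} (hh : L2M h) (i : Fin 3) :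
    GI (term i c L h) < ⊤ := by
  refine lt_of_le_of_lt ?_ (GG_term hL hc hh)
  unfold GI
  refine (oct_le i _).trans (lintegral_mono fun p => (oct_le i _).trans (le_of_eq ?_))
  refine lintegral_congr fun q => ?_
  rw [gag_kg]
  simp [term]

lemma GI_add {u v : En 3 → ℝ} (hu : Measurable u) (hv : Measurable v) (h1 : GI u < ⊤) (h2 : GI v < ⊤) :
    GI (fun x => u x + v x) < ⊤ := by
  have m1 : Measurable (fun q : En 3 × En 3 => ‖(u q.1 - u q.2) ^ 2 / ‖q.1 - q.2‖ ^ 4‖ₑ) := by fun_prop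
  have m2 : Measurable (fun q : En 3 × En 3 => ‖(v q.1 - v q.2) ^ 2 / ‖q.1 - q.2‖ ^ 4‖ₑ) := by fun_prop
  refine lt_of_le_of_lt ?_ (show 2 * GI u + 2 * GI v < ⊤ by have := h1.ne; have := h2.ne; finiteness)
  unfold GI
  rw [← lintegral_const_mul _ m1.lintegral_prod_right', ← lintegral_const_mul _ m2.lintegral_prod_right',
    ← lintegral_add_left (m1.lintegral_prod_right'.const_mul _)]
  refine lintegral_mono fun x => ?_
  have n1 : Measurable (fun y : En 3 => ‖(u x - u y) ^ 2 / ‖x - y‖ ^ 4‖ₑ) := by fun_prop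
  have n2 : Measurable (fun y : En 3 => ‖(v x - v y) ^ 2 / ‖x - y‖ ^ 4‖ₑ) := by fun_prop
  dsimp only
  rw [← lintegral_const_mul _ n1, ← lintegral_const_mul _ n2, ← lintegral_add_left (n1.const_mul _)]
  refine lintegral_mono fun y => ?_
  simp only [Real.enorm_of_nonneg (show 0 ≤ (u x - u y) ^ 2 / ‖x - y‖ ^ 4 by positivity),
    Real.enorm_of_nonneg (show 0 ≤ (v x - v y) ^ 2 / ‖x - y‖ ^ 4 by positivity),
    Real.enorm_of_nonneg (show 0 ≤ (u x + v x - (u y + v y)) ^ 2 / ‖x - y‖ ^ 4 by positivity)]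
  have hr : 0 ≤ ‖x - y‖ ^ 4 := by positivity
  generalize ‖x - y‖ ^ 4 = r at hr ⊢
  rw [show (2:ENNReal) = ENNReal.ofReal 2 by simp, ← ENNReal.ofReal_mul (by norm_num), ← ENNReal.ofReal_mul (by norm_num),
    ← ENNReal.ofReal_add (by positivity) (by positivity)]
  apply ENNReal.ofReal_le_ofReal
  rw [← mul_div_assoc, ← mul_div_assoc, ← add_div]
  gcongr
  nlinarith [sq_nonneg (u x - u y - (v x - v y))]

/-- measurable with finite Gagliardo energy -/
def Gag (u : En 3 → ℝ) : Prop := Measurable u ∧ GI u < ⊤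

lemma Gag.add {u v : En 3 → ℝ} (hu : Gag u) (hv : Gag v) : Gag (fun x => u x + v x) :=
  ⟨hu.1.add hv.1, GI_add hu.1 hv.1 hu.2 hv.2⟩
lemma Gag.zero : Gag (fun _ => 0) := ⟨measurable_const, by simp [GI]⟩
lemma Gag.sum {ι : Type*} (s : Finset ι) {u : ι → En 3 → ℝ} (hu : ∀ k ∈ s, Gag (u k)) : Gag (fun x => ∑ k ∈ s, u k x) := by
  classical
  induction s using Finset.induction_on with
  | empty => simpa using Gag.zero
  | insert a s ha ih =>
    simp only [Finset.sum_insert ha]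
    exact (hu a (by simp)).add (ih fun k hk => hu k (by simp [hk]))
lemma term_gag {L : En 2 → ℝ} (hL : IsTest L) {c : ℝ → ℝ} (hc : Cut c) {h : En 2 → ℝ} (hh : L2M h) (i : Fin 3) :
    Gag (term i c L h) := ⟨term_meas hL hh.1 hc.1.continuous.measurable i, gag_term hL hc hh i⟩
lemma GI_congr {u v : En 3 → ℝ} (h : ∀ x ∈ pos 3, u x = v x) : GI u = GI v := by
  unfold GI
  refine setLIntegral_congr_fun (isOpen_pos 3).measurableSet fun x hx => setLIntegral_congr_fun (isOpen_pos 3).measurableSet fun y hy => ?_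
  simp only [h x hx, h y hy]

lemma IsTest.comb {n : ℕ} {f g : En n → ℝ} (hf : IsTest f) (hg : IsTest g) (a b : ℝ) :
    IsTest (fun x => a * f x + b * g x) :=
  ⟨(contDiff_const.mul hf.1).add (contDiff_const.mul hg.1), (hf.2.mul_left (f := fun _ => a)).add (hg.2.mul_left (f := fun _ => b))⟩

lemma test_integrable {n : ℕ} {f : En n → ℝ} (hf : IsTest f) : Integrable f :=
  memLp_one_iff_integrable.1 (hf.memLp 1 volume)

lemma exists_kerK (neg : Fin 2 → Prop) : ∃ K, Ker neg K ∧ ∫ s, K s = 1 ∧ ∀ m, ∫ s, s m * K s = 0 := by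
  obtain ⟨η, ⟨hη, c, hc, hs⟩, h1⟩ := exists_ker neg
  have hη2 : IsTest (fun s => η ((1/2 : ℝ) • (s - 0))) := hη.affine 0 (by norm_num)
  simp only [sub_zero] at hη2
  have hintg : ∀ f : En 2 → ℝ, ∫ s, f ((1/2:ℝ) • s) = 4 * ∫ s, f s := by
    intro f
    have := integral_affine f 0 (z := 1/2) (by norm_num)
    simp only [zero_add] at this
    rw [this]; norm_num
  refine ⟨fun s => 2 * η s + (-1/4) * η ((1/2:ℝ) • s), ⟨hη.comb hη2 _ _, c, hc, ?_⟩, ?_, ?_⟩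
  · intro s hsK m
    have hcl : s ∈ tsupport η ∪ tsupport (fun s => η ((1/2:ℝ) • s)) := by
      have hsub : Function.support (fun s => 2 * η s + (-1/4) * η ((1/2:ℝ) • s)) ⊆ tsupport η ∪ tsupport (fun s => η ((1/2:ℝ) • s)) := by
        intro x hx
        by_contra hn
        simp only [mem_union, not_or] at hn
        apply hx
        have e1 := image_eq_zero_of_notMem_tsupport hn.1
        have e2 : η ((1/2:ℝ) • x) = 0 := image_eq_zero_of_notMem_tsupport (f := fun s => η ((1/2:ℝ) • s)) hn.2
        simp only [e1, e2]; ring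
      exact closure_minimal hsub ((isClosed_tsupport _).union (isClosed_tsupport _)) hsK
    rcases hcl with h | h
    · exact hs s h m
    · have : (1/2:ℝ) • s ∈ tsupport η := by
        have : tsupport (fun s => η ((1/2:ℝ) • s)) ⊆ (fun s : En 2 => (1/2:ℝ) • s) ⁻¹' tsupport η :=
          tsupport_comp_subset_preimage η (by fun_prop)
        exact this h
      have h2 := hs _ this m
      simp only [PiLp.smul_apply, smul_eq_mul] at h2
      refine ⟨fun hm => ?_, fun hm => ?_⟩
      · have := h2.1 hm; linarith
      · have := h2.2 hm; linarith
  · rw [integral_add ((test_integrable hη).const_mul _) ((test_integrable hη2).const_mul _), integral_const_mul, integral_const_mul,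
      hintg η, h1]; norm_num
  · intro m
    have e : ∀ s : En 2, s m * (2 * η s + (-1/4) * η ((1/2:ℝ) • s)) = 2 * (s m * η s) + (-1/2) * (((1/2:ℝ) • s) m * η ((1/2:ℝ) • s)) := by
      intro s; simp only [PiLp.smul_apply, smul_eq_mul]; ring
    simp only [e]
    have i1 : IsTest (fun s : En 2 => s m * η s) := hη.mul_left (by fun_prop)
    have i2 : IsTest (fun s : En 2 => ((1/2:ℝ) • s) m * η ((1/2:ℝ) • s)) := hη2.mul_left (g := fun s : En 2 => ((1/2:ℝ) • s) m) (by fun_prop)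
    rw [integral_add ((test_integrable i1).const_mul _) ((test_integrable i2).const_mul _), integral_const_mul, integral_const_mul,
      hintg (fun s => s m * η s)]; ring

lemma integral_pd_zero {L : En 2 → ℝ} (hL : IsTest L) (m : Fin 2) : ∫ s, pd m L s = 0 := by
  have hi : Integrable (fun x => fderiv ℝ L x (EuclideanSpace.single m (1:ℝ))) := test_integrable (hL.pd m)
  have h := integral_mul_fderiv_eq_neg_fderiv_mul_of_integrable (𝕜 := ℝ) (μ := (volume : Measure (En 2))) (f := fun _ => (1:ℝ)) (g := L)
    (v := EuclideanSpace.single m (1:ℝ)) (by simp) (by simpa using hi) (by simpa using test_integrable hL)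
    (fun x _ => by fun_prop) (fun x _ => hL.differentiable x)
  simpa [pd] using h

lemma exists_cut : ∃ a : ℝ → ℝ, Cut a ∧ a 0 = 1 ∧ deriv a 0 = 0 := by
  let b : ContDiffBump (0:ℝ) := ⟨1, 2, by norm_num, by norm_num⟩
  refine ⟨b, ⟨b.contDiff, b.hasCompactSupport⟩, b.eventuallyEq_one.eq_of_nhds, ?_⟩
  have : (b : ℝ → ℝ) =ᶠ[nhds 0] fun _ => 1 := b.eventuallyEq_one
  rw [this.deriv_eq]; simp

lemma Cut.zmul {a : ℝ → ℝ} (h : Cut a) : Cut (fun z => z * a z) := ⟨contDiff_id.mul h.1, h.2.mul_left⟩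
lemma Cut.neg {a : ℝ → ℝ} (h : Cut a) : Cut (fun z => - a z) := ⟨h.1.neg, h.2.neg⟩
lemma deriv_zmul {a : ℝ → ℝ} (h : Cut a) : deriv (fun z => z * a z) 0 = a 0 := by
  have := (hasDerivAt_id (0:ℝ)).mul ((h.1.differentiable (by simp)) 0).hasDerivAt
  have e : (fun z => z * a z) = id * a := rfl
  rw [e, this.deriv]; simp

lemma term_zero (i : Fin 3) (c : ℝ → ℝ) (L h : En 2 → ℝ) (y : En 2) : term i c L h (ins i 0 y) = c 0 * ((∫ s, L s) * h y) := by
  simp [term, T0_zero]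

lemma term_zmul {neg : Fin 2 → Prop} {g : En 2 → ℝ} {Dg : Fin 2 → En 2 → ℝ} (H : Admis neg g Dg)
    {L : En 2 → ℝ} (hL : Ker neg L) (a : ℝ → ℝ) (i : Fin 3) (m : Fin 2) {x : En 3} (hx : x ∈ cpos 3) :
    term i (fun z => z * a z) L (Dg m) x = term i (fun z => - a z) (pd m L) g x := by
  unfold term
  rcases (hx i).eq_or_lt with h | h
  · rw [← h, T0_zero, T0_zero, integral_pd_zero hL.1]; ring
  · have := T0_ibp H hL.posK h (pr_mem_cdom neg i hx) m
    linear_combination a (x i) * this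

lemma term_zmul_continuous {L g : En 2 → ℝ} (hL : IsTest L) (hg : L2M g) {a : ℝ → ℝ} (ha : Cut a) (i : Fin 3) :
    Continuous (term i (fun z => z * a z) L g) := by
  obtain ⟨f, hf, hfc⟩ := exists_test_conv hg.2
  obtain ⟨M, R, hM, hR, hb⟩ := ha.bound
  obtain ⟨A, hA⟩ : ∃ A : ℝ, A = √ (N2 volume L).toReal := ⟨_, rfl⟩
  have hA0 : 0 ≤ A := hA ▸ Real.sqrt_nonneg _
  have hA2 : N2 volume L = ENNReal.ofReal (A ^ 2) := by
    rw [hA, Real.sq_sqrt ENNReal.toReal_nonneg, ENNReal.ofReal_toReal (hL.memLp 2 volume).N2_lt.ne]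
  have hest : ∀ n x, |term i (fun z => z * a z) L g x - term i (fun z => z * a z) L (f n) x| ≤ M * (A * (1 / ((n:ℝ) + 1))) := by
    intro n x
    unfold term
    obtain ⟨z, hz⟩ : ∃ z, z = x i := ⟨_, rfl⟩
    rw [← hz, ← mul_sub, ← T0_sub hL hg (test_L2M (hf n)), abs_mul, abs_mul, mul_comm |z|, mul_assoc]
    refine mul_le_mul (hb z).1 ?_ (by positivity) hM
    rcases eq_or_ne z 0 with h0 | h0
    · rw [h0, abs_zero, zero_mul]; positivity
    have h1 := T0_sup hL (h := fun s => g s - f n s) ⟨hg.1.sub (hf n).continuous.measurable, hg.2.sub (test_L2M (hf n)).2⟩ h0 (pr i x)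
    have h2 : N2 volume (fun s => g s - f n s) ≤ ENNReal.ofReal ((1 / ((n:ℝ) + 1)) ^ 2) := by
      rw [ENNReal.ofReal_pow (by positivity)]
      refine le_trans (le_of_eq ?_) (hfc n)
      unfold N2; congr 1; ext s; rw [← enorm_neg, neg_sub]
    have h3 : ‖T0 L (fun s => g s - f n s) z (pr i x)‖ₑ ^ 2 ≤ ENNReal.ofReal (A ^ 2 * (|z|⁻¹ ^ 2 * (1 / ((n:ℝ) + 1)) ^ 2)) := by
      refine h1.trans ?_
      rw [ENNReal.ofReal_mul (by positivity), ENNReal.ofReal_mul (by positivity), hA2]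
      gcongr
    rw [enorm_sq_real, ENNReal.ofReal_le_ofReal_iff (by positivity)] at h3
    have hzp : 0 < |z| := abs_pos.2 h0
    refine abs_le_of_sq_le_sq' ?_ (by positivity) |>.2
    rw [mul_pow, sq_abs (T0 _ _ _ _)]
    calc |z| ^ 2 * T0 L (fun s => g s - f n s) z (pr i x) ^ 2 ≤ |z| ^ 2 * (A ^ 2 * (|z|⁻¹ ^ 2 * (1 / ((n:ℝ) + 1)) ^ 2)) := by gcongr
      _ = (A * (1 / ((n:ℝ) + 1))) ^ 2 := by field_simp
  have hu : TendstoUniformly (fun n => term i (fun z => z * a z) L (f n)) (term i (fun z => z * a z) L g) Filter.atTop := by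
    rw [Metric.tendstoUniformly_iff]
    intro ε hε
    have ht : Filter.Tendsto (fun n : ℕ => M * (A * (1 / ((n:ℝ) + 1)))) Filter.atTop (nhds 0) := by
      have := ((tendsto_one_div_add_atTop_nhds_zero_nat (𝕜 := ℝ)).const_mul A).const_mul M
      simpa using this
    filter_upwards [ht.eventually (gt_mem_nhds hε)] with n hn x
    rw [Real.dist_eq]
    exact (hest n x).trans_lt hn
  exact hu.continuous (Filter.Frequently.of_forall fun n => term_continuous hL (hf n).continuous ha.zmul.1.continuous i)

/-- vanishing on already treated faces -/
lemma term_neg {neg : Fin 2 → Prop} {L h : En 2 → ℝ} (hL : Ker neg L) (h0 : ∀ y, y ∉ cpos 2 → h y = 0) (c : ℝ → ℝ) (i : Fin 3)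
    {m : Fin 2} (hm : neg m) {y : En 2} (hy : 0 < y (m.predAbove i)) : term i c L h (ins (i.succAbove m) 0 y) = 0 := by
  have : T0 L h (ins (i.succAbove m) 0 y i) (pr i (ins (i.succAbove m) 0 y)) = 0 := by
    rw [ins_lat]
    unfold T0
    rw [integral_eq_zero_of_ae]
    refine Filter.Eventually.of_forall fun s => ?_
    by_cases hs : s ∈ tsupport L
    · obtain ⟨_, c, hc, hk⟩ := hL
      have h1 := (hk s hs m).1 hm
      have : h (pr i (ins (i.succAbove m) 0 y) + y (m.predAbove i) • s) = 0 := by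
        apply h0
        intro hcp
        have := hcp m
        simp only [PiLp.add_apply, PiLp.smul_apply, smul_eq_mul, pr_apply, ins_same, zero_add] at this
        nlinarith
      simp [this]
    · simp [image_eq_zero_of_notMem_tsupport hs]
  simp [term, this]

lemma dterm_neg {neg : Fin 2 → Prop} {L h : En 2 → ℝ} {Dh : Fin 2 → En 2 → ℝ} (hL : Ker neg L) (h0 : ∀ y, y ∉ cpos 2 → h y = 0)
    (hd0 : ∀ m y, y ∉ cpos 2 → Dh m y = 0) (c : ℝ → ℝ) (i : Fin 3)
    {m : Fin 2} (hm : neg m) {y : En 2} (hy : 0 < y (m.predAbove i)) (d : Fin 3) : dterm i c L h Dh d (ins (i.succAbove m) 0 y) = 0 := by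
  rcases Fin.eq_self_or_eq_succAbove i d with rfl | ⟨k, rfl⟩
  · rw [dterm_same, term_neg hL h0 _ _ hm hy, Finset.sum_eq_zero, add_zero]
    intro k _
    exact term_neg (hL.mul k) (hd0 k) _ _ hm hy
  · rw [dterm_succ]; exact term_neg hL (hd0 k) _ _ hm hy

lemma dterm_gag {L : En 2 → ℝ} (hL : IsTest L) {c : ℝ → ℝ} (hc : Cut c) (i : Fin 3)
    {h : En 2 → ℝ} (hh : L2M h) {Dh : Fin 2 → En 2 → ℝ} (hDh : ∀ m, L2M (Dh m)) (d : Fin 3) :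
    Gag (dterm i c L h Dh d) := by
  rcases Fin.eq_self_or_eq_succAbove i d with rfl | ⟨m, rfl⟩
  · simp only [funext (dterm_same d c L h Dh)]
    exact (term_gag hL hc.deriv hh d).add (Gag.sum _ fun m _ => term_gag (hL.mul_left (by fun_prop)) hc (hDh m) d)
  · simp only [funext (dterm_succ i c L h Dh m)]
    exact term_gag hL hc (hDh m) i

/-- measurable and square integrable on the quadrant -/
def LQ (f : En 2 → ℝ) : Prop := Measurable f ∧ MemLp f 2 (volume.restrict (pos 2))

structure Pkg (ζ : En 3 → ℝ) (G : Fin 3 → En 3 → ℝ) (H : Fin 3 → Fin 3 → En 3 → ℝ) : Prop where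
  g : IdsJ ζ G
  h : ∀ d, IdsJ (G d) (H d)
  gag : ∀ d d', Gag (H d d')
  c : ContinuousOn ζ (cpos 3)

lemma Pkg.add {ζ ζ' : En 3 → ℝ} {G G' : Fin 3 → En 3 → ℝ} {H H' : Fin 3 → Fin 3 → En 3 → ℝ}
    (h : Pkg ζ G H) (h' : Pkg ζ' G' H') :
    Pkg (fun x => ζ x + ζ' x) (fun d x => G d x + G' d x) (fun d d' x => H d d' x + H' d d' x) :=
  ⟨h.g.add h'.g, fun d => (h.h d).add (h'.h d), fun d d' => (h.gag d d').add (h'.gag d d'), h.c.add h'.c⟩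

structure CD (F : Fin 3 → En 2 → ℝ) (W : Fin 3 → Fin 3 → En 2 → ℝ) (V : Fin 3 → Fin 3 → Fin 2 → En 2 → ℝ) : Prop where
  lF : ∀ e, LQ (F e)
  lW : ∀ e d, LQ (W e d)
  lV : ∀ e d m, LQ (V e d m)
  wF : ∀ e m θ, IsTest θ → tsupport θ ⊆ pos 2 → ∫ y in pos 2, (F e y * pd m θ y + W e (e.succAbove m) y * θ y) = 0
  wW : ∀ e d m θ, IsTest θ → tsupport θ ⊆ pos 2 → ∫ y in pos 2, (W e d y * pd m θ y + V e d m y * θ y) = 0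
  cF : ∀ e, ContinuousOn (F e) (cpos 2)
  PF : ∀ (e : Fin 3) (m : Fin 2) (t : En 1), t ∈ cpos 1 → F e (ins m 0 t) = F (e.succAbove m) (ins (m.predAbove e) 0 t)
  EF : ∀ Θ, IsTest Θ → ∀ e m, edgeF e m (F e) (W e (e.succAbove m)) Θ
    = edgeF (e.succAbove m) (m.predAbove e) (F (e.succAbove m)) (W (e.succAbove m) e) Θ
  EW : ∀ Θ, IsTest Θ → ∀ e m d, d = e ∨ d = e.succAbove m → edgeF e m (W e d) (V e d m) Θ
    = edgeF (e.succAbove m) (m.predAbove e) (W (e.succAbove m) d) (V (e.succAbove m) d (m.predAbove e)) Θ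

def trF (ζ : En 3 → ℝ) (e : Fin 3) (y : En 2) : ℝ := ζ (ins e 0 y)
def trW (G : Fin 3 → En 3 → ℝ) (e d : Fin 3) (y : En 2) : ℝ := G d (ins e 0 y)
def trV (H : Fin 3 → Fin 3 → En 3 → ℝ) (e d : Fin 3) (m : Fin 2) (y : En 2) : ℝ := H d (e.succAbove m) (ins e 0 y)

def ZeroF (F : Fin 3 → En 2 → ℝ) (W : Fin 3 → Fin 3 → En 2 → ℝ) (V : Fin 3 → Fin 3 → Fin 2 → En 2 → ℝ) (e : Fin 3) : Prop :=
  (∀ y ∈ cpos 2, F e y = 0) ∧ (∀ d, ∀ y ∈ pos 2, W e d y = 0) ∧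
    ∀ m d, d = e ∨ d = e.succAbove m → ∀ y ∈ pos 2, V e d m y = 0

lemma JL2.lq {g : En 3 → ℝ} (h : JL2 g) (e : Fin 3) : LQ (fun y => g (ins e 0 y)) :=
  ⟨h.1.comp (measurable_ins0 e), h.2.2 e⟩

lemma Pkg.cd {ζ : En 3 → ℝ} {G : Fin 3 → En 3 → ℝ} {H : Fin 3 → Fin 3 → En 3 → ℝ}
    (h : Pkg ζ G H) : CD (trF ζ) (trW G) (trV H) where
  lF e := h.g.1.lq e
  lW e d := (h.g.2.1 d).lq e
  lV e d m := ((h.h d).2.1 _).lq e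
  wF e m θ hθ hs := h.g.2.2.W θ hθ hs e m
  wW e d m θ hθ hs := (h.h d).2.2.W θ hθ hs e m
  cF e := h.c.comp (f := fun y : En 2 => ins e 0 y) (by fun_prop) fun y hy => (ins_mem_cpos e 0 y).2 ⟨le_rfl, hy⟩
  PF e m t _ := by simp only [trF, ins_ins_comm]
  EF Θ hΘ e m := h.g.2.2.E Θ hΘ e m
  EW Θ hΘ e m d _ := by
    have := (h.h d).2.2.E Θ hΘ e m
    have e1 : trV H (e.succAbove m) d (m.predAbove e) = fun y => H d e (ins (e.succAbove m) 0 y) := by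
      unfold trV; rw [Fin.succAbove_succAbove_predAbove]
    rw [e1]; exact this

lemma LQ.sub {f g : En 2 → ℝ} (hf : LQ f) (hg : LQ g) : LQ (fun y => f y - g y) := ⟨hf.1.sub hg.1, hf.2.sub hg.2⟩

lemma pair_sub {n : ℕ} {μ : Measure (En n)} {f f' g g' : En n → ℝ}
    (h : MemLp f 2 μ) (h' : MemLp f' 2 μ) (hg : MemLp g 2 μ) (hg' : MemLp g' 2 μ)
    {θ θ' : En n → ℝ} (hθ : MemLp θ 2 μ) (hθ' : MemLp θ' 2 μ) :
    ∫ x, ((f x - f' x) * θ x + (g x - g' x) * θ' x) ∂μ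
      = ∫ x, (f x * θ x + g x * θ' x) ∂μ - ∫ x, (f' x * θ x + g' x * θ' x) ∂μ := by
  have i1 : Integrable (fun x => f x * θ x + g x * θ' x) μ := (int_mul h hθ).add (int_mul hg hθ')
  have i2 : Integrable (fun x => f' x * θ x + g' x * θ' x) μ := (int_mul h' hθ).add (int_mul hg' hθ')
  rw [← integral_sub i1 i2]
  congr 1; ext x; ring

lemma edgeF_sub {e : Fin 3} {m : Fin 2} {U U' V V' : En 2 → ℝ} (hU : LQ U) (hU' : LQ U') (hV : LQ V) (hV' : LQ V')
    {Θ : En 3 → ℝ} (hΘ : IsTest Θ) :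
    edgeF e m (fun y => U y - U' y) (fun y => V y - V' y) Θ = edgeF e m U V Θ - edgeF e m U' V' Θ :=
  pair_sub hU.2 hU'.2 hV.2 hV'.2 (((hΘ.pd _).ins0 e).memLp 2 _) ((hΘ.ins0 e).memLp 2 _)

lemma CD.sub {F F' : Fin 3 → En 2 → ℝ} {W W' : Fin 3 → Fin 3 → En 2 → ℝ} {V V' : Fin 3 → Fin 3 → Fin 2 → En 2 → ℝ}
    (h : CD F W V) (h' : CD F' W' V') :
    CD (fun e y => F e y - F' e y) (fun e d y => W e d y - W' e d y) (fun e d m y => V e d m y - V' e d m y) where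
  lF e := (h.lF e).sub (h'.lF e)
  lW e d := (h.lW e d).sub (h'.lW e d)
  lV e d m := (h.lV e d m).sub (h'.lV e d m)
  wF e m θ hθ hs := by
    rw [pair_sub (h.lF _).2 (h'.lF _).2 (h.lW _ _).2 (h'.lW _ _).2 ((hθ.pd m).memLp 2 _) (hθ.memLp 2 _),
      h.wF e m θ hθ hs, h'.wF e m θ hθ hs, sub_zero]
  wW e d m θ hθ hs := by
    rw [pair_sub (h.lW _ _).2 (h'.lW _ _).2 (h.lV _ _ _).2 (h'.lV _ _ _).2 ((hθ.pd m).memLp 2 _) (hθ.memLp 2 _),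
      h.wW e d m θ hθ hs, h'.wW e d m θ hθ hs, sub_zero]
  cF e := (h.cF e).sub (h'.cF e)
  PF e m t ht := by rw [h.PF e m t ht, h'.PF e m t ht]
  EF Θ hΘ e m := by
    rw [edgeF_sub (h.lF _) (h'.lF _) (h.lW _ _) (h'.lW _ _) hΘ, edgeF_sub (h.lF _) (h'.lF _) (h.lW _ _) (h'.lW _ _) hΘ,
      h.EF Θ hΘ e m, h'.EF Θ hΘ e m]
  EW Θ hΘ e m d hd := by
    rw [edgeF_sub (h.lW _ _) (h'.lW _ _) (h.lV _ _ _) (h'.lV _ _ _) hΘ, edgeF_sub (h.lW _ _) (h'.lW _ _) (h.lV _ _ _) (h'.lV _ _ _) hΘ,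
      h.EW Θ hΘ e m d hd, h'.EW Θ hΘ e m d hd]

/-- restriction to the closed quadrant -/
def icq (f : En 2 → ℝ) : En 2 → ℝ := (cpos 2).indicator f

lemma isClosed_cpos (n : ℕ) : IsClosed (cpos n) := by
  simp only [cpos, ofPred_forall]
  exact isClosed_iInter fun j => isClosed_le continuous_const (by fun_prop)

lemma cpos_ae : (cpos 2 : Set (En 2)) =ᵐ[volume] pos 2 := by
  have h0 : ∀ j : Fin 2, volume {x : En 2 | x j = 0} = 0 := by
    intro j
    let p : En 2 →ₗ[ℝ] ℝ := (EuclideanSpace.proj (𝕜 := ℝ) j : En 2 →L[ℝ] ℝ).toLinearMap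
    have := Measure.addHaar_submodule (volume : Measure (En 2)) (LinearMap.ker p) (by
      intro ht
      have : EuclideanSpace.single j (1:ℝ) ∈ LinearMap.ker p := by rw [ht]; trivial
      simp [p] at this)
    convert! this using 2
  have h1 : ∀ᵐ x : En 2, ∀ j, x j ≠ 0 := ae_all_iff.2 fun j => by
    rw [ae_iff]; simpa using h0 j
  filter_upwards [h1] with x hx
  apply propext
  exact ⟨fun h j => lt_of_le_of_ne (h j) (hx j).symm, fun h => pos_subset_cpos 2 h⟩

lemma icq_integral (f g : En 2 → ℝ) : ∫ y, icq f y * g y = ∫ y in pos 2, f y * g y := by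
  rw [← setIntegral_congr_set cpos_ae, ← integral_indicator (isClosed_cpos 2).measurableSet]
  refine integral_congr_ae (Filter.Eventually.of_forall fun y => ?_)
  by_cases h : y ∈ cpos 2 <;> simp [icq, h]

lemma LQ.icq {f : En 2 → ℝ} (h : LQ f) : L2M (icq f) := by
  refine ⟨h.1.indicator (isClosed_cpos 2).measurableSet, ?_⟩
  unfold _root_.icq
  rw [memLp_indicator_iff_restrict (isClosed_cpos 2).measurableSet, Measure.restrict_congr_set cpos_ae]
  exact h.2

def Q0 (neg : Fin 2 → Prop) (m : Fin 2) (U V : En 2 → ℝ) : Prop :=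
  ∀ θ, IsTest θ → tsupport θ ⊆ Dom neg → ∫ y in pos 2, (U y * pd m θ y + V y * θ y) = 0

lemma admis_of_Q0 {neg : Fin 2 → Prop} {U : En 2 → ℝ} {V : Fin 2 → En 2 → ℝ} (hU : LQ U) (hV : ∀ m, LQ (V m))
    (h : ∀ m, Q0 neg m U (V m)) : Admis neg (icq U) (fun m => icq (V m)) := by
  refine ⟨hU.icq, fun m => (hV m).icq, fun θ hθ hs m => ?_⟩
  rw [icq_integral, icq_integral]
  have := h m θ hθ hs
  rw [integral_add (int_mul hU.2 ((hθ.pd m).memLp 2 _)) (int_mul (hV m).2 (hθ.memLp 2 _))] at this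
  linarith

lemma icq_pos (f : En 2 → ℝ) {y : En 2} (hy : y ∈ cpos 2) : icq f y = f y := by simp [icq, hy]

lemma admis_nn {U : En 2 → ℝ} {V : Fin 2 → En 2 → ℝ} (hU : LQ U) (hV : ∀ m, LQ (V m))
    (h : ∀ m θ, IsTest θ → tsupport θ ⊆ pos 2 → ∫ y in pos 2, (U y * pd m θ y + V m y * θ y) = 0) :
    Admis nn (icq U) (fun m => icq (V m)) :=
  admis_of_Q0 hU hV fun m θ hθ hs => h m θ hθ (dom_nn ▸ hs)

lemma qid' {U : En 2 → ℝ} {V : Fin 2 → En 2 → ℝ} (hU : Admis nn (icq U) (fun m => icq (V m))) {θ : En 2 → ℝ}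
    (hθ : IsTest θ) (m : Fin 2) (h0 : ∀ t, θ (ins m 0 t) = 0) : ∫ y in pos 2, (U y * pd m θ y + V m y * θ y) = 0 := by
  rw [← qid hU hθ m h0]
  refine setIntegral_congr_fun (measurableSet_pos 2) fun y hy => ?_
  simp only [icq_pos _ (pos_subset_cpos 2 hy)]

lemma Q0_notneg {neg : Fin 2 → Prop} {U : En 2 → ℝ} {V : Fin 2 → En 2 → ℝ} (hU : Admis nn (icq U) (fun m => icq (V m)))
    {m : Fin 2} (hm : ¬ neg m) : Q0 neg m U (V m) := by
  intro θ hθ hs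
  refine qid' hU hθ m fun t => image_eq_zero_of_notMem_tsupport fun h => ?_
  rcases hs h m with h | h
  · exact hm h
  · simp at h

lemma exists_lift (i : Fin 3) {θ : En 2 → ℝ} (hθ : IsTest θ) : ∃ Θ, IsTest Θ ∧ ∀ y, Θ (ins i 0 y) = θ y := by
  obtain ⟨a, ha, h1, -⟩ := exists_cut
  refine ⟨fun x => a (x i) * θ (pr i x), ⟨?_, ?_⟩, fun y => by simp [h1]⟩
  · exact (ha.1.comp (by fun_prop)).mul (hθ.1.comp (pr i).contDiff)
  · refine HasCompactSupport.intro (K := (fun p : ℝ × En 2 => ins i p.1 p.2) '' (tsupport a ×ˢ tsupport θ))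
      ((ha.2.isCompact.prod hθ.2.isCompact).image (by fun_prop)) fun x hx => ?_
    by_contra hn
    apply hx
    refine ⟨(x i, pr i x), ⟨subset_tsupport _ fun h => hn ?_, subset_tsupport _ fun h => hn ?_⟩, by simp⟩
    · simp [h]
    · simp only [h, mul_zero]

lemma Q0_neg {neg : Fin 2 → Prop} {U V : En 2 → ℝ} (i : Fin 3) (m : Fin 2) (h : ∀ Θ, IsTest Θ → edgeF i m U V Θ = 0) :
    Q0 neg m U V := by
  intro θ hθ _
  obtain ⟨Θ, hΘ, he⟩ := exists_lift i hθ
  rw [← h Θ hΘ]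
  unfold edgeF
  have e : ∀ y, pd (i.succAbove m) Θ (ins i 0 y) = pd m θ y := fun y => by
    rw [← pd_ins0 i hΘ m y, funext he]
  simp only [e, he]

lemma edgeF_zero {e : Fin 3} {m : Fin 2} {U V : En 2 → ℝ} (hU : ∀ y ∈ pos 2, U y = 0) (hV : ∀ y ∈ pos 2, V y = 0) (Θ : En 3 → ℝ) :
    edgeF e m U V Θ = 0 := by
  unfold edgeF
  rw [setIntegral_congr_fun (g := fun _ => 0) (measurableSet_pos 2) fun y hy => by simp [hU y hy, hV y hy]]
  simp

section
variable {F : Fin 3 → En 2 → ℝ} {W : Fin 3 → Fin 3 → En 2 → ℝ} {V : Fin 3 → Fin 3 → Fin 2 → En 2 → ℝ}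

lemma CD.admF (h : CD F W V) (i : Fin 3) : Admis nn (icq (F i)) (fun m => icq (W i (i.succAbove m))) :=
  admis_nn (h.lF i) (fun m => h.lW _ _) fun m θ hθ hs => h.wF i m θ hθ hs

lemma CD.admW (h : CD F W V) (i d : Fin 3) : Admis nn (icq (W i d)) (fun m => icq (V i d m)) :=
  admis_nn (h.lW i d) (fun m => h.lV _ _ _) fun m θ hθ hs => h.wW i d m θ hθ hs

lemma CD.Q0F (h : CD F W V) {i : Fin 3} {neg : Fin 2 → Prop} (hz : ∀ m, neg m → ZeroF F W V (i.succAbove m)) (m : Fin 2) :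
    Q0 neg m (F i) (W i (i.succAbove m)) := by
  by_cases hm : neg m
  · refine Q0_neg i m fun Θ hΘ => ?_
    rw [h.EF Θ hΘ i m]
    exact edgeF_zero (fun y hy => (hz m hm).1 y (pos_subset_cpos 2 hy)) (fun y hy => (hz m hm).2.1 _ y hy) Θ
  · exact Q0_notneg (V := fun m => W i (i.succAbove m)) (h.admF i) hm

lemma CD.Q0W (h : CD F W V) {i : Fin 3} {neg : Fin 2 → Prop} (hz : ∀ m, neg m → ZeroF F W V (i.succAbove m)) (m : Fin 2)
    {d : Fin 3} (hd : d = i ∨ d = i.succAbove m) : Q0 neg m (W i d) (V i d m) := by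
  by_cases hm : neg m
  · refine Q0_neg i m fun Θ hΘ => ?_
    rw [h.EW Θ hΘ i m d hd]
    refine edgeF_zero (fun y hy => (hz m hm).2.1 _ y hy) (fun y hy => (hz m hm).2.2 _ _ ?_ y hy) Θ
    rw [Fin.succAbove_succAbove_predAbove]
    exact hd.symm
  · exact Q0_notneg (V := V i d) (h.admW i d) hm

lemma Q0_limit {m' m : Fin 2} (hne : m ≠ m') {U V : En 2 → ℝ} (hU : LQ U) (hV : LQ V) {θ : En 2 → ℝ} (hθ : IsTest θ)
    (h : ∀ k : ℕ, ∫ y in pos 2, (U y * pd m' (fun y => Real.smoothTransition (k * y m) * θ y) y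
      + V y * (Real.smoothTransition (k * y m) * θ y)) = 0) :
    ∫ y in pos 2, (U y * pd m' θ y + V y * θ y) = 0 := by
  have e : ∀ (k : ℕ) (y : En 2), pd m' (fun y => Real.smoothTransition (k * y m) * θ y) y = Real.smoothTransition (k * y m) * pd m' θ y := by
    intro k y
    have hd : Differentiable ℝ (fun y : En 2 => Real.smoothTransition (k * y m)) :=
      (Real.smoothTransition.contDiff (n := 1)).differentiable (by simp) |>.comp (by fun_prop)
    rw [pd_mul hd hθ.differentiable]
    have : pd m' (fun y : En 2 => Real.smoothTransition (k * y m)) y = 0 := by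
      unfold pd
      have hc := ((Real.smoothTransition.contDiff (n := 1)).differentiable (by simp) (k * y m)).hasDerivAt.comp_hasFDerivAt y
        (((EuclideanSpace.proj (𝕜 := ℝ) m : En 2 →L[ℝ] ℝ).hasFDerivAt (x := y)).const_mul (k:ℝ))
      have hc' := hc.fderiv
      have e2 : (Real.smoothTransition ∘ fun y : En 2 => (k:ℝ) * (EuclideanSpace.proj (𝕜 := ℝ) m : En 2 →L[ℝ] ℝ) y) = fun y : En 2 => Real.smoothTransition (k * y m) := by
        ext; simp
      rw [e2] at hc'
      rw [hc']; simp [hne]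
    rw [this]; ring
  simp only [e] at h
  have hI : Integrable (fun y => U y * pd m' θ y + V y * θ y) (volume.restrict (pos 2)) :=
    (int_mul hU.2 ((hθ.pd m').memLp 2 _)).add (int_mul hV.2 (hθ.memLp 2 _))
  have hlim : Filter.Tendsto (fun k : ℕ => ∫ y in pos 2, (U y * (Real.smoothTransition (k * y m) * pd m' θ y)
      + V y * (Real.smoothTransition (k * y m) * θ y))) Filter.atTop (nhds (∫ y in pos 2, (U y * pd m' θ y + V y * θ y))) := by
    refine tendsto_integral_of_dominated_convergence (fun y => ‖U y * pd m' θ y + V y * θ y‖) (fun k => ?_) hI.norm (fun k => ?_) ?_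
    · have m1 := hU.1
      have m2 := hV.1
      have m3 : Measurable (pd m' θ) := (hθ.pd m').continuous.measurable
      have m4 := hθ.continuous.measurable
      have m5 : Measurable (fun y : En 2 => Real.smoothTransition (k * y m)) :=
        (Real.smoothTransition.continuous.comp (by fun_prop)).measurable
      exact ((m1.mul (m5.mul m3)).add (m2.mul (m5.mul m4))).aestronglyMeasurable
    · refine Filter.Eventually.of_forall fun y => ?_
      have : U y * (Real.smoothTransition (k * y m) * pd m' θ y) + V y * (Real.smoothTransition (k * y m) * θ y)
        = Real.smoothTransition (k * y m) * (U y * pd m' θ y + V y * θ y) := by ring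
      rw [this, norm_mul, Real.norm_of_nonneg (Real.smoothTransition.nonneg _)]
      exact mul_le_of_le_one_left (norm_nonneg _) (Real.smoothTransition.le_one _)
    · refine (ae_restrict_iff' (measurableSet_pos 2)).2 (Filter.Eventually.of_forall fun y hy => ?_)
      refine tendsto_const_nhds.congr' ?_
      have ht : Filter.Tendsto (fun k : ℕ => (k:ℝ) * y m) Filter.atTop Filter.atTop :=
        tendsto_natCast_atTop_atTop.atTop_mul_const (hy m)
      filter_upwards [ht.eventually_ge_atTop 1] with k hk
      rw [Real.smoothTransition.one_of_one_le hk]; ring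
  simp only [h] at hlim
  exact tendsto_nhds_unique hlim tendsto_const_nhds |>.symm ▸ rfl

lemma CD.Q0T (h : CD F W V) {i : Fin 3} {neg : Fin 2 → Prop} (hz : ∀ m, neg m → ZeroF F W V (i.succAbove m)) (m m' : Fin 2) :
    Q0 neg m' (W i (i.succAbove m)) (V i (i.succAbove m') m) := by
  by_cases hne : m = m'
  · subst hne; exact h.Q0W hz m (Or.inr rfl)
  intro θ hθ hs
  refine Q0_limit hne (h.lW _ _) (h.lV _ _ _) hθ fun k => ?_
  have hχ : ContDiff ℝ (⊤ : ℕ∞) (fun y : En 2 => Real.smoothTransition (k * y m)) :=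
    Real.smoothTransition.contDiff.comp (by fun_prop)
  have hk : IsTest (fun y : En 2 => Real.smoothTransition (k * y m) * θ y) := hθ.mul_left hχ
  have hks : tsupport (fun y : En 2 => Real.smoothTransition (k * y m) * θ y) ⊆ Dom neg :=
    (closure_mono (Function.support_mul_subset_right _ _)).trans hs
  obtain ⟨τ, hτ⟩ : ∃ τ, τ = (fun y : En 2 => Real.smoothTransition (k * y m) * θ y) := ⟨_, rfl⟩
  have hb : ∀ y : En 2, Real.smoothTransition (k * y m) * θ y = τ y := fun y => by rw [hτ]
  simp only [hb]
  rw [← hτ] at hk hks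
  have h0 : ∀ t, τ (ins m 0 t) = 0 := fun t => by rw [hτ]; simp
  have A := h.Q0F hz m (pd m' τ) (hk.pd m') ((tsupport_pd τ m').trans hks)
  have B := h.Q0F hz m' (pd m τ) (hk.pd m) ((tsupport_pd τ m).trans hks)
  have C := qid' (V := V i (i.succAbove m')) (h.admW i (i.succAbove m')) hk m h0
  have L1 : ∀ (f g : En 2 → ℝ), LQ f → IsTest g → Integrable (fun y => f y * g y) (volume.restrict (pos 2)) :=
    fun f g hf hg => int_mul hf.2 (hg.memLp 2 _)
  rw [integral_add (L1 _ _ (h.lF _) ((hk.pd m').pd m)) (L1 _ _ (h.lW _ _) (hk.pd m'))] at A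
  rw [integral_add (L1 _ _ (h.lF _) ((hk.pd m).pd m')) (L1 _ _ (h.lW _ _) (hk.pd m))] at B
  rw [integral_add (L1 _ _ (h.lW _ _) (hk.pd m)) (L1 _ _ (h.lV _ _ _) hk)] at C
  rw [integral_add (L1 _ _ (h.lW _ _) (hk.pd m')) (L1 _ _ (h.lV _ _ _) hk)]
  simp only [pd_comm hk.1 m m'] at A
  linarith
end

section
variable (i : Fin 3) (a : ℝ → ℝ) (K f g : En 2 → ℝ) (fm Vi : Fin 2 → En 2 → ℝ) (Vh : Fin 2 → Fin 2 → En 2 → ℝ)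

def zt (x : En 3) : ℝ := term i a K f x + term i (fun z => z * a z) K g x

def Gi (x : En 3) : ℝ := (term i (deriv a) K f x + ∑ k, term i a (fun s => s k * K s) (fm k) x)
  + (term i (deriv fun z => z * a z) K g x + ∑ k, term i (fun z => - a z) (pd k fun s => s k * K s) g x)
def Gm (m : Fin 2) (x : En 3) : ℝ := term i a K (fm m) x + term i (fun z => - a z) (pd m K) g x
def Hi (d : Fin 3) (x : En 3) : ℝ := (dterm i (deriv a) K f fm d x + ∑ k, dterm i a (fun s => s k * K s) (fm k) (Vh k) d x)
  + (dterm i (deriv fun z => z * a z) K g Vi d x + ∑ k, dterm i (fun z => - a z) (pd k fun s => s k * K s) g Vi d x)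
def Hm (m : Fin 2) (d : Fin 3) (x : En 3) : ℝ := dterm i a K (fm m) (Vh m) d x + dterm i (fun z => - a z) (pd m K) g Vi d x

def Gt (d : Fin 3) : En 3 → ℝ := Fin.insertNth (α := fun _ => En 3 → ℝ) i (Gi i a K f g fm) (fun m => Gm i a K g fm m) d
def Ht (d : Fin 3) : Fin 3 → En 3 → ℝ := Fin.insertNth (α := fun _ => Fin 3 → En 3 → ℝ) i (Hi i a K f g fm Vi Vh) (fun m => Hm i a K g fm Vi Vh m) d

lemma Gt_same : Gt i a K f g fm i = Gi i a K f g fm := by simp [Gt]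
lemma Gt_succ (m : Fin 2) : Gt i a K f g fm (i.succAbove m) = Gm i a K g fm m := by simp [Gt]
lemma Ht_same : Ht i a K f g fm Vi Vh i = Hi i a K f g fm Vi Vh := by simp [Ht]
lemma Ht_succ (m : Fin 2) : Ht i a K f g fm Vi Vh (i.succAbove m) = Hm i a K g fm Vi Vh m := by simp [Ht]

variable {i a K f g fm Vi Vh} {neg : Fin 2 → Prop}

lemma build_pkg (hK : Ker neg K) (ha : Cut a) (Hf : Admis neg f fm) (Hg : Admis neg g Vi) (Hm' : ∀ m, Admis neg (fm m) (Vh m))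
    (hc : ContinuousOn f (CDom neg)) : Pkg (zt i a K f g) (Gt i a K f g fm) (Ht i a K f g fm Vi Vh) := by
  have hGH : ∀ d, IdsJ (Gt i a K f g fm d) (Ht i a K f g fm Vi Vh d) := by
    intro d
    rcases Fin.eq_self_or_eq_succAbove i d with rfl | ⟨m, rfl⟩
    · rw [Gt_same, Ht_same]
      exact ((term_idsJ Hf hK ha.deriv d).add (IdsJ.sum _ fun k => term_idsJ (Hm' k) (hK.mul k) ha d)).add
        ((term_idsJ Hg hK ha.zmul.deriv d).add (IdsJ.sum _ fun k => term_idsJ Hg ((hK.mul k).pd k) ha.neg d))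
    · rw [Gt_succ, Ht_succ]
      exact (term_idsJ (Hm' m) hK ha i).add (term_idsJ Hg (hK.pd m) ha.neg i)
  refine ⟨?_, hGH, ?_, ?_⟩
  · have h := (term_idsJ Hf hK ha i).add (term_idsJ Hg hK ha.zmul i)
    refine ⟨h.1, fun d => (hGH d).1, ids_congr (fun x _ => rfl) (fun d x hx => ?_) h.2.2⟩
    rcases Fin.eq_self_or_eq_succAbove i d with rfl | ⟨m, rfl⟩
    · rw [Gt_same, dterm_same, dterm_same]
      unfold Gi
      simp only [term_zmul Hg (hK.mul _) a d _ hx]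
    · rw [Gt_succ, dterm_succ, dterm_succ]
      unfold Gm
      rw [term_zmul Hg hK a i m hx]
  · intro d d'
    rcases Fin.eq_self_or_eq_succAbove i d with rfl | ⟨m, rfl⟩
    · rw [Ht_same]
      exact ((dterm_gag hK.1 ha.deriv d Hf.h2 Hf.d2 d').add
        (Gag.sum _ fun k _ => dterm_gag (hK.mul k).1 ha d (Hm' k).h2 (Hm' k).d2 d')).add
        ((dterm_gag hK.1 ha.zmul.deriv d Hg.h2 Hg.d2 d').add
        (Gag.sum _ fun k _ => dterm_gag ((hK.mul k).pd k).1 ha.neg d Hg.h2 Hg.d2 d'))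
    · rw [Ht_succ]
      exact (dterm_gag hK.1 ha i (Hm' m).h2 (Hm' m).d2 d').add (dterm_gag (hK.pd m).1 ha.neg i Hg.h2 Hg.d2 d')
  · exact (term_continuousOn hK.posK hc ha.1.continuous i).add (term_zmul_continuous hK.1 Hg.h2 ha i).continuousOn

lemma build_tr (hK : Ker neg K) (hK1 : ∫ s, K s = 1) (hK2 : ∀ m, ∫ s, s m * K s = 0) (ha : Cut a) (ha1 : a 0 = 1) (ha2 : deriv a 0 = 0)
    (y : En 2) : zt i a K f g (ins i 0 y) = f y ∧ Gt i a K f g fm i (ins i 0 y) = g y ∧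
      (∀ m, Gt i a K f g fm (i.succAbove m) (ins i 0 y) = fm m y) ∧
      (∀ m, Ht i a K f g fm Vi Vh i (i.succAbove m) (ins i 0 y) = Vi m y) ∧
      (∀ m, Ht i a K f g fm Vi Vh (i.succAbove m) (i.succAbove m) (ins i 0 y) = Vh m m y) := by
  have hp : ∀ k, ∫ s, pd k (fun s => s k * K s) s = 0 := fun k => integral_pd_zero (hK.mul k).1 k
  have hp' : ∀ k, ∫ s, pd k K s = 0 := fun k => integral_pd_zero hK.1 k
  have hz := deriv_zmul ha
  refine ⟨?_, ?_, fun m => ?_, fun m => ?_, fun m => ?_⟩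
  · simp [zt, term_zero, hK1, ha1]
  · rw [Gt_same]; simp [Gi, term_zero, hK1, hK2, hp, ha1, ha2, hz]
  · rw [Gt_succ]; simp [Gm, term_zero, hK1, hp', ha1]
  · rw [Ht_same]; simp [Hi, dterm_succ, term_zero, hK1, hK2, hp, ha1, ha2, hz]
  · rw [Ht_succ]; simp [Hm, dterm_succ, term_zero, hK1, hp', ha1]

lemma build_neg (hK : Ker neg K) (hf : ∀ y, y ∉ cpos 2 → f y = 0) (hg : ∀ y, y ∉ cpos 2 → g y = 0)
    (hfm : ∀ m y, y ∉ cpos 2 → fm m y = 0) (hVi : ∀ m y, y ∉ cpos 2 → Vi m y = 0) (hVh : ∀ m k y, y ∉ cpos 2 → Vh m k y = 0)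
    {m : Fin 2} (hm : neg m) {y : En 2} (hy : 0 < y (m.predAbove i)) :
    zt i a K f g (ins (i.succAbove m) 0 y) = 0 ∧ (∀ d, Gt i a K f g fm d (ins (i.succAbove m) 0 y) = 0) ∧
      ∀ d d', Ht i a K f g fm Vi Vh d d' (ins (i.succAbove m) 0 y) = 0 := by
  refine ⟨?_, fun d => ?_, fun d d' => ?_⟩
  · simp [zt, term_neg hK hf _ i hm hy, term_neg hK hg _ i hm hy]
  · rcases Fin.eq_self_or_eq_succAbove i d with rfl | ⟨k, rfl⟩
    · rw [Gt_same]
      have e1 : ∀ k, term d a (fun s => s k * K s) (fm k) (ins (d.succAbove m) 0 y) = 0 := fun k => term_neg (hK.mul k) (hfm k) _ d hm hy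
      have e2 : ∀ k, term d (fun z => - a z) (pd k fun s => s k * K s) g (ins (d.succAbove m) 0 y) = 0 := fun k => term_neg ((hK.mul k).pd k) hg _ d hm hy
      simp only [Gi, term_neg hK hf _ d hm hy, term_neg hK hg _ d hm hy, e1, e2]; simp
    · rw [Gt_succ]
      simp only [Gm, term_neg hK (hfm k) _ i hm hy, term_neg (hK.pd k) hg _ i hm hy]; simp
  · rcases Fin.eq_self_or_eq_succAbove i d with rfl | ⟨k, rfl⟩
    · rw [Ht_same]
      have e1 : ∀ k, dterm d a (fun s => s k * K s) (fm k) (Vh k) d' (ins (d.succAbove m) 0 y) = 0 := fun k => dterm_neg (hK.mul k) (hfm k) (hVh k) _ d hm hy d'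
      have e2 : ∀ k, dterm d (fun z => - a z) (pd k fun s => s k * K s) g Vi d' (ins (d.succAbove m) 0 y) = 0 := fun k => dterm_neg ((hK.mul k).pd k) hg hVi _ d hm hy d'
      simp only [Hi, dterm_neg hK hf hfm _ d hm hy, dterm_neg hK hg hVi _ d hm hy, e1, e2]; simp
    · rw [Ht_succ]
      simp only [Hm, dterm_neg hK (hfm k) (hVh k) _ i hm hy, dterm_neg (hK.pd k) hg hVi _ i hm hy]; simp
end

lemma icq_off (f : En 2 → ℝ) (y : En 2) (hy : y ∉ cpos 2) : icq f y = 0 := by simp [icq, hy]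

def clip (y : En 2) : En 2 := WithLp.toLp 2 fun j => max 0 (y j)

lemma clip_apply (y : En 2) (j : Fin 2) : clip y j = max 0 (y j) := rfl
lemma continuous_clip : Continuous clip := by
  unfold clip
  refine (PiLp.continuous_toLp 2 _).comp ?_
  fun_prop

section
variable {F : Fin 3 → En 2 → ℝ} {W : Fin 3 → Fin 3 → En 2 → ℝ} {V : Fin 3 → Fin 3 → Fin 2 → En 2 → ℝ}

lemma CD.edge_zero (h : CD F W V) {i : Fin 3} {neg : Fin 2 → Prop} (hz : ∀ m, neg m → ZeroF F W V (i.succAbove m))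
    {m : Fin 2} (hm : neg m) {y : En 2} (hy : y ∈ cpos 2) (hy0 : y m = 0) : F i y = 0 := by
  have e : y = ins m 0 (pr m y) := by rw [← hy0, ins_pr]
  have ht : pr m y ∈ cpos 1 := fun j => by rw [pr_apply]; exact hy _
  rw [e, h.PF i m _ ht]
  exact (hz m hm).1 _ ((ins_mem_cpos _ _ _).2 ⟨le_rfl, ht⟩)

lemma CD.cont_ext (h : CD F W V) {i : Fin 3} {neg : Fin 2 → Prop} (hz : ∀ m, neg m → ZeroF F W V (i.succAbove m)) :
    ContinuousOn (icq (F i)) (CDom neg) := by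
  have hcl : ∀ y, clip y ∈ cpos 2 := fun y j => by rw [clip_apply]; exact le_max_left _ _
  have : ContinuousOn (fun y => F i (clip y)) (CDom neg) :=
    (h.cF i).comp continuous_clip.continuousOn fun y _ => hcl y
  refine this.congr fun y hy => ?_
  by_cases hc : y ∈ cpos 2
  · have : clip y = y := by ext j; rw [clip_apply, max_eq_right (hc j)]
    simp only [icq_pos _ hc, this]
  · rw [icq_off _ _ hc]
    have : ∃ m, y m < 0 := by
      by_contra hn; push Not at hn; exact hc hn
    obtain ⟨m, hm⟩ := this
    have hn : neg m := (hy m).resolve_right (by linarith)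
    exact (h.edge_zero hz hn (hcl y) (by rw [clip_apply, max_eq_left hm.le])).symm

lemma CD.step (h : CD F W V) (i : Fin 3) (neg : Fin 2 → Prop) (hz : ∀ m, neg m → ZeroF F W V (i.succAbove m)) :
    ∃ ζ G H, Pkg ζ G H ∧ ZeroF (fun e y => F e y - trF ζ e y) (fun e d y => W e d y - trW G e d y)
        (fun e d m y => V e d m y - trV H e d m y) i ∧ ∀ m, neg m → ZeroF (trF ζ) (trW G) (trV H) (i.succAbove m) := by
  obtain ⟨K, hK, hK1, hK2⟩ := exists_kerK neg
  obtain ⟨a, ha, ha1, ha2⟩ := exists_cut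
  have Hf : Admis neg (icq (F i)) (fun m => icq (W i (i.succAbove m))) :=
    admis_of_Q0 (h.lF i) (fun m => h.lW _ _) fun m => h.Q0F hz m
  have Hg : Admis neg (icq (W i i)) (fun m => icq (V i i m)) :=
    admis_of_Q0 (h.lW _ _) (fun m => h.lV _ _ _) fun m => h.Q0W hz m (Or.inl rfl)
  have Hm : ∀ m, Admis neg (icq (W i (i.succAbove m))) (fun m' => icq (V i (i.succAbove m') m)) := fun m =>
    admis_of_Q0 (h.lW _ _) (fun m => h.lV _ _ _) fun m' => h.Q0T hz m m'
  have hp := build_pkg (i := i) (fm := fun m => icq (W i (i.succAbove m))) (Vh := fun m m' => icq (V i (i.succAbove m') m))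
    hK ha Hf Hg Hm (h.cont_ext hz)
  have ht := fun y => build_tr (i := i) (f := icq (F i)) (g := icq (W i i)) (fm := fun m => icq (W i (i.succAbove m))) (Vi := fun m => icq (V i i m))
    (Vh := fun m m' => icq (V i (i.succAbove m') m)) hK hK1 hK2 ha ha1 ha2 y
  refine ⟨_, _, _, hp, ⟨?_, ?_, ?_⟩, fun m hm => ?_⟩
  · intro y hy
    simp only [trF, (ht y).1, icq_pos _ hy, sub_self]
  · intro d y hy
    have hy' := pos_subset_cpos 2 hy
    rcases Fin.eq_self_or_eq_succAbove i d with rfl | ⟨k, rfl⟩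
    · simp only [trW, (ht y).2.1, icq_pos _ hy', sub_self]
    · simp only [trW, (ht y).2.2.1 k, icq_pos _ hy', sub_self]
  · intro m d hd y hy
    have hy' := pos_subset_cpos 2 hy
    rcases hd with rfl | rfl
    · simp only [trV, (ht y).2.2.2.1 m, icq_pos _ hy', sub_self]
    · simp only [trV, (ht y).2.2.2.2 m, icq_pos _ hy', sub_self]
  · have hn := fun (y : En 2) (hy : 0 < y (m.predAbove i)) => build_neg (i := i) (a := a) (f := icq (F i)) (g := icq (W i i)) (fm := fun m => icq (W i (i.succAbove m))) (Vi := fun m => icq (V i i m))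
      (Vh := fun m m' => icq (V i (i.succAbove m') m)) hK (icq_off _) (icq_off _) (fun _ => icq_off _) (fun _ => icq_off _) (fun _ _ => icq_off _) hm hy
    refine ⟨fun y hy => ?_, fun d y hy => (hn y (hy _)).2.1 d, fun _ d _ y hy => (hn y (hy _)).2.2 d _⟩
    rcases (hy (m.predAbove i)).eq_or_lt with h0 | h0
    · have e : ins (i.succAbove m) 0 y = ins i 0 (pr i (ins (i.succAbove m) 0 y)) := by
        have := ins_pr i (ins (i.succAbove m) 0 y)
        rw [ins_lat, ← h0] at this
        exact this.symm
      have hc : pr i (ins (i.succAbove m) 0 y) ∈ cpos 2 := by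
        intro j; rw [pr_apply]; exact (ins_mem_cpos _ _ _).2 ⟨le_rfl, hy⟩ _
      unfold trF
      rw [e, (ht _).1, icq_pos _ hc]
      exact h.edge_zero hz hm hc (by simp)
    · exact (hn y h0).1

theorem CD.solve (h : CD F W V) : ∃ ζ G H, Pkg ζ G H ∧ ∀ e, (∀ y ∈ cpos 2, ζ (ins e 0 y) = F e y) ∧ ∀ d, ∀ y ∈ pos 2, G d (ins e 0 y) = W e d y := by
  obtain ⟨ζ0, G0, H0, p0, z0, -⟩ := h.step 0 (fun _ => False) (fun m hm => hm.elim)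
  obtain ⟨ζ1, G1, H1, p1, z1, n1⟩ := (h.sub p0.cd).step 1 (fun m => m = 0) (by rintro m rfl; exact z0)
  obtain ⟨ζ2, G2, H2, p2, z2, n2⟩ := ((h.sub p0.cd).sub p1.cd).step 2 (fun _ => True) (by
    intro m _
    fin_cases m
    · have n := n1 0 rfl
      change ZeroF _ _ _ 0
      change ZeroF _ _ _ 0 at n
      refine ⟨fun y hy => ?_, fun d y hy => ?_, fun m d hd y hy => ?_⟩
      · simp only [n.1 y hy, z0.1 y hy, sub_zero]
      · simp only [n.2.1 d y hy, z0.2.1 d y hy, sub_zero]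
      · simp only [n.2.2 m d hd y hy, z0.2.2 m d hd y hy, sub_zero]
    · exact z1)
  refine ⟨_, _, _, (p0.add p1).add p2, fun e => ?_⟩
  have n10 := n1 0 rfl
  have n20 := n2 0 trivial
  have n21 := n2 1 trivial
  change ZeroF _ _ _ 0 at n10 n20
  change ZeroF _ _ _ 1 at n21
  obtain rfl | rfl | rfl : e = 0 ∨ e = 1 ∨ e = 2 := by clear * -; revert e; decide
  · refine ⟨fun y hy => ?_, fun d y hy => ?_⟩
    · have a := z0.1 y hy; have b := n10.1 y hy; have c := n20.1 y hy
      simp only [trF] at a b c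
      linear_combination - a + b + c
    · have a := z0.2.1 d y hy; have b := n10.2.1 d y hy; have c := n20.2.1 d y hy
      simp only [trW] at a b c
      linear_combination - a + b + c
  · refine ⟨fun y hy => ?_, fun d y hy => ?_⟩
    · have a := z1.1 y hy; have c := n21.1 y hy
      simp only [trF] at a c
      linear_combination - a + c
    · have a := z1.2.1 d y hy; have c := n21.2.1 d y hy
      simp only [trW] at a c
      linear_combination - a + c
  · refine ⟨fun y hy => ?_, fun d y hy => ?_⟩
    · have a := z2.1 y hy
      simp only [trF] at a
      linear_combination - a
    · have a := z2.2.1 d y hy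
      simp only [trW] at a
      linear_combination - a
end

def sg (t : ℝ) : En 1 := EuclideanSpace.single 0 t

lemma ins_sg0 (t : ℝ) : (EuclideanSpace.single 1 t : En 2) = ins 0 0 (sg t) := by
  apply ext_succAbove 0
  · simp
  · intro k; rw [ins_succAbove]; fin_cases k; simp [sg]

lemma ins_sg1 (t : ℝ) : (EuclideanSpace.single 0 t : En 2) = ins 1 0 (sg t) := by
  apply ext_succAbove 1
  · simp
  · intro k; rw [ins_succAbove]; fin_cases k; simp [sg]

lemma sg_coord (t : En 1) : t = sg (t 0) := by
  ext j; fin_cases j; simp [sg]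

lemma exists_rep {u : En 2 → ℝ} (h : L2on quadrant u) : ∃ u', LQ u' ∧ u' =ᵐ[volume.restrict (pos 2)] u := by
  unfold L2on at h
  rw [quadrant_eq] at h
  refine ⟨h.1.mk u, ⟨h.1.stronglyMeasurable_mk.measurable, h.ae_eq h.1.ae_eq_mk⟩, h.1.ae_eq_mk.symm⟩

lemma weak_pair {u v u' v' : En 2 → ℝ} {m : Fin 2} (h : IsWeakD quadrant u v (EuclideanSpace.single m 1))
    (hu : u' =ᵐ[volume.restrict (pos 2)] u) (hv : v' =ᵐ[volume.restrict (pos 2)] v) (lu : LQ u') (lv : LQ v')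
    {θ : En 2 → ℝ} (hθ : IsTest θ) (hs : tsupport θ ⊆ pos 2) : ∫ y in pos 2, (u' y * pd m θ y + v' y * θ y) = 0 := by
  rw [integral_add (int_mul lu.2 ((hθ.pd m).memLp 2 _)) (int_mul lv.2 (hθ.memLp 2 _))]
  have := h θ hθ.1 hθ.2 (quadrant_eq ▸ hs)
  rw [quadrant_eq] at this
  have e1 : ∫ y in pos 2, u' y * pd m θ y = ∫ y in pos 2, u y * pd m θ y :=
    integral_congr_ae (by filter_upwards [hu] with y hy; rw [hy])
  have e2 : ∫ y in pos 2, v' y * θ y = ∫ y in pos 2, v y * θ y :=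
    integral_congr_ae (by filter_upwards [hv] with y hy; rw [hy])
  rw [e1, e2]
  change ∫ y in pos 2, u y * pd m θ y = _ at this
  rw [this]; ring

lemma qt_pair {u u' : En 2 → ℝ} {Du : Fin 2 → En 2 → ℝ} {v' : En 2 → ℝ} {b : Fin 2 → ℝ → ℝ} (h : QuadTrace u Du (b 0) (b 1)) (m : Fin 2)
    (hu : u' =ᵐ[volume.restrict (pos 2)] u) (hv : v' =ᵐ[volume.restrict (pos 2)] Du m) (e : Fin 3)
    {Θ : En 3 → ℝ} (hΘ : IsTest Θ) : edgeF e m u' v' Θ = - ∫ t in Ioi (0:ℝ), b m t * Θ (ins e 0 (ins m 0 (sg t))) := by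
  have h1 := h (fun y => Θ (ins e 0 y)) (hΘ.ins0 e).1 (hΘ.ins0 e).2 m
  rw [quadrant_eq] at h1
  have e1 : edgeF e m u' v' Θ = ∫ x in pos 2, (u x * fderiv ℝ (fun y => Θ (ins e 0 y)) x (stdb2 m) + Du m x * Θ (ins e 0 x)) := by
    unfold edgeF
    refine integral_congr_ae ?_
    filter_upwards [hu, hv] with y h1 h2
    rw [h1, h2, ← pd_ins0 e hΘ m y]
    rfl
  rw [e1, h1]
  obtain rfl | rfl : m = 0 ∨ m = 1 := by clear * -; revert m; decide
  · simp only [if_pos, ins_sg0]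
  · simp only [one_ne_zero, if_false, ins_sg1]

lemma closure_pos (n : ℕ) : closure (pos n) = cpos n := by
  apply subset_antisymm
  · exact closure_minimal (pos_subset_cpos n) (isClosed_cpos n)
  · intro x hx
    have ht : Filter.Tendsto (fun k : ℕ => x + (1 / ((k:ℝ) + 1)) • (WithLp.toLp 2 (fun _ => (1:ℝ)) : En n)) Filter.atTop (nhds x) := by
      have := ((tendsto_one_div_add_atTop_nhds_zero_nat (𝕜 := ℝ)).smul_const (WithLp.toLp 2 (fun _ => (1:ℝ)) : En n)).const_add x
      simpa using this
    refine mem_closure_of_tendsto ht (Filter.Eventually.of_forall fun k j => ?_)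
    have := hx j
    have h2 : 0 < 1 / ((k:ℝ) + 1) := by positivity
    simp only [PiLp.add_apply, PiLp.smul_apply, smul_eq_mul, mul_one]
    linarith

lemma icq_lq {f : En 2 → ℝ} (hc : ContinuousOn f (cpos 2)) (h2 : L2on quadrant f) : LQ (icq f) := by
  classical
  refine ⟨?_, ?_⟩
  · have : icq f = (cpos 2).piecewise f (fun _ => 0) := by
      ext y; by_cases h : y ∈ cpos 2 <;> simp [icq, h]
    rw [this]
    exact hc.measurable_piecewise continuousOn_const (isClosed_cpos 2).measurableSet
  · unfold L2on at h2
    rw [quadrant_eq] at h2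
    refine h2.ae_eq ((ae_restrict_iff' (measurableSet_pos 2)).2 (Filter.Eventually.of_forall fun y hy => ?_))
    exact (icq_pos f (pos_subset_cpos 2 hy)).symm

lemma cd_of_data (φ ψ : Fin 3 → En 2 → ℝ)
    (Gφ : Fin 3 → Fin 2 → E2 → ℝ) (Hφ : Fin 3 → Fin 2 → Fin 2 → E2 → ℝ)
    (Gψ : Fin 3 → Fin 2 → E2 → ℝ)
    (bGφ : Fin 3 → Fin 2 → Fin 2 → ℝ → ℝ) (bψ : Fin 3 → Fin 2 → ℝ → ℝ)
    (hφ : ∀ i, MemH2W quadrant (φ i) (Gφ i) (Hφ i))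
    (hφc : ∀ i, ContinuousOn (φ i) (cpos 2))
    (hψ : ∀ i, MemH1Q (ψ i) (Gψ i))
    (hbGφ : ∀ i d, QuadTrace (Gφ i d) (fun d' => Hφ i d d') (bGφ i d 0) (bGφ i d 1))
    (hbψ : ∀ i, QuadTrace (ψ i) (Gψ i) (bψ i 0) (bψ i 1))
    (hp : ∀ (e : Fin 3) (m : Fin 2) (t : ℝ), 0 ≤ t → φ e (ins m 0 (sg t)) = φ (e.succAbove m) (ins (m.predAbove e) 0 (sg t)))
    (hb : ∀ (e : Fin 3) (m : Fin 2), ∀ᵐ t ∂(volume.restrict (Ioi (0:ℝ))), bψ e m t = bGφ (e.succAbove m) (m.predAbove e) (m.predAbove e) t) :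
    ∃ F W V, CD F W V ∧ (∀ e, ∀ y ∈ cpos 2, F e y = φ e y) ∧
      ∀ e d, W e d =ᵐ[volume.restrict (pos 2)] Fin.insertNth (α := fun _ => En 2 → ℝ) e (ψ e) (Gφ e) d := by
  choose wG hwG aG using fun e m => exists_rep ((hφ e).2.1 m).1
  choose wH hwH aH using fun e m m' => exists_rep ((hφ e).2.2 m m').1
  choose wψ hwψ aψ using fun e => exists_rep (hψ e).1
  choose vψ hvψ bψ' using fun e m => exists_rep ((hψ e).2 m).1
  have hicq : ∀ e, icq (φ e) =ᵐ[volume.restrict (pos 2)] φ e := fun e =>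
    (ae_restrict_iff' (measurableSet_pos 2)).2 (Filter.Eventually.of_forall fun y hy => icq_pos _ (pos_subset_cpos 2 hy))
  have lF := fun e => icq_lq (hφc e) (hφ e).1
  obtain ⟨W, hWs, hWk⟩ : ∃ W : Fin 3 → Fin 3 → En 2 → ℝ, (∀ e, W e e = wψ e) ∧ ∀ e k, W e (e.succAbove k) = wG e k :=
    ⟨fun e d => Fin.insertNth (α := fun _ => En 2 → ℝ) e (wψ e) (wG e) d, fun e => by simp, fun e k => by simp⟩
  obtain ⟨V, hVs, hVk⟩ : ∃ V : Fin 3 → Fin 3 → Fin 2 → En 2 → ℝ, (∀ e m, V e e m = vψ e m) ∧ ∀ e k m, V e (e.succAbove k) m = wH e k m :=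
    ⟨fun e d => Fin.insertNth (α := fun _ => Fin 2 → En 2 → ℝ) e (vψ e) (wH e) d, fun e m => by simp, fun e k m => by simp⟩
  have lW : ∀ e d, LQ (W e d) := by
    intro e d
    rcases Fin.eq_self_or_eq_succAbove e d with rfl | ⟨k, rfl⟩
    · rw [hWs]; exact hwψ _
    · rw [hWk]; exact hwG _ _
  have lV : ∀ e d m, LQ (V e d m) := by
    intro e d m
    rcases Fin.eq_self_or_eq_succAbove e d with rfl | ⟨k, rfl⟩
    · rw [hVs]; exact hvψ _ _
    · rw [hVk]; exact hwH _ _ _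
  have wF : ∀ e m θ, IsTest θ → tsupport θ ⊆ pos 2 → ∫ y in pos 2, (icq (φ e) y * pd m θ y + W e (e.succAbove m) y * θ y) = 0 := by
    intro e m θ hθ hs
    rw [hWk]
    exact weak_pair ((hφ e).2.1 m).2 (hicq e) (aG e m) (lF e) (hwG _ _) hθ hs
  have cF : ∀ e, ContinuousOn (icq (φ e)) (cpos 2) := fun e => (hφc e).congr fun y hy => icq_pos _ hy
  have PF : ∀ (e : Fin 3) (m : Fin 2) (t : En 1), t ∈ cpos 1 → icq (φ e) (ins m 0 t) = icq (φ (e.succAbove m)) (ins (m.predAbove e) 0 t) := by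
    intro e m t ht
    rw [icq_pos _ ((ins_mem_cpos _ _ _).2 ⟨le_rfl, ht⟩), icq_pos _ ((ins_mem_cpos _ _ _).2 ⟨le_rfl, ht⟩), sg_coord t]
    exact hp e m _ (ht 0)
  have EFa : ∀ Θ, IsTest Θ → ∀ e m, edgeF e m (icq (φ e)) (W e (e.succAbove m)) Θ
      = - ∫ t in pos 1, icq (φ e) (ins m 0 t) * Θ (ins e 0 (ins m 0 t)) := by
    intro Θ hΘ e m
    have A := admis_nn (lF e) (fun m => lW e (e.succAbove m)) fun m θ hθ hs => wF e m θ hθ hs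
    have hc : ContinuousOn (icq (icq (φ e))) (cpos 2) := (cF e).congr fun y hy => icq_pos _ hy
    have := edge_cont A hc (hΘ.ins0 e) m
    have e1 : edgeF e m (icq (φ e)) (W e (e.succAbove m)) Θ = ∫ y in pos 2, (icq (icq (φ e)) y * pd m (fun y => Θ (ins e 0 y)) y + icq (W e (e.succAbove m)) y * Θ (ins e 0 y)) := by
      unfold edgeF
      refine setIntegral_congr_fun (measurableSet_pos 2) fun y hy => ?_
      have hy' := pos_subset_cpos 2 hy
      simp only [icq_pos _ hy', pd_ins0 e hΘ m y]
    rw [e1, this]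
    congr 1
    refine setIntegral_congr_fun (measurableSet_pos 1) fun t ht => ?_
    have hy' : ins m 0 t ∈ cpos 2 := (ins_mem_cpos _ _ _).2 ⟨le_rfl, pos_subset_cpos 1 ht⟩
    simp only [icq_pos _ hy']
  have EWa : ∀ Θ, IsTest Θ → ∀ e m, edgeF e m (W e e) (V e e m) Θ
    = edgeF (e.succAbove m) (m.predAbove e) (W (e.succAbove m) e) (V (e.succAbove m) e (m.predAbove e)) Θ := by
    intro Θ hΘ e m
    have e1 : W (e.succAbove m) e = wG (e.succAbove m) (m.predAbove e) := by
      rw [← hWk, Fin.succAbove_succAbove_predAbove]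
    have e2 : V (e.succAbove m) e (m.predAbove e) = wH (e.succAbove m) (m.predAbove e) (m.predAbove e) := by
      rw [← hVk, Fin.succAbove_succAbove_predAbove]
    rw [e1, e2, hWs, hVs, qt_pair (b := bψ e) (hbψ e) m (aψ e) (bψ' e m) e hΘ,
      qt_pair (b := bGφ (e.succAbove m) (m.predAbove e)) (hbGφ (e.succAbove m) (m.predAbove e)) (m.predAbove e) (aG _ _) (aH _ _ _) (e.succAbove m) hΘ]
    congr 1
    refine integral_congr_ae ?_
    filter_upwards [hb e m] with t ht
    rw [ht, ins_ins_comm]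
  refine ⟨fun e => icq (φ e), W, V, ⟨lF, lW, lV, wF, ?_, cF, PF, ?_, ?_⟩, fun e y hy => icq_pos _ hy, ?_⟩
  · intro e d m θ hθ hs
    rcases Fin.eq_self_or_eq_succAbove e d with rfl | ⟨k, rfl⟩
    · rw [hWs, hVs]
      exact weak_pair ((hψ d).2 m).2 (aψ d) (bψ' d m) (hwψ _) (hvψ _ _) hθ hs
    · rw [hWk, hVk]
      exact weak_pair ((hφ e).2.2 k m).2 (aG e k) (aH e k m) (hwG _ _) (hwH _ _ _) hθ hs
  · intro Θ hΘ e m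
    have h2 := EFa Θ hΘ (e.succAbove m) (m.predAbove e)
    rw [Fin.succAbove_succAbove_predAbove] at h2
    rw [EFa Θ hΘ e m, h2]
    congr 1
    refine setIntegral_congr_fun (measurableSet_pos 1) fun t ht => ?_
    simp only [PF e m t (pos_subset_cpos 1 ht), ins_ins_comm]
  · intro Θ hΘ e m d hd
    rcases hd with rfl | rfl
    · exact EWa Θ hΘ _ m
    · have h2 := EWa Θ hΘ (e.succAbove m) (m.predAbove e)
      have e1 : (m.predAbove e).predAbove (e.succAbove m) = m := by clear * -; revert e m; decide
      rw [Fin.succAbove_succAbove_predAbove, e1] at h2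
      exact h2.symm
  · intro e d
    rcases Fin.eq_self_or_eq_succAbove e d with rfl | ⟨k, rfl⟩
    · rw [hWs]; simpa using aψ d
    · rw [hWk]; simpa using aG e k

lemma IdsJ.weakD {u : En 3 → ℝ} {Du : Fin 3 → En 3 → ℝ} (h : IdsJ u Du) (d : Fin 3) :
    IsWeakD octant u (Du d) (EuclideanSpace.single d 1) := by
  intro θ h1 h2 hs
  have hθ : IsTest θ := ⟨h1, h2⟩
  rw [octant_eq] at hs ⊢
  have := h.2.2.T3 θ hθ d
  rw [integral_add (int_mul h.1.2.1 ((hθ.pd d).memLp 2 _)) (int_mul (h.2.1 d).2.1 (hθ.memLp 2 _))] at this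
  have e : ∀ y, θ (ins d 0 y) = 0 := fun y => image_eq_zero_of_notMem_tsupport fun hy => by
    have := hs hy d; simp at this
  simp only [e, mul_zero, integral_zero, neg_zero] at this
  exact eq_neg_of_add_eq_zero_left this

theorem octant_inverse_trace
    (φ ψ : Fin 3 → E2 → ℝ)
    (Gφ : Fin 3 → Fin 2 → E2 → ℝ) (Hφ : Fin 3 → Fin 2 → Fin 2 → E2 → ℝ)
    (Gψ : Fin 3 → Fin 2 → E2 → ℝ)
    (bGφ : Fin 3 → Fin 2 → Fin 2 → ℝ → ℝ) (bψ : Fin 3 → Fin 2 → ℝ → ℝ)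
    -- (φᵢ, ψᵢ) ∈ H²(ℝ₊×ℝ₊) × H¹(ℝ₊×ℝ₊), with continuous representatives of φᵢ,
    -- and with boundary traces of ∇φᵢ and ψᵢ on the two boundary half-lines
    (hφ : ∀ i, MemH2W quadrant (φ i) (Gφ i) (Hφ i))
    (hφc : ∀ i, ContinuousOn (φ i) (closure quadrant))
    (hψ : ∀ i, MemH1Q (ψ i) (Gψ i))
    (hbGφ : ∀ i d, QuadTrace (Gφ i d) (fun d' => Hφ i d d') (bGφ i d 0) (bGφ i d 1))
    (hbψ : ∀ i, QuadTrace (ψ i) (Gψ i) (bψ i 0) (bψ i 1))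
    -- compatibility conditions (A.8)–(A.16)
    (c1 : ∀ t : ℝ, 0 ≤ t → φ 0 (EuclideanSpace.single 1 t) = φ 1 (EuclideanSpace.single 1 t))
    (c2 : ∀ t : ℝ, 0 ≤ t → φ 1 (EuclideanSpace.single 0 t) = φ 2 (EuclideanSpace.single 0 t))
    (c3 : ∀ t : ℝ, 0 ≤ t → φ 2 (EuclideanSpace.single 1 t) = φ 0 (EuclideanSpace.single 0 t))
    (c4 : ∀ᵐ t ∂(volume.restrict (Ioi (0:ℝ))), bψ 0 0 t = bGφ 1 0 0 t)
    (c5 : ∀ᵐ t ∂(volume.restrict (Ioi (0:ℝ))), bψ 0 1 t = bGφ 2 0 0 t)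
    (c6 : ∀ᵐ t ∂(volume.restrict (Ioi (0:ℝ))), bψ 1 1 t = bGφ 2 1 1 t)
    (c7 : ∀ᵐ t ∂(volume.restrict (Ioi (0:ℝ))), bψ 1 0 t = bGφ 0 0 0 t)
    (c8 : ∀ᵐ t ∂(volume.restrict (Ioi (0:ℝ))), bψ 2 1 t = bGφ 1 1 1 t)
    (c9 : ∀ᵐ t ∂(volume.restrict (Ioi (0:ℝ))), bψ 2 0 t = bGφ 0 1 1 t) :
    ∃ (ζ : E3 → ℝ) (Gζ : Fin 3 → E3 → ℝ) (Hζ : Fin 3 → Fin 3 → E3 → ℝ)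
      (B : Fin 3 → Fin 3 → E2 → ℝ),
      -- ζ ∈ H^{5/2}(ℝ₊×ℝ₊×ℝ₊)
      MemH2W octant ζ Gζ Hζ ∧ (∀ d d', GagH12 octant (Hζ d d')) ∧
      ContinuousOn ζ (closure octant) ∧
      -- ζ = φᵢ on the face {x_i = 0}
      (∀ i : Fin 3, ∀ y : E2, 0 ≤ y 0 → 0 ≤ y 1 → ζ (embFace i y) = φ i y) ∧
      -- the boundary gradient on the face {x_i = 0} has normal component ψᵢ and
      -- tangential components ∇φᵢ
      (∀ i : Fin 3, B i i = ψ i ∧ ∀ m : Fin 2, B (i.succAbove m) i = Gφ i m) ∧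
      (∀ d : Fin 3, OctTrace (Gζ d) (fun d' => Hζ d d') (B d)) := by
  obtain ⟨F, W, V, hCD, hF, hW⟩ := cd_of_data φ ψ Gφ Hφ Gψ bGφ bψ hφ
    (fun i => by have := hφc i; rwa [quadrant_eq, closure_pos] at this) hψ hbGφ hbψ
    (by
      simp only [ins_sg0, ins_sg1] at c1 c2 c3
      intro e m t ht
      obtain rfl | rfl | rfl : e = 0 ∨ e = 1 ∨ e = 2 := by clear * -; revert e; decide
      · obtain rfl | rfl : m = 0 ∨ m = 1 := by clear * -; revert m; decide
        · exact c1 t ht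
        · exact (c3 t ht).symm
      · obtain rfl | rfl : m = 0 ∨ m = 1 := by clear * -; revert m; decide
        · exact (c1 t ht).symm
        · exact c2 t ht
      · obtain rfl | rfl : m = 0 ∨ m = 1 := by clear * -; revert m; decide
        · exact c3 t ht
        · exact (c2 t ht).symm)
    (by
      intro e m
      obtain rfl | rfl | rfl : e = 0 ∨ e = 1 ∨ e = 2 := by clear * -; revert e; decide
      · obtain rfl | rfl : m = 0 ∨ m = 1 := by clear * -; revert m; decide
        · exact c4
        · exact c5
      · obtain rfl | rfl : m = 0 ∨ m = 1 := by clear * -; revert m; decide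
        · exact c7
        · exact c6
      · obtain rfl | rfl : m = 0 ∨ m = 1 := by clear * -; revert m; decide
        · exact c9
        · exact c8)
  obtain ⟨ζ, G, H, hP, hT⟩ := hCD.solve
  refine ⟨ζ, G, H, fun d e => Fin.insertNth (α := fun _ => E2 → ℝ) e (ψ e) (Gφ e) d, ⟨?_, ?_, ?_⟩, ?_, ?_, ?_, ?_, ?_⟩
  · unfold L2on; rw [octant_eq]; exact hP.g.1.2.1
  · intro d
    refine ⟨?_, hP.g.weakD d⟩
    unfold L2on; rw [octant_eq]; exact (hP.g.2.1 d).2.1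
  · intro d d'
    refine ⟨?_, (hP.h d).weakD d'⟩
    unfold L2on; rw [octant_eq]; exact ((hP.h d).2.1 d').2.1
  · intro d d'
    exact (gag_iff (hP.gag d d').1).2 (hP.gag d d').2
  · rw [octant_eq, closure_pos]; exact hP.c
  · intro i y h0 h1
    have hy : y ∈ cpos 2 := by
      intro j
      obtain rfl | rfl : j = 0 ∨ j = 1 := by clear * -; revert j; decide
      · exact h0
      · exact h1
    rw [embFace_eq, (hT i).1 y hy, hF i y hy]
  · intro i
    exact ⟨by simp, fun m => by simp⟩
  · intro d θ h1 h2 d'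
    have := (hP.h d).2.2.T3 θ ⟨h1, h2⟩ d'
    rw [octant_eq, quadrant_eq]
    refine Eq.trans this ?_
    congr 1
    refine integral_congr_ae ?_
    filter_upwards [hW d' d, ae_restrict_mem (measurableSet_pos 2)] with y hy hyp
    rw [embFace_eq, (hT d').2 d y hyp, hy]
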